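/- arXiv:2312.06650 — 6 statements merged into one kernel-verified Lean document; each statement's English description precedes it below -/
import Mathlib

section
/- There is an absolute constant d_0 such that the following holds for every integer d ≥ d_0 and every δ > 0: there exist a threshold p_0, a real constant c > 0 and an integer K, all depending only on δ and d, such that for every prime p ≥ p_0 the following holds. Let H ⊆ 𝔽_p^d with |H| > δ·p^d and let ξ_1, ξ_2, ξ_3, ξ_4 : H → 𝔽_p^d be maps. Suppose there is a set U ⊆ {(h_1,h_2,h_3,h_4) ∈ H^4 : h_1 + h_2 = h_3 + h_4} with |U| > δ·|H|^3 such that ξ_1(h_1) + ξ_2(h_2) − ξ_3(h_3) − ξ_4(h_4) ∈ span_{𝔽_p}{h_1,h_2,h_3} for every (h_1,h_2,h_3,h_4) ∈ U. Then there exist a subset H' ⊆ H with |H'| ≥ c·p^d, a vector g ∈ 𝔽_p^d, and a map T : H' → 𝔽_p^d each of whose d coordinate functions is an almost linear Freiman homomorphism of complexity at most K, such that ξ_1(h) − T(h) − g ∈ span_{𝔽_p}{h} for all h ∈ H'. -/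
noncomputable section


/-- The real-valued auxiliary function `h ↦ ∑ i {α_i · τ(h)}·β_i`, where the `α_i` are the
vectors `(α' i)/p ∈ ((1/p)ℤ)^d` and the `β_i` are `(β' i)/p ∈ (1/p)ℤ`. -/
def alfAux (p d K : ℕ) (α : Fin K → Fin d → ℤ) (β : Fin K → ℤ) (h : Fin d → ZMod p) : ℝ :=
  ∑ i : Fin K,
    Int.fract (∑ j : Fin d, ((α i j : ℝ) / (p : ℝ)) * (((h j).val : ℕ) : ℝ)) *
      ((β i : ℝ) / (p : ℝ))

/-- `ξ : H → 𝔽_p` is an almost linear Freiman homomorphism of complexity at most `K`. -/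
def IsALFHom (p d K : ℕ) (H : Set (Fin d → ZMod p)) (ξ : (Fin d → ZMod p) → ZMod p) : Prop :=
  ∃ (α : Fin K → Fin d → ℤ) (β : Fin K → ℤ),
    (∀ h ∈ H, ∃ m : ℤ, (p : ℝ) * alfAux p d K α β h = (m : ℝ) ∧ ξ h = (m : ZMod p)) ∧
    (∀ h₁ ∈ H, ∀ h₂ ∈ H, ∀ h₃ ∈ H, ∀ h₄ ∈ H, h₁ + h₂ = h₃ + h₄ →
      ∃ z : ℤ, alfAux p d K α β h₁ + alfAux p d K α β h₂
        - alfAux p d K α β h₃ - alfAux p d K α β h₄ = (z : ℝ))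


open Classical in
def ind (P : Prop) : ℝ := if P then 1 else 0

lemma ind_true' {P : Prop} (h : P) : ind P = 1 := by simp [ind, h]
lemma ind_false' {P : Prop} (h : ¬ P) : ind P = 0 := by simp [ind, h]
lemma ind_nonneg (P : Prop) : 0 ≤ ind P := by unfold ind; split_ifs <;> norm_num
lemma ind_le_one (P : Prop) : ind P ≤ 1 := by unfold ind; split_ifs <;> norm_num
lemma ind_mono {P Q : Prop} (h : P → Q) : ind P ≤ ind Q := by
  by_cases hp : P
  · rw [ind_true' hp, ind_true' (h hp)]
  · rw [ind_false' hp]; exact ind_nonneg _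
lemma ind_and (P Q : Prop) : ind (P ∧ Q) = ind P * ind Q := by
  by_cases hp : P <;> by_cases hq : Q <;> simp [ind, hp, hq]
lemma ind_sq (P : Prop) : ind P * ind P = ind P := by
  by_cases hp : P <;> simp [ind, hp]

lemma sum_ind_card {X : Type*} [Fintype X] (P : X → Prop) [DecidablePred P] :
    ∑ x, ind (P x) = ((Finset.univ.filter P).card : ℝ) := by
  rw [Finset.card_filter]; push_cast
  refine Finset.sum_congr rfl fun x _ => ?_
  by_cases h : P x <;> simp [ind, h]

lemma exists_ge_avg {X : Type*} [Fintype X] [Nonempty X] (f : X → ℝ) (m : ℝ)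
    (h : m * Fintype.card X ≤ ∑ x, f x) : ∃ x, m ≤ f x := by
  by_contra! hc
  have : ∑ x, f x < ∑ _x : X, m := Finset.sum_lt_sum_of_nonempty Finset.univ_nonempty
    (fun x _ => hc x)
  simp only [Finset.sum_const, Finset.card_univ, nsmul_eq_mul] at this
  linarith

lemma popular_fibres {X : Type*} [Fintype X] (f : X → ℝ) (M ε : ℝ) (hM : 0 < M) (hε : 0 ≤ ε)
    (hf : ∀ x, f x ≤ M) (h : ε * Fintype.card X * M ≤ ∑ x, f x) :
    ε / 2 * Fintype.card X ≤ ∑ x, ind (ε / 2 * M ≤ f x) := by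
  have h1 : ∀ x, f x ≤ ε / 2 * M + M * ind (ε / 2 * M ≤ f x) := by
    intro x
    by_cases hx : ε / 2 * M ≤ f x
    · rw [ind_true' hx]; have := hf x; nlinarith
    · rw [ind_false' hx]; linarith
  have h2 := Finset.sum_le_sum (s := Finset.univ) fun x _ => h1 x
  rw [Finset.sum_add_distrib, ← Finset.mul_sum (f := fun x => ind (ε / 2 * M ≤ f x))] at h2
  simp only [Finset.sum_const, Finset.card_univ, nsmul_eq_mul] at h2
  have : (ε / 2 * Fintype.card X) * M ≤ (∑ x, ind (ε / 2 * M ≤ f x)) * M := by nlinarith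
  exact le_of_mul_le_mul_right this hM

lemma cs_card {X : Type*} [Fintype X] (f : X → ℝ) :
    (∑ x, f x) ^ 2 ≤ Fintype.card X * ∑ x, f x ^ 2 := by
  have := sq_sum_le_card_mul_sum_sq (s := (Finset.univ : Finset X)) (f := f)
  simpa using this

lemma popular {X Y : Type*} [Fintype X] [Fintype Y] [Nonempty X] [Nonempty Y]
    (E : X → Y → Prop) (B : X → X → Y → Y → Prop) (ε : ℝ) (hε : 0 < ε)
    (hE : ε * Fintype.card X * Fintype.card Y ≤ ∑ x, ∑ y, ind (E x y))
    (hB : ∑ x0, ∑ x, ∑ y0, ∑ y, ind (B x0 x y0 y) ≤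
      ε ^ 4 / 2 * (Fintype.card X) ^ 2 * (Fintype.card Y) ^ 2) :
    ∃ x0 y0, E x0 y0 ∧ ε ^ 4 / 2 * Fintype.card X * Fintype.card Y ≤
      ∑ x, ∑ y, ind (E x y ∧ E x0 y ∧ E x y0 ∧ ¬ B x0 x y0 y) := by
  set n : ℝ := (Fintype.card X : ℝ) with hn
  set m : ℝ := (Fintype.card Y : ℝ) with hm
  have hn0 : 0 < n := by rw [hn]; exact_mod_cast Fintype.card_pos
  have hm0 : 0 < m := by rw [hm]; exact_mod_cast Fintype.card_pos
  set e : X → Y → ℝ := fun x y => ind (E x y) with he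
  -- rectangles
  have hR : ∑ x0, ∑ x, (∑ y, e x0 y * e x y) ^ 2 =
      ∑ x0, ∑ x, ∑ y0, ∑ y, e x0 y0 * e x y0 * (e x0 y * e x y) := by
    refine Finset.sum_congr rfl fun x0 _ => Finset.sum_congr rfl fun x _ => ?_
    rw [sq, Finset.sum_mul_sum]
  have h1 : ∑ x0, ∑ x, ∑ y, e x0 y * e x y = ∑ y, (∑ x, e x y) ^ 2 := by
    calc _ = ∑ x0, ∑ y, ∑ x, e x0 y * e x y :=
          Finset.sum_congr rfl fun x0 _ => Finset.sum_comm
      _ = ∑ y, ∑ x0, ∑ x, e x0 y * e x y := Finset.sum_comm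
      _ = _ := by
        refine Finset.sum_congr rfl fun y _ => ?_
        rw [sq, Finset.sum_mul_sum]
  have h2 : (∑ y, ∑ x, e x y) ^ 2 ≤ m * ∑ y, (∑ x, e x y) ^ 2 := cs_card _
  have h3 : (∑ z : X × X, ∑ y, e z.1 y * e z.2 y) ^ 2 ≤
      (Fintype.card (X × X) : ℝ) * ∑ z : X × X, (∑ y, e z.1 y * e z.2 y) ^ 2 := cs_card _
  rw [Fintype.sum_prod_type, Fintype.sum_prod_type, Fintype.card_prod] at h3
  push_cast at h3
  rw [h1, hR] at h3
  rw [Finset.sum_comm] at h2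
  set R := ∑ x0, ∑ x, ∑ y0, ∑ y, e x0 y0 * e x y0 * (e x0 y * e x y) with hRdef
  have h4 : ε ^ 2 * n ^ 2 * m ≤ ∑ y, (∑ x, e x y) ^ 2 := by
    have : (ε * n * m) ^ 2 ≤ m * ∑ y, (∑ x, e x y) ^ 2 :=
      le_trans (pow_le_pow_left₀ (by positivity) hE 2) h2
    have h : m * (ε ^ 2 * n ^ 2 * m) ≤ m * ∑ y, (∑ x, e x y) ^ 2 := by
      calc _ = (ε * n * m) ^ 2 := by ring
        _ ≤ _ := this
    exact le_of_mul_le_mul_left h hm0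
  have h5 : ε ^ 4 * n ^ 2 * m ^ 2 ≤ R := by
    have : (ε ^ 2 * n ^ 2 * m) ^ 2 ≤ n * n * R :=
      le_trans (pow_le_pow_left₀ (by positivity) h4 2) h3
    have h : n * n * (ε ^ 4 * n ^ 2 * m ^ 2) ≤ n * n * R := by
      calc _ = (ε ^ 2 * n ^ 2 * m) ^ 2 := by ring
        _ ≤ _ := this
    exact le_of_mul_le_mul_left h (by positivity)
  have h6 : R - ∑ x0, ∑ x, ∑ y0, ∑ y, ind (B x0 x y0 y) ≤
      ∑ x0, ∑ y0, e x0 y0 * ∑ x, ∑ y, ind (E x y ∧ E x0 y ∧ E x y0 ∧ ¬ B x0 x y0 y) := by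
    have : ∑ x0, ∑ y0, e x0 y0 * ∑ x, ∑ y, ind (E x y ∧ E x0 y ∧ E x y0 ∧ ¬ B x0 x y0 y)
      = ∑ x0, ∑ x, ∑ y0, ∑ y, e x0 y0 * ind (E x y ∧ E x0 y ∧ E x y0 ∧ ¬ B x0 x y0 y) := by
      refine Finset.sum_congr rfl fun x0 _ => ?_
      rw [Finset.sum_comm]
      refine Finset.sum_congr rfl fun y0 _ => ?_
      rw [Finset.mul_sum]
      exact Finset.sum_congr rfl fun x _ => Finset.mul_sum _ _ _
    rw [this, hRdef]
    simp only [← Finset.sum_sub_distrib]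
    refine Finset.sum_le_sum fun x0 _ => Finset.sum_le_sum fun x _ => Finset.sum_le_sum fun y0 _ =>
      Finset.sum_le_sum fun y _ => ?_
    simp only [he]
    by_cases a1 : E x0 y0 <;> by_cases a2 : E x y0 <;> by_cases a3 : E x0 y <;>
      by_cases a4 : E x y <;> by_cases a5 : B x0 x y0 y <;> simp [ind, a1, a2, a3, a4, a5]
  have h7 : ε ^ 4 / 2 * n ^ 2 * m ^ 2 ≤ ∑ z : X × Y, e z.1 z.2 *
      ∑ x, ∑ y, ind (E x y ∧ E z.1 y ∧ E x z.2 ∧ ¬ B z.1 x z.2 y) := by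
    rw [Fintype.sum_prod_type]; linarith
  obtain ⟨⟨x0, y0⟩, h8⟩ := exists_ge_avg (fun z : X × Y => e z.1 z.2 *
      ∑ x, ∑ y, ind (E x y ∧ E z.1 y ∧ E x z.2 ∧ ¬ B z.1 x z.2 y)) (ε ^ 4 / 2 * n * m) (by
    rw [Fintype.card_prod]; push_cast
    refine le_trans (le_of_eq ?_) h7
    ring)
  simp only at h8
  have hpos : 0 < ε ^ 4 / 2 * n * m := by positivity
  by_cases hE0 : E x0 y0
  · refine ⟨x0, y0, hE0, ?_⟩
    simpa [he, ind_true' hE0] using h8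
  · simp [he, ind_false' hE0] at h8
    linarith

set_option linter.unusedSectionVars false

section lin
variable {F V : Type*} [Field F] [Fintype F] [AddCommGroup V] [Module F V] [Fintype V]

def Dep (F : Type*) {V : Type*} [Field F] [AddCommGroup V] [Module F V] (s x1 x2 x3 x4 : V) :
    Prop :=
  ∃ c0 c1 c2 c3 c4 : F, (c1 ≠ 0 ∨ c2 ≠ 0 ∨ c3 ≠ 0 ∨ c4 ≠ 0) ∧
    c0 • s + c1 • x1 + c2 • x2 + c3 • x3 + c4 • x4 = 0

lemma sum_ind_le_one_of_unique {X : Type*} [Fintype X] (P : X → Prop)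
    (h : ∀ x y, P x → P y → x = y) : ∑ x, ind (P x) ≤ 1 := by
  classical
  rw [sum_ind_card]
  have : (Finset.univ.filter P).card ≤ 1 := Finset.card_le_one.2 (by
    intro a ha b hb
    exact h a b (by simpa using ha) (by simpa using hb))
  exact_mod_cast this

lemma ind_exists_le {X : Type*} [Fintype X] (P : X → Prop) : ind (∃ x, P x) ≤ ∑ x, ind (P x) := by
  by_cases h : ∃ x, P x
  · obtain ⟨x, hx⟩ := h
    calc ind (∃ x, P x) ≤ 1 := ind_le_one _
      _ = ind (P x) := (ind_true' hx).symm
      _ ≤ _ := Finset.single_le_sum (f := fun x => ind (P x)) (fun i _ => ind_nonneg _)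
        (Finset.mem_univ x)
  · rw [ind_false' h]; exact Finset.sum_nonneg fun i _ => ind_nonneg _

lemma sum_lin_le (c : F) (hc : c ≠ 0) (r : V) : ∑ x : V, ind (c • x = r) ≤ 1 := by
  apply sum_ind_le_one_of_unique
  intro x y hx hy
  have : c • x = c • y := by rw [hx, hy]
  exact smul_right_injective V hc this

lemma sum4_le_of_inner (f : V → V → V → V → ℝ) (h : ∀ a b c, ∑ d, f a b c d ≤ 1) :
    ∑ a, ∑ b, ∑ c, ∑ d, f a b c d ≤ (Fintype.card V : ℝ) ^ 3 := by
  calc _ ≤ ∑ _a : V, ∑ _b : V, ∑ _c : V, (1 : ℝ) :=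
        Finset.sum_le_sum fun a _ => Finset.sum_le_sum fun b _ => Finset.sum_le_sum fun c _ => h a b c
    _ = _ := by simp; ring

lemma dep_count (s : V) : ∑ x1 : V, ∑ x2 : V, ∑ x3 : V, ∑ x4 : V, ind (Dep F s x1 x2 x3 x4) ≤
    (Fintype.card F : ℝ) ^ 5 * (Fintype.card V : ℝ) ^ 3 := by
  have h1 : ∀ x1 x2 x3 x4 : V, ind (Dep F s x1 x2 x3 x4) ≤ ∑ c : F × F × F × F × F,
      ind ((c.2.1 ≠ 0 ∨ c.2.2.1 ≠ 0 ∨ c.2.2.2.1 ≠ 0 ∨ c.2.2.2.2 ≠ 0) ∧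
    c.1 • s + c.2.1 • x1 + c.2.2.1 • x2 + c.2.2.2.1 • x3 + c.2.2.2.2 • x4 = 0) := by
    intro x1 x2 x3 x4
    refine le_trans (ind_mono ?_) (ind_exists_le _)
    rintro ⟨c0, c1, c2, c3, c4, h⟩
    exact ⟨(c0, c1, c2, c3, c4), h⟩
  calc _ ≤ ∑ x1 : V, ∑ x2 : V, ∑ x3 : V, ∑ x4 : V, ∑ c : F × F × F × F × F,
      ind ((c.2.1 ≠ 0 ∨ c.2.2.1 ≠ 0 ∨ c.2.2.2.1 ≠ 0 ∨ c.2.2.2.2 ≠ 0) ∧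
    c.1 • s + c.2.1 • x1 + c.2.2.1 • x2 + c.2.2.2.1 • x3 + c.2.2.2.2 • x4 = 0) :=
        Finset.sum_le_sum fun x1 _ => Finset.sum_le_sum fun x2 _ => Finset.sum_le_sum fun x3 _ =>
          Finset.sum_le_sum fun x4 _ => h1 x1 x2 x3 x4
    _ = ∑ c : F × F × F × F × F, ∑ x1 : V, ∑ x2 : V, ∑ x3 : V, ∑ x4 : V,
      ind ((c.2.1 ≠ 0 ∨ c.2.2.1 ≠ 0 ∨ c.2.2.2.1 ≠ 0 ∨ c.2.2.2.2 ≠ 0) ∧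
    c.1 • s + c.2.1 • x1 + c.2.2.1 • x2 + c.2.2.2.1 • x3 + c.2.2.2.2 • x4 = 0) := by
        simp only [Finset.sum_comm (s := (Finset.univ : Finset V))
          (t := (Finset.univ : Finset (F × F × F × F × F)))]
    _ ≤ ∑ c : F × F × F × F × F, (Fintype.card V : ℝ) ^ 3 := by
        refine Finset.sum_le_sum fun c _ => ?_
        obtain ⟨c0, c1, c2, c3, c4⟩ := c
        simp only
        by_cases k4 : c4 ≠ 0
        · refine sum4_le_of_inner _ fun a b c => ?_
          refine le_trans (Finset.sum_le_sum fun d _ => ind_mono ?_)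
            (sum_lin_le c4 k4 (-(c0 • s + c1 • a + c2 • b + c3 • c)))
          rintro ⟨-, h⟩
          exact eq_neg_of_add_eq_zero_right h
        by_cases k3 : c3 ≠ 0
        · have : ∀ a b : V, ∀ g : V → V → ℝ, ∑ x3, ∑ x4, g x3 x4 = ∑ x4, ∑ x3, g x3 x4 :=
            fun a b g => Finset.sum_comm
          simp_rw [fun a b : V => Finset.sum_comm (s := (Finset.univ : Finset V))
            (t := (Finset.univ : Finset V)) (f := fun x3 x4 => ind ((c1 ≠ 0 ∨ c2 ≠ 0 ∨ c3 ≠ 0 ∨ c4 ≠ 0) ∧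
              c0 • s + c1 • a + c2 • b + c3 • x3 + c4 • x4 = 0))]
          refine sum4_le_of_inner _ fun a b c => ?_
          refine le_trans (Finset.sum_le_sum fun d _ => ind_mono ?_)
            (sum_lin_le c3 k3 (-(c0 • s + c1 • a + c2 • b + c4 • c)))
          rintro ⟨-, h⟩
          apply eq_neg_of_add_eq_zero_right
          rw [← h]; abel
        by_cases k2 : c2 ≠ 0
        · have e : ∀ a : V, ∀ g : V → V → V → ℝ, ∑ x2, ∑ x3, ∑ x4, g x2 x3 x4 =
              ∑ x3, ∑ x4, ∑ x2, g x2 x3 x4 := fun a g => by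
            rw [Finset.sum_comm]
            exact Finset.sum_congr rfl fun x _ => Finset.sum_comm
          rw [Finset.sum_congr rfl fun a _ => e a _]
          refine sum4_le_of_inner _ fun a b c => ?_
          refine le_trans (Finset.sum_le_sum fun d _ => ind_mono ?_)
            (sum_lin_le c2 k2 (-(c0 • s + c1 • a + c3 • b + c4 • c)))
          rintro ⟨-, h⟩
          apply eq_neg_of_add_eq_zero_right
          rw [← h]; abel
        by_cases k1 : c1 ≠ 0
        · have e : ∀ g : V → V → V → V → ℝ, ∑ x1, ∑ x2, ∑ x3, ∑ x4, g x1 x2 x3 x4 =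
              ∑ x2, ∑ x3, ∑ x4, ∑ x1, g x1 x2 x3 x4 := fun g => by
            rw [Finset.sum_comm]
            refine Finset.sum_congr rfl fun x _ => ?_
            rw [Finset.sum_comm]
            exact Finset.sum_congr rfl fun x _ => Finset.sum_comm
          rw [e]
          refine sum4_le_of_inner _ fun a b c => ?_
          refine le_trans (Finset.sum_le_sum fun d _ => ind_mono ?_)
            (sum_lin_le c1 k1 (-(c0 • s + c2 • a + c3 • b + c4 • c)))
          rintro ⟨-, h⟩
          apply eq_neg_of_add_eq_zero_right
          rw [← h]; abel
        · have : ∀ a b c d : V, ind ((c1 ≠ 0 ∨ c2 ≠ 0 ∨ c3 ≠ 0 ∨ c4 ≠ 0) ∧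
            c0 • s + c1 • a + c2 • b + c3 • c + c4 • d = 0) = 0 := by
            intro a b c d
            apply ind_false'
            rintro ⟨h, -⟩
            tauto
          simp only [this, Finset.sum_const_zero]
          positivity
    _ = _ := by
        simp [Finset.sum_const, Fintype.card_prod]; ring

lemma dep_small (s : V) (ε : ℝ) (hq : 2 ≤ ε ^ 4 * Fintype.card F)
    (hN : (Fintype.card F) ^ 6 ≤ Fintype.card V) :
    ∑ x1 : V, ∑ x2 : V, ∑ x3 : V, ∑ x4 : V, ind (Dep F s x1 x2 x3 x4) ≤
      ε ^ 4 / 2 * (Fintype.card V : ℝ) ^ 2 * (Fintype.card V : ℝ) ^ 2 := by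
  refine le_trans (dep_count (F := F) s) ?_
  have h : (Fintype.card F : ℝ) ^ 6 ≤ Fintype.card V := by exact_mod_cast hN
  set q : ℝ := (Fintype.card F : ℝ)
  set N : ℝ := (Fintype.card V : ℝ)
  have hq0 : 0 ≤ q := by positivity
  have hN0 : 0 ≤ N := by positivity
  have : q ^ 5 ≤ ε ^ 4 / 2 * N := by
    have a1 : q ^ 5 * 1 ≤ q ^ 5 * (ε ^ 4 * q / 2) := by gcongr; linarith
    have a2 : ε ^ 4 / 2 * q ^ 6 ≤ ε ^ 4 / 2 * N := by gcongr
    nlinarith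
  calc q ^ 5 * N ^ 3 ≤ ε ^ 4 / 2 * N * N ^ 3 := by gcongr
    _ = _ := by ring

/-- lines in quotient meeting -/
lemma step1s (Hs : V → Prop) (s : V) (P Q : V → V) (U : V → V → Prop) (ε : ℝ) (hε : 0 < ε)
    (hq : 2 ≤ ε ^ 4 * Fintype.card F) (hN : (Fintype.card F) ^ 6 ≤ Fintype.card V)
    (hUs : ∀ x y, U x y → Hs x)
    (hU : ∀ x y, U x y → ∃ a b c : F, P x - Q y = a • s + b • x + c • y)
    (hc : ε * Fintype.card V * Fintype.card V ≤ ∑ x, ∑ y, ind (U x y)) :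
    ∃ w : V, ε ^ 4 / 2 * Fintype.card V ≤ ∑ x, ind (Hs x ∧ ∃ a b : F, P x - w = a • x + b • s) := by
  obtain ⟨x0, y0, h0, h1⟩ := popular U (fun x0 x y0 y => Dep F s x0 x y0 y) ε hε hc
    (dep_small s ε hq hN)
  obtain ⟨a, b, c, habc⟩ := hU _ _ h0
  refine ⟨P x0 - b • x0, ?_⟩
  have hN0 : (0 : ℝ) < Fintype.card V := by exact_mod_cast Fintype.card_pos
  refine le_of_mul_le_mul_right (le_trans h1 ?_) hN0
  rw [Finset.sum_mul]
  refine Finset.sum_le_sum fun x _ => ?_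
  have : ∀ y, ind (U x y ∧ U x0 y ∧ U x y0 ∧ ¬ Dep F s x0 x y0 y) ≤
      ind (Hs x ∧ ∃ a' b' : F, P x - (P x0 - b • x0) = a' • x + b' • s) := by
    intro y
    apply ind_mono
    rintro ⟨h2, h3, h4, h5⟩
    obtain ⟨a1, b1, c1, e1⟩ := hU _ _ h2
    obtain ⟨a2, b2, c2, e2⟩ := hU _ _ h3
    obtain ⟨a3, b3, c3, e3⟩ := hU _ _ h4
    have hcc : c = c3 := by
      by_contra hne
      apply h5
      refine ⟨a - a2 - a3 + a1, b - b2, b1 - b3, c - c3, c1 - c2, ?_, ?_⟩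
      · right; right; left; exact sub_ne_zero.2 hne
      · have : (P x0 - Q y0) - (P x0 - Q y) - (P x - Q y0) + (P x - Q y) = 0 := by abel
        rw [habc, e1, e2, e3] at this
        rw [← this]; module
    refine ⟨hUs _ _ h2, b3, a3 - a, ?_⟩
    have : P x - (P x0 - b • x0) = (P x - Q y0) - (P x0 - Q y0) + b • x0 := by abel
    rw [this, habc, e3, hcc]; module
  refine le_trans (Finset.sum_le_sum fun y _ => this y) ?_
  simp [mul_comm]

lemma step1 (Hs : V → Prop) (ξ₁ ξ₂ ξ₃ ξ₄ : V → V) (U : V → V → V → Prop) (ε : ℝ) (hε : 0 < ε)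
    (hq : 2 ≤ (ε / 2) ^ 4 * Fintype.card F) (hN : (Fintype.card F) ^ 6 ≤ Fintype.card V)
    (hUs : ∀ s x y, U s x y → Hs x)
    (hU : ∀ s x y, U s x y → ∃ a b c : F,
      (ξ₁ x + ξ₂ (s - x)) - (ξ₃ y + ξ₄ (s - y)) = a • s + b • x + c • y)
    (hc : ε * (Fintype.card V : ℝ) ^ 3 ≤ ∑ s, ∑ x, ∑ y, ind (U s x y)) :
    ∃ W : V → V, (ε / 2) ^ 5 / 2 * Fintype.card V * Fintype.card V ≤
      ∑ x, ∑ s, ind (Hs x ∧ ∃ a b : F, ξ₁ x + ξ₂ (s - x) - W s = a • x + b • (s - x)) := by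
  have hN0 : (0 : ℝ) < Fintype.card V := by exact_mod_cast Fintype.card_pos
  have hp := popular_fibres (fun s => ∑ x, ∑ y, ind (U s x y)) ((Fintype.card V : ℝ) ^ 2) ε
    (by positivity) hε.le (by
      intro s
      calc _ ≤ ∑ _x : V, ∑ _y : V, (1 : ℝ) := Finset.sum_le_sum fun x _ => Finset.sum_le_sum fun y _ =>
            ind_le_one _
        _ = _ := by simp; ring) (le_trans (le_of_eq (by ring)) hc)
  have : ∀ s, ∃ w : V, (ε / 2 * (Fintype.card V : ℝ) ^ 2 ≤ ∑ x, ∑ y, ind (U s x y)) →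
      (ε / 2) ^ 4 / 2 * Fintype.card V ≤
        ∑ x, ind (Hs x ∧ ∃ a b : F, ξ₁ x + ξ₂ (s - x) - w = a • x + b • s) := by
    intro s
    by_cases h : (ε / 2 * (Fintype.card V : ℝ) ^ 2 ≤ ∑ x, ∑ y, ind (U s x y))
    · obtain ⟨w, hw⟩ := step1s Hs s (fun x => ξ₁ x + ξ₂ (s - x)) (fun y => ξ₃ y + ξ₄ (s - y)) (U s)
        (ε / 2) (by positivity) hq hN (hUs s) (hU s) (le_trans (le_of_eq (by ring)) h)
      exact ⟨w, fun _ => hw⟩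
    · exact ⟨0, fun h' => absurd h' h⟩
  choose W hW using this
  refine ⟨W, ?_⟩
  rw [Finset.sum_comm]
  have key : ∀ s, (ε / 2) ^ 4 / 2 * Fintype.card V *
      ind (ε / 2 * (Fintype.card V : ℝ) ^ 2 ≤ ∑ x, ∑ y, ind (U s x y)) ≤
      ∑ x, ind (Hs x ∧ ∃ a b : F, ξ₁ x + ξ₂ (s - x) - W s = a • x + b • (s - x)) := by
    intro s
    by_cases h : (ε / 2 * (Fintype.card V : ℝ) ^ 2 ≤ ∑ x, ∑ y, ind (U s x y))
    · rw [ind_true' h, mul_one]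
      refine le_trans (hW s h) (Finset.sum_le_sum fun x _ => ind_mono ?_)
      rintro ⟨hx, a, b, hab⟩
      refine ⟨hx, a + b, b, ?_⟩
      rw [hab]; module
    · rw [ind_false' h, mul_zero]; exact Finset.sum_nonneg fun _ _ => ind_nonneg _
  refine le_trans ?_ (Finset.sum_le_sum fun s _ => key s)
  rw [← Finset.mul_sum]
  calc _ = (ε / 2) ^ 4 / 2 * Fintype.card V * (ε / 2 * Fintype.card V) := by ring
    _ ≤ _ := by gcongr

end lin

set_option linter.unusedSectionVars false
section lin2
variable {F V : Type*} [Field F] [Fintype F] [AddCommGroup V] [Module F V] [Fintype V]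

lemma sum_shift (f : V → ℝ) (t : V) : ∑ x, f x = ∑ x, f (t + x) :=
  (Equiv.sum_comp (Equiv.addLeft t) f).symm

lemma sum_reflect (f : V → ℝ) (t : V) : ∑ x, f x = ∑ x, f (t - x) :=
  (Equiv.sum_comp (Equiv.subLeft t) f).symm

lemma span4_count (y0 y1 y2 y3 : V) :
    ∑ x : V, ind (∃ a b c d : F, x = a • y0 + b • y1 + c • y2 + d • y3) ≤
      (Fintype.card F : ℝ) ^ 4 := by
  classical
  have h1 : ∀ x : V, ind (∃ a b c d : F, x = a • y0 + b • y1 + c • y2 + d • y3) ≤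
      ∑ c : F × F × F × F, ind (x = c.1 • y0 + c.2.1 • y1 + c.2.2.1 • y2 + c.2.2.2 • y3) := by
    intro x
    refine le_trans (ind_mono ?_) (ind_exists_le _)
    rintro ⟨a, b, c, d, h⟩
    exact ⟨(a, b, c, d), h⟩
  refine le_trans (Finset.sum_le_sum fun x _ => h1 x) ?_
  rw [Finset.sum_comm]
  refine le_trans (Finset.sum_le_sum (g := fun _ => (1 : ℝ)) fun c _ => ?_) ?_
  · apply sum_ind_le_one_of_unique
    intro x y hx hy
    rw [hx, hy]
  · simp [Fintype.card_prod]; apply le_of_eq; ring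

lemma step2 (f g W : V → V) (E : V → V → Prop) (a b : V → V → F) (ε : ℝ) (hε : 0 < ε)
    (hq : 2 ≤ ε ^ 4 * Fintype.card F) (hN : (Fintype.card F) ^ 6 ≤ Fintype.card V)
    (hE : ∀ x s, E x s → f x + g (s - x) - W s = a x s • x + b x s • (s - x))
    (hc : ε * Fintype.card V * Fintype.card V ≤ ∑ x, ∑ s, ind (E x s)) :
    ∃ l n : V → F, ε ^ 4 / 2 * Fintype.card V * Fintype.card V ≤
      ∑ x, ∑ s, ind (E x s ∧ a x s = l x - n s) := by
  set B : V → V → V → V → Prop := fun x x' s s' =>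
    E x s ∧ E x s' ∧ E x' s ∧ E x' s' ∧ a x s - a x s' - a x' s + a x' s' ≠ 0 with hB
  have hBc : ∑ x, ∑ x', ∑ s, ∑ s', ind (B x x' s s') ≤
      ε ^ 4 / 2 * (Fintype.card V : ℝ) ^ 2 * (Fintype.card V : ℝ) ^ 2 := by
    have e1 : ∑ x, ∑ x', ∑ s, ∑ s', ind (B x x' s s') =
        ∑ y1, ∑ y2, ∑ y3, ∑ x, ind (B x (x + y1 - y2) (x + y1) (x + y3)) := by
      have : ∀ x, ∑ x', ∑ s, ∑ s', ind (B x x' s s') =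
          ∑ y1, ∑ y2, ∑ y3, ind (B x (x + y1 - y2) (x + y1) (x + y3)) := by
        intro x
        rw [Finset.sum_comm, sum_shift _ x]
        refine Finset.sum_congr rfl fun y1 _ => ?_
        rw [sum_reflect _ (x + y1)]
        refine Finset.sum_congr rfl fun y2 _ => ?_
        rw [sum_shift _ x]
      rw [Finset.sum_congr rfl fun x _ => this x]
      rw [Finset.sum_comm]
      refine Finset.sum_congr rfl fun y1 _ => ?_
      rw [Finset.sum_comm]
      refine Finset.sum_congr rfl fun y2 _ => ?_
      rw [Finset.sum_comm]
    have e2 : ∀ y1 y2 y3 : V, ∑ x, ind (B x (x + y1 - y2) (x + y1) (x + y3)) ≤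
        (Fintype.card F : ℝ) ^ 4 := by
      intro y1 y2 y3
      by_cases hex : ∃ x0, B x0 (x0 + y1 - y2) (x0 + y1) (x0 + y3)
      · obtain ⟨x0, hx0⟩ := hex
        have expand : ∀ x, B x (x + y1 - y2) (x + y1) (x + y3) → ∃ k c1 c2 c3 : F, k ≠ 0 ∧
            g y1 - g y3 - g y2 + g (y3 - y1 + y2) = k • x + c1 • y1 + c2 • y2 + c3 • y3 := by
          rintro x ⟨h1, h2, h3, h4, h5⟩
          have k1 := hE _ _ h1
          have k2 := hE _ _ h2
          have k3 := hE _ _ h3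
          have k4 := hE _ _ h4
          rw [show x + y1 - x = y1 by abel] at k1
          rw [show x + y3 - x = y3 by abel] at k2
          rw [show x + y1 - (x + y1 - y2) = y2 by abel] at k3
          rw [show x + y3 - (x + y1 - y2) = y3 - y1 + y2 by abel] at k4
          generalize a x (x + y1) = a1 at *
          generalize a x (x + y3) = a2 at *
          generalize a (x + y1 - y2) (x + y1) = a3 at *
          generalize a (x + y1 - y2) (x + y3) = a4 at *
          generalize b x (x + y1) = b1 at *
          generalize b x (x + y3) = b2 at *
          generalize b (x + y1 - y2) (x + y1) = b3 at *
          generalize b (x + y1 - y2) (x + y3) = b4 at *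
          refine ⟨a1 - a2 - a3 + a4, b1 - a3 + a4 - b4, a3 - a4 - b3 + b4, - b2 + b4, h5, ?_⟩
          have : g y1 - g y3 - g y2 + g (y3 - y1 + y2) =
            (f x + g y1 - W (x + y1)) - (f x + g y3 - W (x + y3))
            - (f (x + y1 - y2) + g y2 - W (x + y1)) +
            (f (x + y1 - y2) + g (y3 - y1 + y2) - W (x + y3)) := by abel
          rw [this, k1, k2, k3, k4]
          module
        obtain ⟨k, c1, c2, c3, hk, hk'⟩ := expand x0 hx0
        refine le_trans (Finset.sum_le_sum fun x _ => ind_mono ?_) (span4_count (F := F) x0 y1 y2 y3)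
        intro hx
        obtain ⟨k', c1', c2', c3', hk0, hk1⟩ := expand x hx
        rw [hk'] at hk1
        refine ⟨k'⁻¹ * k, k'⁻¹ * (c1 - c1'), k'⁻¹ * (c2 - c2'), k'⁻¹ * (c3 - c3'), ?_⟩
        have : k' • x = k • x0 + (c1 - c1') • y1 + (c2 - c2') • y2 + (c3 - c3') • y3 := by
          have : k' • x = (k' • x + c1' • y1 + c2' • y2 + c3' • y3) -
            (c1' • y1 + c2' • y2 + c3' • y3) := by abel
          rw [this, ← hk1]; module
        rw [← inv_smul_smul₀ hk0 x, this]
        module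
      · push Not at hex
        rw [Finset.sum_congr rfl fun x _ => ind_false' (hex x)]
        simp
    rw [e1]
    have h : (Fintype.card F : ℝ) ^ 6 ≤ Fintype.card V := by exact_mod_cast hN
    refine le_trans (Finset.sum_le_sum fun y1 _ => Finset.sum_le_sum fun y2 _ =>
      Finset.sum_le_sum fun y3 _ => e2 y1 y2 y3) ?_
    simp only [Finset.sum_const, Finset.card_univ, nsmul_eq_mul]
    have hq1 : (1 : ℝ) ≤ Fintype.card F := by exact_mod_cast Fintype.card_pos
    set q : ℝ := (Fintype.card F : ℝ)
    set N : ℝ := (Fintype.card V : ℝ)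
    have hq0 : 0 ≤ q := by positivity
    have hN0 : 0 ≤ N := by positivity
    have : q ^ 4 ≤ ε ^ 4 / 2 * N := by
      have a1 : q ^ 5 * 1 ≤ q ^ 5 * (ε ^ 4 * q / 2) := by gcongr; linarith
      have a2 : ε ^ 4 / 2 * q ^ 6 ≤ ε ^ 4 / 2 * N := by gcongr
      have a3 : q ^ 4 ≤ q ^ 5 := pow_le_pow_right₀ hq1 (by norm_num)
      nlinarith
    calc N * (N * (N * q ^ 4)) ≤ N * (N * (N * (ε ^ 4 / 2 * N))) := by gcongr
      _ = _ := by ring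
  obtain ⟨x0, s0, h0, h1⟩ := popular E B ε hε hc hBc
  refine ⟨fun x => a x s0 - a x0 s0, fun s => - a x0 s, le_trans h1 ?_⟩
  refine Finset.sum_le_sum fun x _ => Finset.sum_le_sum fun s _ => ind_mono ?_
  rintro ⟨h2, h3, h4, h5⟩
  refine ⟨h2, ?_⟩
  by_contra hne
  apply h5
  refine ⟨h0, h3, h4, h2, ?_⟩
  intro h
  apply hne
  linear_combination h

lemma rect_count {X Y : Type*} [Fintype X] [Fintype Y] [Nonempty X] [Nonempty Y]
    (E : X → Y → Prop) (ε : ℝ) (hε : 0 < ε)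
    (hE : ε * Fintype.card X * Fintype.card Y ≤ ∑ x, ∑ y, ind (E x y)) :
    ε ^ 4 / 2 * (Fintype.card X) ^ 2 * (Fintype.card Y) ^ 2 ≤
    ∑ x0, ∑ x, ∑ y0, ∑ y, ind (E x0 y0 ∧ E x0 y ∧ E x y0 ∧ E x y) := by
  by_contra! h
  obtain ⟨x0, y0, h0, h1⟩ := popular E (fun x0 x y0 y => E x0 y0 ∧ E x0 y ∧ E x y0 ∧ E x y) ε hε hE
    h.le
  have : ∑ x, ∑ y, ind (E x y ∧ E x0 y ∧ E x y0 ∧ ¬ (E x0 y0 ∧ E x0 y ∧ E x y0 ∧ E x y)) = 0 := by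
    refine Finset.sum_eq_zero fun x _ => Finset.sum_eq_zero fun y _ => ind_false' ?_
    tauto
  rw [this] at h1
  have hn0 : (0 : ℝ) < Fintype.card X := by exact_mod_cast Fintype.card_pos
  have hm0 : (0 : ℝ) < Fintype.card Y := by exact_mod_cast Fintype.card_pos
  have : 0 < ε ^ 4 / 2 * Fintype.card X * Fintype.card Y := by positivity
  linarith

lemma step4 (f g W : V → V) (E : V → V → Prop) (k : V → F) (ε : ℝ) (hε : 0 < ε)
    (hq : 2 ≤ ((ε / 2) ^ 8 / 2) ^ 4 * Fintype.card F)
    (hN : (Fintype.card F) ^ 6 ≤ Fintype.card V)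
    (hE : ∀ x s, E x s → f x + g (s - x) - W s = k s • x)
    (hc : ε * Fintype.card V * Fintype.card V ≤ ∑ x, ∑ s, ind (E x s)) :
    ∃ k0 : F, ((ε / 2) ^ 8 / 2) ^ 4 / 2 * (ε / 2) * Fintype.card V * Fintype.card V ≤
      ∑ x, ∑ s, ind (E x s ∧ k s = k0) := by
  have hN0 : (0 : ℝ) < Fintype.card V := by exact_mod_cast Fintype.card_pos
  set N : ℝ := (Fintype.card V : ℝ) with hNdef
  set S : V → Prop := fun s => ε / 2 * N ≤ ∑ x, ind (E x s) with hS
  have hp : ε / 2 * N ≤ ∑ s, ind (S s) := popular_fibres (fun s => ∑ x, ind (E x s)) N ε hN0 hε.le (by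
      intro s
      calc _ ≤ ∑ _x : V, (1 : ℝ) := Finset.sum_le_sum fun x _ => ind_le_one _
        _ = _ := by simp [hNdef]) (by rw [Finset.sum_comm]; exact hc)
  have fib : ∀ s, ∀ P : V → Prop, ε / 2 * N * ind (S s ∧ P s) ≤ ∑ x, ind (E x s ∧ S s ∧ P s) := by
    intro s P
    by_cases h : S s ∧ P s
    · rw [ind_true' h, mul_one]
      refine le_trans h.1 (Finset.sum_le_sum fun x _ => ind_mono fun h' => ⟨h', h⟩)
    · rw [ind_false' h, mul_zero]; exact Finset.sum_nonneg fun _ _ => ind_nonneg _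
  have hc4 : (ε / 2) ^ 2 * N * N ≤ ∑ x, ∑ s, ind (E x s ∧ S s) := by
    rw [Finset.sum_comm]
    have : ∀ s, ε / 2 * N * ind (S s) ≤ ∑ x, ind (E x s ∧ S s) := fun s => by
      simpa using fib s (fun _ => True)
    refine le_trans ?_ (Finset.sum_le_sum fun s _ => this s)
    rw [← Finset.mul_sum]
    calc _ = ε / 2 * N * (ε / 2 * N) := by ring
      _ ≤ _ := by gcongr
  have hR := rect_count (fun x s => E x s ∧ S s) ((ε / 2) ^ 2) (by positivity) hc4
  set R : V → V → V → V → Prop := fun x x' s s' => (E x s ∧ S s) ∧ (E x s' ∧ S s') ∧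
    (E x' s ∧ S s) ∧ (E x' s' ∧ S s') with hRdef
  have e1 : ∑ x, ∑ x', ∑ s, ∑ s', ind (R x x' s s') =
      ∑ z : V × V, ∑ y1, ∑ y2, ind (R z.1 (z.1 + y1 - y2) (z.1 + y1) (z.2 + z.1 - y2)) := by
    rw [Fintype.sum_prod_type]
    refine Finset.sum_congr rfl fun x _ => ?_
    have c1 : ∑ x', ∑ s, ∑ s', ind (R x x' s s') =
        ∑ y1, ∑ y2, ∑ w, ind (R x (x + y1 - y2) (x + y1) (w + x - y2)) := by
      rw [Finset.sum_comm, sum_shift _ x]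
      refine Finset.sum_congr rfl fun y1 _ => ?_
      rw [sum_reflect _ (x + y1)]
      refine Finset.sum_congr rfl fun y2 _ => ?_
      rw [sum_shift _ (x - y2)]
      refine Finset.sum_congr rfl fun w _ => ?_
      rw [show x - y2 + w = w + x - y2 by abel]
    rw [c1]
    calc _ = ∑ y1, ∑ w, ∑ y2, ind (R x (x + y1 - y2) (x + y1) (w + x - y2)) :=
          Finset.sum_congr rfl fun _ _ => Finset.sum_comm
      _ = _ := Finset.sum_comm
  set η : ℝ := (ε / 2) ^ 8 / 2 with hη
  have hη0 : 0 < η := by positivity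
  obtain ⟨⟨x, w⟩, hxw⟩ := exists_ge_avg (fun z : V × V => ∑ y1, ∑ y2,
      ind (R z.1 (z.1 + y1 - y2) (z.1 + y1) (z.2 + z.1 - y2))) (η * N * N) (by
    rw [← e1, Fintype.card_prod]
    push_cast
    refine le_trans (le_of_eq ?_) hR
    rw [← hNdef, hη]; ring)
  simp only at hxw
  set D : V → V → Prop := fun y1 y2 => R x (x + y1 - y2) (x + y1) (w + x - y2) with hD
  obtain ⟨y10, y20, h0, h1⟩ := popular D (fun a b c d => Dep F 0 a b c d) η hη0 hxw
    (dep_small 0 η hq hN)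
  have hDk : ∀ y1 y2, D y1 y2 → (g y1 + g (w - y1)) - (g y2 + g (w - y2)) =
      (k (x + y1) - k (w + x - y2)) • (y2 - y1) := by
    rintro y1 y2 ⟨⟨h1, -⟩, ⟨h2, -⟩, ⟨h3, -⟩, ⟨h4, -⟩⟩
    have k1 := hE _ _ h1
    have k2 := hE _ _ h2
    have k3 := hE _ _ h3
    have k4 := hE _ _ h4
    rw [show x + y1 - x = y1 by abel] at k1
    rw [show w + x - y2 - x = w - y2 by abel] at k2
    rw [show x + y1 - (x + y1 - y2) = y2 by abel] at k3
    rw [show w + x - y2 - (x + y1 - y2) = w - y1 by abel] at k4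
    generalize k (x + y1) = κ1 at *
    generalize k (w + x - y2) = κ2 at *
    have : (g y1 + g (w - y1)) - (g y2 + g (w - y2)) = (f x + g y1 - W (x + y1)) -
      (f x + g (w - y2) - W (w + x - y2)) - (f (x + y1 - y2) + g y2 - W (x + y1)) +
      (f (x + y1 - y2) + g (w - y1) - W (w + x - y2)) := by abel
    rw [this, k1, k2, k3, k4]
    module
  set k0 := k (x + y10) with hk0
  have hcount : η ^ 4 / 2 * N ≤ ∑ s, ind (S s ∧ k s = k0) := by
    rw [sum_shift _ x]
    refine le_of_mul_le_mul_right (le_trans h1 ?_) hN0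
    rw [Finset.sum_mul]
    refine Finset.sum_le_sum fun y1 _ => ?_
    have : ∀ y2, ind (D y1 y2 ∧ D y10 y2 ∧ D y1 y20 ∧ ¬ Dep F 0 y10 y1 y20 y2) ≤
        ind (S (x + y1) ∧ k (x + y1) = k0) := by
      intro y2
      apply ind_mono
      rintro ⟨h2, h3, h4, h5⟩
      refine ⟨h2.1.2, ?_⟩
      have k00 := hDk _ _ h0
      have k11 := hDk _ _ h2
      have k01 := hDk _ _ h3
      have k10 := hDk _ _ h4
      rw [hk0]
      generalize k (x + y10) = κ10 at *
      generalize k (x + y1) = κ1 at *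
      generalize k (w + x - y20) = κ20 at *
      generalize k (w + x - y2) = κ2 at *
      by_contra hne
      apply h5
      refine ⟨0, -(κ10 - κ20) + (κ10 - κ2), (κ1 - κ20) - (κ1 - κ2), κ10 - κ1,
        (κ1 - κ2) - (κ10 - κ2), ?_, ?_⟩
      · right; right; left
        exact sub_ne_zero.2 (Ne.symm hne)
      · have : ((g y10 + g (w - y10)) - (g y20 + g (w - y20))) -
          ((g y1 + g (w - y1)) - (g y20 + g (w - y20))) + ((g y1 + g (w - y1)) - (g y2 + g (w - y2)))
          - ((g y10 + g (w - y10)) - (g y2 + g (w - y2))) = 0 := by abel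
        rw [k00, k11, k01, k10] at this
        rw [← this]
        module
    refine le_trans (Finset.sum_le_sum fun y2 _ => this y2) ?_
    simp [mul_comm]
  refine ⟨k0, ?_⟩
  rw [Finset.sum_comm]
  have : ∀ s, ε / 2 * N * ind (S s ∧ k s = k0) ≤ ∑ x, ind (E x s ∧ k s = k0) := fun s =>
    le_trans (fib s (fun s => k s = k0)) (Finset.sum_le_sum fun x _ => ind_mono fun h => ⟨h.1, h.2.2⟩)
  refine le_trans ?_ (Finset.sum_le_sum fun s _ => this s)
  rw [← Finset.mul_sum]
  calc _ = ε / 2 * N * (η ^ 4 / 2 * N) := by ring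
    _ ≤ _ := by gcongr

/-- Summary of steps 1-4. -/
lemma partA (ε : ℝ) (hε : 0 < ε) : ∃ ε' : ℝ, 0 < ε' ∧ ∃ q0 : ℕ,
    ∀ (F V : Type) [Field F] [Fintype F] [AddCommGroup V] [Module F V] [Fintype V],
    q0 ≤ Fintype.card F → (Fintype.card F) ^ 6 ≤ Fintype.card V →
    ∀ (Hs : V → Prop) (ξ₁ ξ₂ ξ₃ ξ₄ : V → V) (U : V → V → V → Prop),
    (∀ s x y, U s x y → Hs x) →
    (∀ s x y, U s x y → ∃ a b c : F,
      (ξ₁ x + ξ₂ (s - x)) - (ξ₃ y + ξ₄ (s - y)) = a • s + b • x + c • y) →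
    ε * (Fintype.card V : ℝ) ^ 3 ≤ ∑ s, ∑ x, ∑ y, ind (U s x y) →
    ∃ (l : V → F) (g W : V → V), ε' * Fintype.card V * Fintype.card V ≤
      ∑ x, ∑ s, ind (Hs x ∧ (ξ₁ x - l x • x) + g (s - x) = W s) := by
  set ε1 : ℝ := (ε / 2) ^ 5 / 2 with h1
  set ε2 : ℝ := ε1 ^ 4 / 2 with h2
  set ε3 : ℝ := ε2 ^ 4 / 2 with h3
  set ε4 : ℝ := ((ε3 / 2) ^ 8 / 2) ^ 4 / 2 * (ε3 / 2) with h4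
  have p1 : 0 < ε1 := by positivity
  have p2 : 0 < ε2 := by positivity
  have p3 : 0 < ε3 := by positivity
  have p4 : 0 < ε4 := by positivity
  obtain ⟨q0, hq0⟩ := exists_nat_ge (2 / (ε / 2) ^ 4 + 2 / ε1 ^ 4 + 2 / ε2 ^ 4 +
    2 / ((ε3 / 2) ^ 8 / 2) ^ 4)
  refine ⟨ε4, p4, q0, ?_⟩
  intro F V _ _ _ _ _ hq hN Hs ξ₁ ξ₂ ξ₃ ξ₄ U hUs hU hc
  have hqr : (q0 : ℝ) ≤ Fintype.card F := by exact_mod_cast hq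
  have z1 : 0 < 2 / (ε / 2) ^ 4 := by positivity
  have z2 : 0 < 2 / ε1 ^ 4 := by positivity
  have z3 : 0 < 2 / ε2 ^ 4 := by positivity
  have z4 : 0 < 2 / ((ε3 / 2) ^ 8 / 2) ^ 4 := by positivity
  have q1 : 2 ≤ (ε / 2) ^ 4 * Fintype.card F := by
    rw [mul_comm, ← div_le_iff₀ (by positivity)]; linarith
  have q2 : 2 ≤ ε1 ^ 4 * Fintype.card F := by
    rw [mul_comm, ← div_le_iff₀ (by positivity)]; linarith
  have q3 : 2 ≤ ε2 ^ 4 * Fintype.card F := by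
    rw [mul_comm, ← div_le_iff₀ (by positivity)]; linarith
  have q4 : 2 ≤ ((ε3 / 2) ^ 8 / 2) ^ 4 * Fintype.card F := by
    rw [mul_comm, ← div_le_iff₀ (by positivity)]; linarith
  obtain ⟨W, hW⟩ := step1 Hs ξ₁ ξ₂ ξ₃ ξ₄ U ε hε q1 hN hUs hU hc
  set E1 : V → V → Prop := fun x s => Hs x ∧ ∃ a b : F, ξ₁ x + ξ₂ (s - x) - W s = a • x + b • (s - x)
    with hE1
  have : ∀ x s, ∃ a b : F, E1 x s → ξ₁ x + ξ₂ (s - x) - W s = a • x + b • (s - x) := by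
    intro x s
    by_cases h : E1 x s
    · obtain ⟨-, a, b, hab⟩ := h
      exact ⟨a, b, fun _ => hab⟩
    · exact ⟨0, 0, fun h' => absurd h' h⟩
  choose a b hab using this
  obtain ⟨l, n, hl⟩ := step2 ξ₁ ξ₂ W E1 a b ε1 p1 q2 hN hab hW
  -- swap
  set E2 : V → V → Prop := fun y s => E1 (s - y) s ∧ a (s - y) s = l (s - y) - n s with hE2
  have hc2 : ε2 * Fintype.card V * Fintype.card V ≤ ∑ y, ∑ s, ind (E2 y s) := by
    refine le_trans hl (le_of_eq ?_)
    rw [Finset.sum_comm]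
    rw [Finset.sum_comm (f := fun y s => ind (E2 y s))]
    refine Finset.sum_congr rfl fun s _ => ?_
    rw [sum_reflect _ s]
  obtain ⟨m, n', hm⟩ := step2 ξ₂ (fun x => ξ₁ x - l x • x) (fun s => W s - n s • s) E2
    (fun y s => b (s - y) s + n s) (fun _ _ => (0 : F)) ε2 p2 q3 hN (by
      rintro y s ⟨h, h'⟩
      have := hab _ _ h
      rw [show s - (s - y) = y by abel, h'] at this
      have e : ξ₂ y + (ξ₁ (s - y) - l (s - y) • (s - y)) - (W s - n s • s) =
        (ξ₁ (s - y) + ξ₂ y - W s) - l (s - y) • (s - y) + n s • s := by abel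
      rw [e, this]
      module) hc2
  set E3 : V → V → Prop := fun x s => E2 (s - x) s ∧
    b (s - (s - x)) s + n s = m (s - x) - n' s with hE3
  have hc3 : ε3 * Fintype.card V * Fintype.card V ≤ ∑ x, ∑ s, ind (E3 x s) := by
    refine le_trans hm (le_of_eq ?_)
    rw [Finset.sum_comm]
    rw [Finset.sum_comm (f := fun y s => ind (E3 y s))]
    refine Finset.sum_congr rfl fun s _ => ?_
    rw [sum_reflect _ s]
  set f3 : V → V := fun x => ξ₁ x - l x • x with hf3
  set g3 : V → V := fun y => ξ₂ y - m y • y with hg3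
  set W3 : V → V := fun s => W s - n s • s - n' s • s with hW3
  have hE3' : ∀ x s, E3 x s → f3 x + g3 (s - x) - W3 s = n' s • x := by
    rintro x s ⟨⟨h1, h2⟩, h3⟩
    have := hab _ _ h1
    rw [show s - (s - x) = x by abel] at this h2 h3
    have h4 : b x s = m (s - x) - n' s - n s := by rw [← h3]; ring
    rw [h2, h4] at this
    have e : f3 x + g3 (s - x) - W3 s = (ξ₁ x + ξ₂ (s - x) - W s) - l x • x - m (s - x) • (s - x)
      + n s • s + n' s • s := by
      simp only [hf3, hg3, hW3]; abel
    rw [e, this]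
    module
  obtain ⟨k0, hk⟩ := step4 f3 g3 W3 E3 n' ε3 p3 q4 hN hE3' hc3
  refine ⟨fun x => l x + k0, g3, W3, le_trans hk ?_⟩
  refine Finset.sum_le_sum fun x _ => Finset.sum_le_sum fun s _ => ind_mono ?_
  rintro ⟨h, h'⟩
  have hHs : Hs x := by
    have := h.1.1.1
    rwa [show s - (s - x) = x by abel] at this
  refine ⟨hHs, ?_⟩
  have := hE3' _ _ h
  rw [h'] at this
  have e : ξ₁ x - (l x + k0) • x + g3 (s - x) - W3 s = (f3 x + g3 (s - x) - W3 s) - k0 • x := by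
    simp only [hf3]; module
  rw [← sub_eq_zero, e, this, sub_self]
end lin2

set_option linter.unusedSectionVars false
section bsg
variable {V : Type*} [AddCommGroup V] [Fintype V]

lemma bsg (E : V → V → Prop) (ε : ℝ) (hε : 0 < ε)
    (hE : ε * Fintype.card V * Fintype.card V ≤ ∑ x, ∑ y, ind (E x y)) :
    ∃ A : Finset V, ε / 4 * Fintype.card V ≤ A.card ∧ (∀ a ∈ A, ∃ y, E a y) ∧ ∀ a ∈ A, ∀ a' ∈ A,
      ε / 4 * (ε ^ 2 / 32) ^ 2 * (Fintype.card V : ℝ) ^ 3 ≤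
        ∑ a1, ∑ y, ∑ y', ind (E a y ∧ E a1 y ∧ E a1 y' ∧ E a' y') := by
  classical
  have hN0 : (0 : ℝ) < Fintype.card V := by exact_mod_cast Fintype.card_pos
  set N : ℝ := (Fintype.card V : ℝ) with hNdef
  set c : ℝ := ε ^ 2 / 32 with hc
  set com : V → V → ℝ := fun a a' => ∑ y, ind (E a y ∧ E a' y) with hcom
  have com_symm : ∀ a a', com a a' = com a' a := by
    intro a a'; simp only [hcom, and_comm]
  set Bad : V → V → Prop := fun a a' => com a a' < c * N with hBad
  set bd : V → ℝ := fun y => ∑ a, ∑ a', ind ((E a y ∧ E a' y) ∧ Bad a a') with hbd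
  have h1 : ε ^ 2 * N ^ 3 ≤ ∑ y, (∑ a, ind (E a y)) ^ 2 := by
    have := cs_card (fun y => ∑ a, ind (E a y))
    rw [Finset.sum_comm] at this
    have h : N * (ε ^ 2 * N ^ 3) ≤ N * ∑ y, (∑ a, ind (E a y)) ^ 2 := by
      refine le_trans ?_ this
      calc _ = (ε * N * N) ^ 2 := by ring
        _ ≤ _ := pow_le_pow_left₀ (by positivity) hE 2
    exact le_of_mul_le_mul_left h hN0
  have h2 : ∑ y, bd y ≤ c * N ^ 3 := by
    have : ∑ y, bd y = ∑ a, ∑ a', com a a' * ind (Bad a a') := by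
      simp only [hbd]
      rw [Finset.sum_comm]
      refine Finset.sum_congr rfl fun a _ => ?_
      rw [Finset.sum_comm]
      refine Finset.sum_congr rfl fun a' _ => ?_
      simp only [hcom]
      rw [Finset.sum_mul]
      refine Finset.sum_congr rfl fun y _ => ?_
      rw [ind_and]
    rw [this]
    calc _ ≤ ∑ _a : V, ∑ _a' : V, c * N := by
          refine Finset.sum_le_sum fun a _ => Finset.sum_le_sum fun a' _ => ?_
          by_cases h : Bad a a'
          · rw [ind_true' h, mul_one]; exact h.le
          · rw [ind_false' h, mul_zero]; positivity
      _ = _ := by simp [← hNdef]; ring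
  obtain ⟨y0, hy0⟩ := exists_ge_avg (fun y => (∑ a, ind (E a y)) ^ 2 - 16 * bd y) (ε ^ 2 / 2 * N ^ 2)
    (by
      rw [Finset.sum_sub_distrib, ← Finset.mul_sum, ← hNdef]
      have : c * N ^ 3 * 16 = ε ^ 2 / 2 * N ^ 3 := by rw [hc]; ring
      nlinarith)
  set d : ℝ := ∑ a, ind (E a y0) with hd
  have hbd0 : 0 ≤ bd y0 := Finset.sum_nonneg fun _ _ => Finset.sum_nonneg fun _ _ => ind_nonneg _
  have hd0 : 0 ≤ d := Finset.sum_nonneg fun _ _ => ind_nonneg _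
  have hd1 : ε / 2 * N ≤ d := by
    apply le_of_sq_le_sq _ hd0
    have : 0 ≤ ε ^ 2 * N ^ 2 := by positivity
    nlinarith
  have hdpos : 0 < d := lt_of_lt_of_le (by positivity) hd1
  have hb : bd y0 ≤ d ^ 2 / 16 := by
    have : 0 ≤ ε ^ 2 / 2 * N ^ 2 := by positivity
    linarith
  set β : V → ℝ := fun a => ∑ a', ind (E a' y0 ∧ Bad a a') with hβ
  have hbdβ : bd y0 = ∑ a, ind (E a y0) * β a := by
    simp only [hbd, hβ]
    refine Finset.sum_congr rfl fun a _ => ?_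
    rw [Finset.mul_sum]
    refine Finset.sum_congr rfl fun a' _ => ?_
    rw [← ind_and, and_assoc]
  refine ⟨Finset.univ.filter fun a => E a y0 ∧ β a ≤ d / 4, ?_, fun a ha => ⟨y0, (Finset.mem_filter.1 ha).2.1⟩, ?_⟩
  · rw [← sum_ind_card]
    have key : ∀ a, d / 4 * ind (E a y0) ≤ d / 4 * ind (E a y0 ∧ β a ≤ d / 4) +
        ind (E a y0) * β a := by
      intro a
      have hβ0 : 0 ≤ β a := Finset.sum_nonneg fun _ _ => ind_nonneg _
      by_cases h : E a y0
      · by_cases h' : β a ≤ d / 4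
        · rw [ind_true' h, ind_true' (⟨h, h'⟩ : E a y0 ∧ β a ≤ d / 4)]; linarith
        · rw [ind_true' h, ind_false' (fun h'' => h' h''.2)]; push Not at h'; linarith
      · rw [ind_false' h, ind_false' (fun h'' => h h''.1)]; simp
    have := Finset.sum_le_sum (s := Finset.univ) fun a _ => key a
    rw [Finset.sum_add_distrib, ← Finset.mul_sum, ← Finset.mul_sum, ← hbdβ, ← hd] at this
    have h3 : d / 4 * (3 / 4 * d) ≤ d / 4 * ∑ a, ind (E a y0 ∧ β a ≤ d / 4) := by nlinarith
    have := le_of_mul_le_mul_left h3 (by positivity)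
    have : 0 ≤ ε * N := by positivity
    linarith
  · intro a ha a' ha'
    simp only [Finset.mem_filter, Finset.mem_univ, true_and] at ha ha'
    have k1 : d / 2 ≤ ∑ a1, ind (E a1 y0 ∧ ¬ Bad a a1 ∧ ¬ Bad a' a1) := by
      have : ∀ a1, ind (E a1 y0) ≤ ind (E a1 y0 ∧ ¬ Bad a a1 ∧ ¬ Bad a' a1) +
          ind (E a1 y0 ∧ Bad a a1) + ind (E a1 y0 ∧ Bad a' a1) := by
        intro a1
        by_cases u1 : E a1 y0 <;> by_cases u2 : Bad a a1 <;> by_cases u3 : Bad a' a1 <;>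
          simp [ind, u1, u2, u3]
      have := Finset.sum_le_sum (s := Finset.univ) fun a _ => this a
      rw [Finset.sum_add_distrib, Finset.sum_add_distrib] at this
      have t1 := ha.2
      have t2 := ha'.2
      simp only [hβ] at t1 t2
      linarith
    have k2 : ∀ a1, (c * N) ^ 2 * ind (E a1 y0 ∧ ¬ Bad a a1 ∧ ¬ Bad a' a1) ≤
        ∑ y, ∑ y', ind (E a y ∧ E a1 y ∧ E a1 y' ∧ E a' y') := by
      intro a1
      have e : ∑ y, ∑ y', ind (E a y ∧ E a1 y ∧ E a1 y' ∧ E a' y') = com a a1 * com a1 a' := by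
        simp only [hcom]
        rw [Finset.sum_mul_sum]
        refine Finset.sum_congr rfl fun y _ => Finset.sum_congr rfl fun y' _ => ?_
        rw [← ind_and, and_assoc]
      rw [e]
      by_cases h : E a1 y0 ∧ ¬ Bad a a1 ∧ ¬ Bad a' a1
      · rw [ind_true' h, mul_one, sq]
        have g1 : c * N ≤ com a a1 := not_lt.1 h.2.1
        have g2 : c * N ≤ com a1 a' := by rw [com_symm]; exact not_lt.1 h.2.2
        have : 0 ≤ c * N := by positivity
        exact mul_le_mul g1 g2 this (this.trans g1)
      · rw [ind_false' h, mul_zero]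
        exact mul_nonneg (Finset.sum_nonneg fun _ _ => ind_nonneg _)
          (Finset.sum_nonneg fun _ _ => ind_nonneg _)
    refine le_trans ?_ (Finset.sum_le_sum fun a1 _ => k2 a1)
    rw [← Finset.mul_sum]
    calc _ = (c * N) ^ 2 * ((ε / 2 * N) / 2) := by ring
      _ ≤ (c * N) ^ 2 * (d / 2) := by gcongr
      _ ≤ _ := by gcongr

open scoped Pointwise in
lemma partB (Hs : V → Prop) (f g W : V → V) (ε : ℝ) (hε : 0 < ε) [DecidableEq V]
    (hE : ε * Fintype.card V * Fintype.card V ≤ ∑ x, ∑ s, ind (Hs x ∧ f x + g (s - x) = W s)) :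
    ∃ A : Finset V, ε / 4 * Fintype.card V ≤ A.card ∧ (∀ a ∈ A, Hs a) ∧
      ε / 4 * (ε ^ 2 / 32) ^ 2 *
        ((A.image fun a => (a, f a)) - (A.image fun a => (a, f a))).card ≤ Fintype.card V := by
  have hN0 : (0 : ℝ) < Fintype.card V := by exact_mod_cast Fintype.card_pos
  have hE' : ε * Fintype.card V * Fintype.card V ≤ ∑ x, ∑ y, ind (Hs x ∧ f x + g y = W (x + y)) := by
    refine le_trans hE (le_of_eq (Finset.sum_congr rfl fun x _ => ?_))
    rw [sum_shift _ x]
    refine Finset.sum_congr rfl fun y _ => ?_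
    rw [add_sub_cancel_left]
  obtain ⟨A, hA, hA3, hA2⟩ := bsg (fun x y => Hs x ∧ f x + g y = W (x + y)) ε hε hE'
  refine ⟨A, hA, fun a ha => (hA3 a ha).choose_spec.1, ?_⟩
  set D := (A.image fun a => (a, f a)) - (A.image fun a => (a, f a)) with hD
  have : ∀ z : V × V, ∃ a a' : V, z ∈ D → a ∈ A ∧ a' ∈ A ∧ z = (a - a', f a - f a') := by
    intro z
    by_cases hz : z ∈ D
    · obtain ⟨u, hu, v, hv, rfl⟩ := Finset.mem_sub.1 hz
      obtain ⟨a, ha, rfl⟩ := Finset.mem_image.1 hu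
      obtain ⟨a', ha', rfl⟩ := Finset.mem_image.1 hv
      exact ⟨a, a', fun _ => ⟨ha, ha', rfl⟩⟩
    · exact ⟨0, 0, fun h => absurd h hz⟩
  choose l r hlr using this
  set T : V × V → Finset (V × V × V) := fun z => Finset.univ.filter fun t =>
    f (l z) + g t.2.1 = W (l z + t.2.1) ∧ f t.1 + g t.2.1 = W (t.1 + t.2.1) ∧
    f t.1 + g t.2.2 = W (t.1 + t.2.2) ∧ f (r z) + g t.2.2 = W (r z + t.2.2) with hT
  have hTc : ∀ z ∈ D, ε / 4 * (ε ^ 2 / 32) ^ 2 * (Fintype.card V : ℝ) ^ 3 ≤ (T z).card := by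
    intro z hz
    obtain ⟨h1, h2, -⟩ := hlr z hz
    refine le_trans (hA2 _ h1 _ h2) ?_
    simp only [hT]
    rw [← sum_ind_card, Fintype.sum_prod_type]
    refine Finset.sum_le_sum fun a1 _ => ?_
    rw [Fintype.sum_prod_type]
    refine Finset.sum_le_sum fun y _ => Finset.sum_le_sum fun y' _ => ind_mono ?_
    tauto
  have hcard : (D.sigma T).card ≤ Fintype.card (V × V × V × V) := by
    rw [← Finset.card_univ]
    refine Finset.card_le_card_of_injOn (fun w => (l w.1 + w.2.2.1, w.2.1 + w.2.2.1, w.2.1 + w.2.2.2,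
      r w.1 + w.2.2.2)) (fun _ _ => Finset.mem_coe.2 (Finset.mem_univ _)) ?_
    rintro ⟨z, a1, y, y'⟩ hz ⟨z2, b1, u, u'⟩ hz2 heq
    simp only [Finset.coe_sigma, Set.mem_sigma_iff, Finset.mem_coe, hT, Finset.mem_filter,
      Finset.mem_univ, true_and] at hz hz2
    simp only [Prod.mk.injEq] at heq
    obtain ⟨hzD, t1, t2, t3, t4⟩ := hz
    obtain ⟨hzD2, r1, r2, r3, r4⟩ := hz2
    obtain ⟨e1, e2, e3, e4⟩ := heq
    have hz := (hlr z hzD).2.2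
    have hz2 := (hlr z2 hzD2).2.2
    have zz : z = z2 := by
      rw [hz, hz2]
      ext1
      · simp only
        calc l z - r z = (l z + y) - (a1 + y) + (a1 + y') - (r z + y') := by abel
          _ = _ := by rw [e1, e2, e3, e4]; abel
      · simp only
        calc f (l z) - f (r z) = (f (l z) + g y) - (f a1 + g y) + (f a1 + g y')
              - (f (r z) + g y') := by abel
          _ = (f (l z2) + g u) - (f b1 + g u) + (f b1 + g u') - (f (r z2) + g u') := by
            rw [t1, t2, t3, t4, r1, r2, r3, r4, e1, e2, e3, e4]
          _ = _ := by abel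
    subst zz
    have hy : y = u := add_left_cancel e1
    subst hy
    have ha : a1 = b1 := add_right_cancel e2
    subst ha
    have hy' : y' = u' := add_left_cancel e3
    subst hy'
    rfl
  have hcard' : ((D.sigma T).card : ℝ) ≤ (Fintype.card V : ℝ) ^ 4 := by
    have h : ((D.sigma T).card : ℝ) ≤ ((Fintype.card (V × V × V × V) : ℕ) : ℝ) := by exact_mod_cast hcard
    refine h.trans (le_of_eq ?_)
    simp only [Fintype.card_prod]; push_cast; ring
  rw [Finset.card_sigma] at hcard'
  push_cast at hcard'
  have h5 : (D.card : ℝ) * (ε / 4 * (ε ^ 2 / 32) ^ 2 * (Fintype.card V : ℝ) ^ 3) ≤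
      ∑ z ∈ D, ((T z).card : ℝ) := by
    rw [← nsmul_eq_mul]
    exact Finset.card_nsmul_le_sum _ _ _ hTc
  refine le_of_mul_le_mul_right (a := (Fintype.card V : ℝ) ^ 3) ?_ (by positivity)
  calc _ = (D.card : ℝ) * (ε / 4 * (ε ^ 2 / 32) ^ 2 * (Fintype.card V : ℝ) ^ 3) := by ring
    _ ≤ _ := h5
    _ ≤ _ := hcard'
    _ = _ := by ring
end bsg

section partC
open scoped Pointwise

def gr {V : Type*} [DecidableEq V] (f : V → V) (A : Finset V) : Finset (V × V) :=
  A.image fun a => (a, f a)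

lemma mem_gr {V : Type*} [DecidableEq V] {f : V → V} {A : Finset V} {a : V} (h : a ∈ A) :
    (a, f a) ∈ gr f A := Finset.mem_image_of_mem _ h

lemma card_gr {V : Type*} [DecidableEq V] (f : V → V) (A : Finset V) : (gr f A).card = A.card :=
  Finset.card_image_of_injective _ fun _ _ h => (Prod.mk.inj h).1

lemma gr_mono {V : Type*} [DecidableEq V] (f : V → V) {A B : Finset V} (h : A ⊆ B) :
    gr f A ⊆ gr f B := Finset.image_subset_image h

lemma card_X {V : Type*} [AddCommGroup V] [Fintype V] [DecidableEq V] (f : V → V) (A : Finset V)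
    (α κ : ℝ) (hα : 0 < α) (hκ : 0 < κ) (h1 : α * Fintype.card V ≤ A.card)
    (h2 : κ * (gr f A - gr f A).card ≤ Fintype.card V) (X : Finset V)
    (hX : ∀ z ∈ X, ((0, z) : V × V) ∈ 6 • gr f A - 6 • gr f A) :
    (X.card : ℝ) ≤ (1 / (κ * α)) ^ 13 / α := by
  have hN0 : (0 : ℝ) < Fintype.card V := by exact_mod_cast Fintype.card_pos
  have hA0 : (0 : ℝ) < A.card := lt_of_lt_of_le (by positivity) h1
  have hAne : A.Nonempty := Finset.card_pos.1 (by exact_mod_cast hA0)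
  have hΓ : (gr f A).Nonempty := hAne.image _
  have hpr := Finset.pluennecke_ruzsa_inequality_nsmul_sub_nsmul_sub hΓ (gr f A) 7 6
  have hpr' : ((7 • gr f A - 6 • gr f A).card : ℝ) ≤
      ((gr f A - gr f A).card / (gr f A).card : ℝ) ^ (7 + 6) * (gr f A).card := by
    have := (NNRat.cast_le (K := ℝ)).2 hpr
    push_cast at this
    exact this
  rw [card_gr] at hpr'
  have hle : (A.card : ℝ) ≤ Fintype.card V := by exact_mod_cast Finset.card_le_univ A
  have h3 : ((gr f A - gr f A).card / A.card : ℝ) ≤ 1 / (κ * α) := by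
    rw [div_le_div_iff₀ hA0 (by positivity)]
    nlinarith
  have h4 : ((7 • gr f A - 6 • gr f A).card : ℝ) ≤ (1 / (κ * α)) ^ 13 * Fintype.card V := by
    refine hpr'.trans ?_
    gcongr
  have h5 : (X ×ˢ A).card ≤ (7 • gr f A - 6 • gr f A).card := by
    refine Finset.card_le_card_of_injOn (fun w => (w.2, w.1 + f w.2)) ?_ ?_
    · rintro ⟨z, a⟩ h
      obtain ⟨hz, ha⟩ := Finset.mem_product.1 (Finset.mem_coe.1 h)
      obtain ⟨u, hu, v, hv, huv⟩ := Finset.mem_sub.1 (hX z hz)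
      refine Finset.mem_coe.2 (Finset.mem_sub.2 ⟨u + (a, f a), ?_, v, hv, ?_⟩)
      · rw [show (7 : ℕ) = 6 + 1 from rfl, succ_nsmul]
        exact Finset.add_mem_add hu (mem_gr ha)
      · rw [add_sub_right_comm, huv]; simp
    · rintro ⟨z, a⟩ _ ⟨z', a'⟩ _ h
      simp only [Prod.mk.injEq] at h
      obtain ⟨rfl, h⟩ := h
      simpa using h
  rw [Finset.card_product] at h5
  have h6 : (X.card : ℝ) * A.card ≤ ((7 • gr f A - 6 • gr f A).card : ℝ) := by exact_mod_cast h5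
  rw [le_div_iff₀ hα]
  refine le_of_mul_le_mul_right (a := (Fintype.card V : ℝ)) ?_ hN0
  calc _ = (X.card : ℝ) * (α * Fintype.card V) := by ring
    _ ≤ X.card * A.card := by gcongr
    _ ≤ _ := h6.trans h4

lemma dot_count (p d : ℕ) [Fact p.Prime] (z : Fin d → ZMod p) (hz : z ≠ 0) (B : ZMod p → Prop) :
    (p : ℝ) * ∑ r : Fin d → ZMod p, ind (B (∑ i, r i * z i)) = (p : ℝ) ^ d * ∑ t, ind (B t) := by
  obtain ⟨i, hi⟩ := Function.ne_iff.1 hz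
  have hi : z i ≠ 0 := hi
  have e1 : ∀ t : ZMod p, ∑ r : Fin d → ZMod p, ind (B (∑ i, r i * z i)) =
      ∑ r : Fin d → ZMod p, ind (B (∑ i, r i * z i + z i * t)) := by
    intro t
    rw [sum_shift _ (Pi.single i t)]
    refine Finset.sum_congr rfl fun r _ => ?_
    congr 2
    simp only [Pi.add_apply, add_mul, Finset.sum_add_distrib]
    rw [add_comm]; congr 1
    simp [Pi.single_apply, mul_comm]
  have : (p : ℝ) * ∑ r : Fin d → ZMod p, ind (B (∑ i, r i * z i)) =
      ∑ _t : ZMod p, ∑ r : Fin d → ZMod p, ind (B (∑ i, r i * z i)) := by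
    simp [ZMod.card]
  rw [this, Finset.sum_congr rfl fun t _ => e1 t, Finset.sum_comm]
  have e2 : ∀ r : Fin d → ZMod p, ∑ t, ind (B (∑ i, r i * z i + z i * t)) = ∑ t, ind (B t) := by
    intro r
    rw [← Equiv.sum_comp ((Equiv.mulLeft₀ (z i) hi).trans (Equiv.addLeft (∑ i, r i * z i)))
      (fun t => ind (B t))]
    rfl
  rw [Finset.sum_congr rfl fun r _ => e2 r]
  simp [ZMod.card]

/-- small residues -/
def SmallRes (p M : ℕ) (t : ZMod p) : Prop := ∃ k : ℤ, (k : ZMod p) = t ∧ |k| * M < 6 * p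

lemma small_count (p M : ℕ) [Fact p.Prime] (hM : 0 < M) (hpM : M ≤ p) :
    ∑ t, ind (SmallRes p M t) ≤ 13 * p / M := by
  classical
  have hM' : (0 : ℝ) < M := by exact_mod_cast hM
  have hpM' : (M : ℝ) ≤ p := by exact_mod_cast hpM
  set L : ℤ := 6 * p / M with hL
  have hL0 : 0 ≤ L := by positivity
  rw [sum_ind_card]
  have h1 : (Finset.univ.filter fun t => SmallRes p M t).card ≤ (Finset.Icc (-L) L).card := by
    have : (Finset.univ.filter fun t => SmallRes p M t) ⊆
        (Finset.Icc (-L) L).image (fun k : ℤ => (k : ZMod p)) := by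
      intro t ht
      obtain ⟨k, hk, hk2⟩ := (Finset.mem_filter.1 ht).2
      refine Finset.mem_image.2 ⟨k, ?_, hk⟩
      have : |k| ≤ L := (Int.le_ediv_iff_mul_le (by exact_mod_cast hM)).2 hk2.le
      rw [Finset.mem_Icc]; exact abs_le.1 this
    exact (Finset.card_le_card this).trans Finset.card_image_le
  have h2 : ((Finset.Icc (-L) L).card : ℝ) = 2 * L + 1 := by
    have : ((Finset.Icc (-L) L).card : ℤ) = 2 * L + 1 := by
      rw [Int.card_Icc, Int.toNat_of_nonneg (by linarith)]; ring
    exact_mod_cast this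
  have h3 : (L : ℝ) * M ≤ 6 * p := by
    have : L * M ≤ 6 * p := Int.ediv_mul_le _ (by exact_mod_cast hM.ne')
    exact_mod_cast this
  have h1' : ((Finset.univ.filter fun t => SmallRes p M t).card : ℝ) ≤ 2 * L + 1 := by
    rw [← h2]; exact_mod_cast h1
  refine h1'.trans ?_
  rw [le_div_iff₀ hM']; nlinarith

lemma exists_r (p d M : ℕ) [Fact p.Prime] (hM : 0 < M) (hpM : M ≤ p) (X : Finset (Fin d → ZMod p))
    (hX : (X.card : ℝ) * 13 < M) :
    ∃ r : Fin d → ZMod p, ∀ z ∈ X, z ≠ 0 → ¬ SmallRes p M (∑ i, r i * z i) := by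
  by_contra! h
  have hp : (0 : ℝ) < p := by exact_mod_cast (Fact.out : p.Prime).pos
  have hM' : (0 : ℝ) < M := by exact_mod_cast hM
  have h1 : ∀ r : Fin d → ZMod p, (1 : ℝ) ≤ ∑ z ∈ X, ind (z ≠ 0 ∧ SmallRes p M (∑ i, r i * z i)) := by
    intro r
    obtain ⟨z, hz, hz0, hs⟩ := h r
    rw [← ind_true' (⟨hz0, hs⟩ : z ≠ 0 ∧ SmallRes p M (∑ i, r i * z i))]
    exact Finset.single_le_sum (f := fun z => ind (z ≠ 0 ∧ SmallRes p M (∑ i, r i * z i)))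
      (fun _ _ => ind_nonneg _) hz
  have h2 := Finset.sum_le_sum (s := Finset.univ) fun r _ => h1 r
  rw [Finset.sum_comm] at h2
  have h3 : ∀ z ∈ X, ∑ r : Fin d → ZMod p, ind (z ≠ 0 ∧ SmallRes p M (∑ i, r i * z i)) ≤
      (p : ℝ) ^ d * 13 / M := by
    intro z _
    by_cases hz : z = 0
    · rw [Finset.sum_congr rfl fun r _ => ind_false' (fun h => h.1 hz)]
      simp only [Finset.sum_const_zero]; positivity
    · refine le_of_mul_le_mul_left (a := (p : ℝ)) ?_ hp
      refine le_trans (mul_le_mul_of_nonneg_left (Finset.sum_le_sum fun r _ => ind_mono And.right) hp.le) ?_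
      rw [dot_count p d z hz]
      calc _ ≤ (p : ℝ) ^ d * (13 * p / M) := by gcongr; exact small_count p M hM hpM
        _ = _ := by ring
  have h4 := h2.trans (Finset.sum_le_sum h3)
  simp only [Finset.sum_const, Finset.card_univ, Fintype.card_fun, ZMod.card, Fintype.card_fin,
    nsmul_eq_mul, mul_one] at h4
  push_cast at h4
  have hpd : (0 : ℝ) < (p : ℝ) ^ d := by positivity
  have : (p : ℝ) ^ d * M ≤ (p : ℝ) ^ d * (X.card * 13) := by
    have := mul_le_mul_of_nonneg_right h4 hM'.le
    refine this.trans (le_of_eq ?_)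
    field_simp
  have := le_of_mul_le_mul_left this hpd
  linarith

lemma nsmul_cell (p d M : ℕ) [Fact p.Prime] (f : (Fin d → ZMod p) → (Fin d → ZMod p))
    (A : Finset (Fin d → ZMod p)) (r : Fin d → ZMod p) (c : ℕ)
    (hc : ∀ a ∈ A, (c : ℤ) * p ≤ ((∑ i, r i * f a i).val : ℤ) * M ∧
      ((∑ i, r i * f a i).val : ℤ) * M < (c + 1) * p) (k : ℕ) :
    ∀ w ∈ k • gr f A, ∃ t : ℤ, (t : ZMod p) = ∑ i, r i * w.2 i ∧
      k * (c : ℤ) * p ≤ t * M ∧ t * M ≤ k * (c + 1) * p ∧ (0 < k → t * M < k * (c + 1) * p) := by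
  induction k with
  | zero =>
    intro w hw
    rw [zero_nsmul, Finset.mem_zero] at hw
    exact ⟨0, by simp [hw], by simp⟩
  | succ k ih =>
    intro w hw
    rw [succ_nsmul] at hw
    obtain ⟨u, hu, v, hv, rfl⟩ := Finset.mem_add.1 hw
    obtain ⟨a, ha, rfl⟩ := Finset.mem_image.1 hv
    obtain ⟨t, ht, h1, h2, -⟩ := ih u hu
    obtain ⟨h3, h4⟩ := hc a ha
    have : t * M + ((∑ i, r i * f a i).val : ℤ) * M < ((k + 1 : ℕ) : ℤ) * (c + 1) * p := by
      push_cast; linarith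
    refine ⟨t + ((∑ i, r i * f a i).val : ℤ), ?_, ?_, ?_, fun _ => ?_⟩
    · push_cast
      rw [ht, ZMod.natCast_zmod_val]
      simp [mul_add, Finset.sum_add_distrib]
    · push_cast; linarith
    · linarith
    · linarith

/-- pigeonhole into boundedly many cells -/
lemma pigeon {V ι : Type*} [DecidableEq ι] (A : Finset V) (I : Finset ι) (cell : V → ι)
    (h : ∀ a ∈ A, cell a ∈ I) (x : ℝ) (hI : 0 < I.card) (hx : x * I.card ≤ A.card) :
    ∃ i ∈ I, x ≤ (A.filter fun a => cell a = i).card := by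
  by_contra! hcon
  have h1 := Finset.card_eq_sum_card_fiberwise (f := cell) (s := A) (t := I) (fun a ha => h a ha)
  have hne : I.Nonempty := Finset.card_pos.1 hI
  have h2 : (A.card : ℝ) < ∑ _i ∈ I, x := by
    rw [h1]; push_cast
    exact Finset.sum_lt_sum_of_nonempty hne hcon
  rw [Finset.sum_const, nsmul_eq_mul] at h2
  linarith

lemma partC (α κ : ℝ) (hα : 0 < α) (hκ : 0 < κ) : ∃ c : ℝ, 0 < c ∧ ∃ p0 : ℕ,
    ∀ (p d : ℕ) [Fact p.Prime], p0 ≤ p →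
    ∀ (A : Finset (Fin d → ZMod p)) (f : (Fin d → ZMod p) → (Fin d → ZMod p)),
    α * (p : ℝ) ^ d ≤ A.card → κ * (gr f A - gr f A).card ≤ (p : ℝ) ^ d →
    ∃ A' ⊆ A, c * (p : ℝ) ^ d ≤ A'.card ∧
      ∀ z, ((0, z) : (Fin d → ZMod p) × (Fin d → ZMod p)) ∈ 6 • gr f A' - 6 • gr f A' → z = 0 := by
  obtain ⟨M, hM⟩ := exists_nat_gt ((1 / (κ * α)) ^ 13 / α * 13)
  have hMpos : (0 : ℝ) < M := lt_of_le_of_lt (by positivity) hM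
  have hMpos' : 0 < M := by exact_mod_cast hMpos
  refine ⟨α / M, by positivity, M, ?_⟩
  intro p d _ hp A f hA hG
  have hpp : 0 < p := (Fact.out : p.Prime).pos
  classical
  set X : Finset (Fin d → ZMod p) := Finset.univ.filter fun z =>
    ((0, z) : (Fin d → ZMod p) × (Fin d → ZMod p)) ∈ 6 • gr f A - 6 • gr f A with hXdef
  have hcV : ((Fintype.card (Fin d → ZMod p) : ℕ) : ℝ) = (p : ℝ) ^ d := by simp [ZMod.card]
  have hX := card_X f A α κ hα hκ (by rw [hcV]; exact hA) (by rw [hcV]; exact hG) X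
    (fun z hz => (Finset.mem_filter.1 hz).2)
  obtain ⟨r, hr⟩ := exists_r p d M hMpos' hp X (by nlinarith)
  obtain ⟨i, -, hi⟩ := pigeon A (Finset.range M) (fun a => (∑ i, r i * f a i).val * M / p)
    (by
      intro a _
      rw [Finset.mem_range, Nat.div_lt_iff_lt_mul hpp, mul_comm]
      exact Nat.mul_lt_mul_of_pos_left (ZMod.val_lt _) hMpos')
    (α / M * (p : ℝ) ^ d) (by simpa using hMpos') (by
      rw [Finset.card_range]
      refine le_trans (le_of_eq ?_) hA
      field_simp)
  refine ⟨_, Finset.filter_subset _ _, hi, ?_⟩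
  set A' := A.filter fun a => (∑ i, r i * f a i).val * M / p = i with hA'
  intro z hz
  have hzX : z ∈ X := by
    refine Finset.mem_filter.2 ⟨Finset.mem_univ _, ?_⟩
    have : 6 • gr f A' ⊆ 6 • gr f A := Finset.nsmul_subset_nsmul_left (gr_mono f (Finset.filter_subset _ _))
    exact Finset.sub_subset_sub this this hz
  by_contra hz0
  apply hr z hzX hz0
  have hcell := nsmul_cell p d M f A' r i (by
    intro a ha
    have h := (Finset.mem_filter.1 ha).2
    constructor
    · rw [← h]; exact_mod_cast Nat.div_mul_le_self _ _
    · rw [← h]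
      have := Nat.lt_mul_of_div_lt (Nat.lt_succ_self ((∑ i, r i * f a i).val * M / p)) hpp
      exact_mod_cast this) 6
  obtain ⟨u, hu, v, hv, huv⟩ := Finset.mem_sub.1 hz
  obtain ⟨t, ht, t1, -, t2⟩ := hcell u hu
  obtain ⟨s, hs, s1, -, s2⟩ := hcell v hv
  have t2 := t2 (by norm_num)
  have s2 := s2 (by norm_num)
  refine ⟨t - s, ?_, ?_⟩
  · push_cast
    rw [ht, hs, ← Finset.sum_sub_distrib]
    refine Finset.sum_congr rfl fun j _ => ?_
    rw [← mul_sub]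
    have : z = u.2 - v.2 := by rw [← Prod.snd_sub, huv]
    rw [this]; rfl
  · have : |t - s| * M = |(t - s) * M| := by rw [abs_mul]; simp
    rw [this, abs_lt]
    push_cast at *
    constructor <;> nlinarith
end partC

section bogo
open scoped Pointwise ComplexConjugate
variable {p d : ℕ} [Fact p.Prime]

def dotHom (y : Fin d → ZMod p) : (Fin d → ZMod p) →+ ZMod p where
  toFun γ := ∑ i, γ i * y i
  map_zero' := by simp
  map_add' := by intro a b; simp [add_mul, Finset.sum_add_distrib]

def chi (γ y : Fin d → ZMod p) : ℂ := ZMod.stdAddChar (∑ i, γ i * y i)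

lemma chi_add (γ x y : Fin d → ZMod p) : chi γ (x + y) = chi γ x * chi γ y := by
  unfold chi
  rw [← AddChar.map_add_eq_mul, ← Finset.sum_add_distrib]
  simp [mul_add]

lemma chi_neg (γ x : Fin d → ZMod p) : chi γ (-x) = conj (chi γ x) := by
  unfold chi
  rw [← AddChar.map_neg_eq_conj]
  simp

lemma chi_norm (γ x : Fin d → ZMod p) : ‖chi γ x‖ = 1 := by
  unfold chi
  exact AddChar.norm_apply _ _

lemma chi_sum (y : Fin d → ZMod p) (hy : y ≠ 0) : ∑ γ, chi γ y = 0 := by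
  set ψ : AddChar (Fin d → ZMod p) ℂ := (ZMod.stdAddChar (N := p)).compAddMonoidHom (dotHom y) with hψ
  have : ψ ≠ 0 := by
    intro h
    obtain ⟨i, hi⟩ := Function.ne_iff.1 hy
    have hi : y i ≠ 0 := hi
    have h1 : ψ (Pi.single i (y i)⁻¹) = 1 := by rw [h]; rfl
    have h2 : ψ (Pi.single i (y i)⁻¹) = ZMod.stdAddChar (N := p) 1 := by
      simp [hψ, dotHom, Pi.single_apply, hi]
    rw [h2, ← AddChar.map_zero_eq_one (ZMod.stdAddChar (N := p))] at h1
    exact one_ne_zero (ZMod.injective_stdAddChar h1)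
  exact AddChar.sum_eq_zero_iff_ne_zero.2 this

lemma chi_zero_sum : ∑ γ : Fin d → ZMod p, chi γ 0 = (p : ℂ) ^ d := by
  simp [chi, ZMod.card]

def FA (A : Finset (Fin d → ZMod p)) (γ : Fin d → ZMod p) : ℂ := ∑ a ∈ A, chi γ a

lemma FA_normSq (A : Finset (Fin d → ZMod p)) (γ : Fin d → ZMod p) :
    (Complex.normSq (FA A γ) : ℂ) = ∑ a ∈ A, ∑ b ∈ A, chi γ (a - b) := by
  rw [Complex.normSq_eq_conj_mul_self, mul_comm, FA, map_sum, Finset.sum_mul_sum]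
  refine Finset.sum_congr rfl fun a _ => Finset.sum_congr rfl fun b _ => ?_
  rw [sub_eq_add_neg, chi_add, chi_neg]

lemma parseval (A : Finset (Fin d → ZMod p)) :
    ∑ γ, Complex.normSq (FA A γ) = (p : ℝ) ^ d * A.card := by
  have : ((∑ γ, Complex.normSq (FA A γ) : ℝ) : ℂ) = (((p : ℝ) ^ d * A.card : ℝ) : ℂ) := by
    push_cast
    simp_rw [FA_normSq]
    rw [Finset.sum_comm]
    have : ∀ a ∈ A, ∑ γ, ∑ b ∈ A, chi γ (a - b) = (p : ℂ) ^ d := by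
      intro a ha
      rw [Finset.sum_comm, Finset.sum_eq_single_of_mem a ha]
      · rw [sub_self, chi_zero_sum]
      · intro b _ hb
        exact chi_sum _ (sub_ne_zero.2 hb.symm)
    rw [Finset.sum_congr rfl this]
    simp [mul_comm]
  exact_mod_cast this

lemma rep_zero (A : Finset (Fin d → ZMod p)) (x : Fin d → ZMod p) (hx : x ∉ 2 • A - 2 • A) :
    ∑ γ, (Complex.normSq (FA A γ) : ℂ) ^ 2 * chi γ x = 0 := by
  have h1 : ∀ γ, (Complex.normSq (FA A γ) : ℂ) ^ 2 * chi γ x =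
      ∑ a ∈ A, ∑ b ∈ A, ∑ c ∈ A, ∑ e ∈ A, chi γ ((a - b) + (c - e) + x) := by
    intro γ
    rw [sq, FA_normSq, Finset.sum_mul, Finset.sum_mul]
    refine Finset.sum_congr rfl fun a _ => ?_
    rw [Finset.sum_mul, Finset.sum_mul]
    refine Finset.sum_congr rfl fun b _ => ?_
    rw [Finset.mul_sum, Finset.sum_mul]
    refine Finset.sum_congr rfl fun c _ => ?_
    rw [Finset.mul_sum, Finset.sum_mul]
    refine Finset.sum_congr rfl fun e _ => ?_
    rw [chi_add, chi_add]
  rw [Finset.sum_congr rfl fun γ _ => h1 γ, Finset.sum_comm]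
  refine Finset.sum_eq_zero fun a ha => ?_
  rw [Finset.sum_comm]
  refine Finset.sum_eq_zero fun b hb => ?_
  rw [Finset.sum_comm]
  refine Finset.sum_eq_zero fun c hc => ?_
  rw [Finset.sum_comm]
  refine Finset.sum_eq_zero fun e he => ?_
  apply chi_sum
  intro h
  apply hx
  rw [two_nsmul]
  refine Finset.mem_sub.2 ⟨b + e, Finset.add_mem_add hb he, a + c, Finset.add_mem_add ha hc, ?_⟩
  have : x = ((a - b) + (c - e) + x) + (b + e - (a + c)) := by abel
  rw [this, h, zero_add]

lemma chi_re_nonneg (γ x : Fin d → ZMod p) (k : ℤ) (hk : (k : ZMod p) = ∑ i, γ i * x i)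
    (hk2 : 4 * |k| ≤ p) : 0 ≤ (chi γ x).re := by
  have hp : (0 : ℝ) < p := by exact_mod_cast (Fact.out : p.Prime).pos
  unfold chi
  rw [← hk, ZMod.stdAddChar_coe]
  have : (2 * Real.pi * Complex.I * k / p : ℂ) = ((2 * Real.pi * k / p : ℝ) : ℂ) * Complex.I := by
    push_cast; ring
  rw [this, Complex.exp_ofReal_mul_I_re]
  have hk3 : 4 * |(k : ℝ)| ≤ p := by exact_mod_cast hk2
  have h4 : |2 * Real.pi * k / p| ≤ Real.pi / 2 := by
    rw [abs_div, abs_mul, abs_of_pos hp, abs_of_pos Real.two_pi_pos, div_le_iff₀ hp]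
    nlinarith [Real.pi_pos]
  exact Real.cos_nonneg_of_mem_Icc ⟨by linarith [(abs_le.1 h4).1], (abs_le.1 h4).2⟩

lemma bogo_core (A : Finset (Fin d → ZMod p)) (α : ℝ) (hα : 0 < α) (hA : α * (p : ℝ) ^ d ≤ A.card)
    (x : Fin d → ZMod p)
    (hx : ∀ γ, α ^ 3 / 2 * ((p : ℝ) ^ d) ^ 2 ≤ Complex.normSq (FA A γ) →
      ∃ k : ℤ, (k : ZMod p) = ∑ i, γ i * x i ∧ 4 * |k| ≤ p) : x ∈ 2 • A - 2 • A := by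
  by_contra hn
  have hp : (0 : ℝ) < p := by exact_mod_cast (Fact.out : p.Prime).pos
  have h0 := congrArg Complex.re (rep_zero A x hn)
  rw [Complex.re_sum, Complex.zero_re] at h0
  have hre : ∀ γ, ((Complex.normSq (FA A γ) : ℂ) ^ 2 * chi γ x).re =
      Complex.normSq (FA A γ) ^ 2 * (chi γ x).re := by
    intro γ
    rw [← Complex.ofReal_pow, Complex.re_ofReal_mul]
  simp_rw [hre] at h0
  set N : ℝ := (p : ℝ) ^ d with hN
  have hN0 : 0 < N := by positivity
  have hA0 : (0 : ℝ) < A.card := lt_of_lt_of_le (by positivity) hA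
  have hAN : (A.card : ℝ) ≤ N := by
    have := Finset.card_le_univ A
    simp only [Fintype.card_fun, ZMod.card, Fintype.card_fin] at this
    rw [hN]; exact_mod_cast this
  have hF0 : FA A 0 = A.card := by simp [FA, chi]
  have hn0 : Complex.normSq (FA A 0) = (A.card : ℝ) ^ 2 := by
    rw [hF0, ← Complex.ofReal_natCast, Complex.normSq_ofReal, sq]
  have key : ∀ γ, (if γ = 0 then (A.card : ℝ) ^ 4 else 0) -
      α ^ 3 / 2 * N ^ 2 * Complex.normSq (FA A γ) ≤ Complex.normSq (FA A γ) ^ 2 * (chi γ x).re := by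
    intro γ
    have hns := Complex.normSq_nonneg (FA A γ)
    have hα3 : 0 < α ^ 3 / 2 * N ^ 2 := by positivity
    split_ifs with hγ
    · subst hγ
      have : chi 0 x = 1 := by simp [chi]
      rw [this, hn0, Complex.one_re]
      have : 0 ≤ α ^ 3 / 2 * N ^ 2 * (A.card : ℝ) ^ 2 := by positivity
      nlinarith
    · by_cases hs : α ^ 3 / 2 * N ^ 2 ≤ Complex.normSq (FA A γ)
      · obtain ⟨k, hk, hk2⟩ := hx γ hs
        have := chi_re_nonneg γ x k hk hk2
        have h1 : 0 ≤ Complex.normSq (FA A γ) ^ 2 * (chi γ x).re := by positivity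
        have h2 : 0 ≤ α ^ 3 / 2 * N ^ 2 * Complex.normSq (FA A γ) := by positivity
        linarith
      · push Not at hs
        have h1 : -1 ≤ (chi γ x).re := by
          have := Complex.abs_re_le_norm (chi γ x)
          rw [chi_norm] at this
          exact (abs_le.1 this).1
        have h2 : Complex.normSq (FA A γ) ^ 2 * (-1) ≤ Complex.normSq (FA A γ) ^ 2 * (chi γ x).re := by
          gcongr
        nlinarith
  have hs := Finset.sum_le_sum (s := Finset.univ) fun γ _ => key γ
  rw [Finset.sum_sub_distrib, ← Finset.mul_sum, parseval, h0, Finset.sum_ite_eq'] at hs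
  simp only [Finset.mem_univ, if_true] at hs
  rw [← hN] at hs
  have h3 : (α * N) ^ 3 ≤ (A.card : ℝ) ^ 3 := pow_le_pow_left₀ (by positivity) hA 3
  have h4 : 0 < (A.card : ℝ) * ((A.card : ℝ) ^ 3 - α ^ 3 / 2 * N ^ 3) := by
    apply mul_pos hA0
    have : 0 < (α * N) ^ 3 := by positivity
    nlinarith
  nlinarith

lemma spec_card (A : Finset (Fin d → ZMod p)) (α : ℝ) (hα : 0 < α) (S : Finset (Fin d → ZMod p))
    (hS : ∀ γ ∈ S, α ^ 3 / 2 * ((p : ℝ) ^ d) ^ 2 ≤ Complex.normSq (FA A γ)) :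
    (S.card : ℝ) ≤ 2 / α ^ 3 := by
  have hp : (0 : ℝ) < p := by exact_mod_cast (Fact.out : p.Prime).pos
  have h1 : (S.card : ℝ) * (α ^ 3 / 2 * ((p : ℝ) ^ d) ^ 2) ≤ (p : ℝ) ^ d * A.card := by
    rw [← parseval, ← nsmul_eq_mul]
    refine (Finset.card_nsmul_le_sum _ _ _ hS).trans ?_
    exact Finset.sum_le_sum_of_subset_of_nonneg (Finset.subset_univ _)
      fun _ _ _ => Complex.normSq_nonneg _
  have hAN : (A.card : ℝ) ≤ (p : ℝ) ^ d := by
    have := Finset.card_le_univ A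
    simp only [Fintype.card_fun, ZMod.card, Fintype.card_fin] at this
    exact_mod_cast this
  have hN0 : 0 < (p : ℝ) ^ d := by positivity
  set N : ℝ := (p : ℝ) ^ d
  rw [le_div_iff₀ (by positivity)]
  refine le_of_mul_le_mul_right (a := N ^ 2) ?_ (by positivity)
  nlinarith

end bogo

open scoped Pointwise in
lemma bogo (α : ℝ) (hα : 0 < α) : ∃ m : ℕ, ∀ (p d : ℕ) [Fact p.Prime] (A : Finset (Fin d → ZMod p)),
    α * (p : ℝ) ^ d ≤ A.card → ∃ γ : Fin m → (Fin d → ZMod p), ∀ x,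
      (∀ j, ∃ k : ℤ, (k : ZMod p) = ∑ i, γ j i * x i ∧ 4 * |k| ≤ p) → x ∈ 2 • A - 2 • A := by
  classical
  obtain ⟨m, hm⟩ := exists_nat_ge (2 / α ^ 3)
  refine ⟨m, ?_⟩
  intro p d _ A hA
  set S : Finset (Fin d → ZMod p) := Finset.univ.filter fun γ =>
    α ^ 3 / 2 * ((p : ℝ) ^ d) ^ 2 ≤ Complex.normSq (FA A γ) with hS
  have hc := spec_card A α hα S fun γ hγ => (Finset.mem_filter.1 hγ).2
  have hcm : S.card ≤ m := by exact_mod_cast hc.trans hm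
  refine ⟨fun j => if h : j.1 < S.card then (S.equivFin.symm ⟨j.1, h⟩ : Fin d → ZMod p) else 0, ?_⟩
  intro x hx
  apply bogo_core A α hα hA x
  intro γ hγ
  have hγS : γ ∈ S := Finset.mem_filter.2 ⟨Finset.mem_univ _, hγ⟩
  have hlt := (S.equivFin ⟨γ, hγS⟩).2
  have := hx ⟨(S.equivFin ⟨γ, hγS⟩).1, lt_of_lt_of_le hlt hcm⟩
  simpa using this

section ext

lemma inv_nat {M E B : Type} [AddCommGroup M] [SeminormedAddCommGroup E] [NormedSpace ℝ E]
    [AddCommGroup B] (j : M →+ E) (φ : M → B) (ρ : ℝ)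
    (hφ : ∀ x y, ‖j x‖ < ρ → ‖j y‖ < ρ → ‖j (x + y)‖ < ρ → φ (x + y) = φ x + φ y)
    (v : M) (hv : ‖j v‖ < ρ) (hφv : φ v = 0) (x : M) (k : ℕ) (h1 : ‖j x‖ < ρ / 3)
    (h2 : ‖j (x + k • v)‖ < ρ / 3) : φ (x + k • v) = φ x := by
  have hk : (k : ℝ) * ‖j v‖ < 2 * (ρ / 3) := by
    have : (k : ℝ) * ‖j v‖ = ‖j (x + k • v) - j x‖ := by
      rw [map_add, add_sub_cancel_left, map_nsmul, ← Nat.cast_smul_eq_nsmul ℝ, norm_smul]; simp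
    rw [this]
    have := norm_sub_le (j (x + k • v)) (j x)
    linarith
  have hb : ∀ i : ℕ, i ≤ k → ‖j (x + i • v)‖ < ρ := by
    intro i hi
    have h3 : ‖j (x + i • v)‖ ≤ ‖j x‖ + i * ‖j v‖ := by
      rw [map_add, map_nsmul, ← Nat.cast_smul_eq_nsmul ℝ]
      refine (norm_add_le _ _).trans ?_
      rw [norm_smul]; simp
    have h4 : (i : ℝ) * ‖j v‖ ≤ k * ‖j v‖ := by gcongr
    linarith
  have : ∀ i : ℕ, i ≤ k → φ (x + i • v) = φ x := by
    intro i
    induction i with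
    | zero => intro _; simp
    | succ i ih =>
      intro hi
      rw [succ_nsmul, ← add_assoc, hφ, ih (by omega), hφv, add_zero]
      · exact hb i (by omega)
      · exact hv
      · rw [add_assoc, ← succ_nsmul]; exact hb _ hi
  exact this k le_rfl

lemma inv_int {M E B : Type} [AddCommGroup M] [SeminormedAddCommGroup E] [NormedSpace ℝ E]
    [AddCommGroup B] (j : M →+ E) (φ : M → B) (ρ : ℝ)
    (hφ : ∀ x y, ‖j x‖ < ρ → ‖j y‖ < ρ → ‖j (x + y)‖ < ρ → φ (x + y) = φ x + φ y)
    (v : M) (hv : ‖j v‖ < ρ) (hφv : φ v = 0) (x y : M) (k : ℤ) (h1 : ‖j x‖ < ρ / 3)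
    (h2 : ‖j y‖ < ρ / 3) (hxy : y = x + k • v) : φ y = φ x := by
  obtain ⟨n, rfl | rfl⟩ := k.eq_nat_or_neg
  · rw [natCast_zsmul] at hxy
    subst hxy
    exact inv_nat j φ ρ hφ v hv hφv x n h1 h2
  · have : x = y + n • v := by
      rw [hxy, neg_smul, natCast_zsmul]; abel
    subst this
    exact (inv_nat j φ ρ hφ v hv hφv y n h2 h1).symm

lemma primitive {M : Type} [AddCommGroup M] [Module.Free ℤ M] [Module.Finite ℤ M] (x : M)
    (hx : x ≠ 0) : ∃ (g : ℤ) (v : M) (e : M →ₗ[ℤ] ℤ), g ≠ 0 ∧ x = g • v ∧ e v = 1 := by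
  let b := Module.Free.chooseBasis ℤ M
  let I : Ideal ℤ := LinearMap.range (LinearMap.applyₗ x : (M →ₗ[ℤ] ℤ) →ₗ[ℤ] ℤ)
  obtain ⟨g, hg⟩ := (IsPrincipalIdealRing.principal I).principal
  have hmem : ∀ f : M →ₗ[ℤ] ℤ, g ∣ f x := by
    intro f
    have : f x ∈ I := ⟨f, rfl⟩
    rw [hg] at this
    exact Ideal.mem_span_singleton.1 this
  have hgI : g ∈ I := by rw [hg]; exact Submodule.mem_span_singleton_self g
  obtain ⟨e, he⟩ := hgI
  have he : e x = g := he
  choose c hc using fun i => hmem (b.coord i)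
  set v : M := ∑ i, c i • b i with hv
  have hxv : x = g • v := by
    rw [← b.sum_repr x, hv, Finset.smul_sum]
    refine Finset.sum_congr rfl fun i _ => ?_
    rw [smul_smul, ← hc i]; rfl
  have hg0 : g ≠ 0 := by
    rintro rfl
    apply hx; rw [hxv, zero_smul]
  refine ⟨g, v, e, hg0, hxv, ?_⟩
  have : g * e v = g * 1 := by
    rw [← smul_eq_mul, ← map_smul, ← hxv, he, mul_one]
  exact mul_left_cancel₀ hg0 this

lemma ext_lemma (n : ℕ) : ∃ c : ℝ, 0 < c ∧ c ≤ 1 ∧ ∀ (M E B : Type) [AddCommGroup M]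
    [Module.Free ℤ M] [Module.Finite ℤ M] [SeminormedAddCommGroup E] [NormedSpace ℝ E]
    [AddCommGroup B], Module.finrank ℤ M = n → ∀ (j : M →+ E) (φ : M → B) (ρ : ℝ), 0 < ρ →
    (∀ x y, ‖j x‖ < ρ → ‖j y‖ < ρ → ‖j (x + y)‖ < ρ → φ (x + y) = φ x + φ y) →
    ∃ L : M →+ B, ∀ x, ‖j x‖ < c * ρ → L x = φ x := by
  induction n with
  | zero =>
    refine ⟨1, one_pos, le_rfl, ?_⟩
    intro M E B _ _ _ _ _ _ hM j φ ρ hρ hφ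
    have hs : Subsingleton M := Module.finrank_zero_iff.1 hM
    refine ⟨0, fun x _ => ?_⟩
    have h0 : x = 0 := Subsingleton.elim _ _
    subst h0
    have := hφ 0 0 (by simpa using hρ) (by simpa using hρ) (by simpa using hρ)
    have h1 : φ 0 = 0 := by simpa using this
    rw [h1]; rfl
  | succ n ih =>
    obtain ⟨c, hc0, hc1, ih⟩ := ih
    refine ⟨c / 16, by positivity, by linarith, ?_⟩
    intro M E B _ _ _ _ _ _ hM j φ ρ hρ hφ
    have hφ0 : φ 0 = 0 := by
      have := hφ 0 0 (by simpa using hρ) (by simpa using hρ) (by simpa using hρ)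
      simpa using this
    by_cases hex : ∃ x : M, x ≠ 0 ∧ ‖j x‖ < c / 16 * ρ
    swap
    · push Not at hex
      refine ⟨0, fun x hx => ?_⟩
      have : x = 0 := by
        by_contra h
        exact absurd hx (not_lt.2 (hex x h))
      rw [this, hφ0]; rfl
    obtain ⟨x0, hx0, hx1⟩ := hex
    obtain ⟨g, v, e, hg, hgv, hev⟩ := primitive x0 hx0
    have hcρ : c / 16 * ρ ≤ ρ / 16 := by nlinarith
    have hv : ‖j v‖ < c / 16 * ρ := by
      refine lt_of_le_of_lt ?_ hx1
      rw [hgv, map_zsmul, ← Int.cast_smul_eq_zsmul ℝ, norm_smul]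
      have : (1 : ℝ) ≤ ‖(g : ℝ)‖ := by
        rw [Real.norm_eq_abs]
        exact_mod_cast Int.one_le_abs hg
      nlinarith [norm_nonneg (j v)]
    have hvρ : ‖j v‖ < ρ := by linarith
    -- normalised map
    set φ1 : M → B := fun x => φ x - e x • φ v with hφ1
    have hφ1a : ∀ x y, ‖j x‖ < ρ → ‖j y‖ < ρ → ‖j (x + y)‖ < ρ → φ1 (x + y) = φ1 x + φ1 y := by
      intro x y h1 h2 h3
      simp only [hφ1]
      rw [hφ x y h1 h2 h3, map_add, add_smul]; abel
    have hφ1v : φ1 v = 0 := by simp [hφ1, hev]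
    -- the quotient
    let S : Submodule ℝ E := Submodule.span ℝ {j v}
    let M' := LinearMap.ker e
    let j' : M' →+ E ⧸ S := (S.mkQ.toAddMonoidHom.comp j).comp M'.subtype.toAddMonoidHom
    have hj' : ∀ y : M', j' y = S.mkQ (j y) := fun _ => rfl
    have hfr : Module.finrank ℤ M' = n := by
      have h1 := Submodule.finrank_quotient_add_finrank (LinearMap.ker e)
      have h2 : Function.Surjective e := by
        intro t
        exact ⟨t • v, by rw [map_smul, hev]; simp⟩
      rw [(e.quotKerEquivOfSurjective h2).finrank_eq, hM, Module.finrank_self] at h1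
      have h3 : Module.finrank ℤ (LinearMap.ker e) = n := by omega
      exact h3
    have hlift : ∀ y : M', ∃ k : ℤ, ‖j' y‖ < ρ / 16 → ‖j ((y : M) - k • v)‖ < ρ / 8 := by
      intro y
      by_cases h : ‖j' y‖ < ρ / 16
      · rw [hj'] at h
        obtain ⟨m, hm, hm2⟩ := Submodule.Quotient.norm_mk_lt (S.mkQ (j y)) (sub_pos.2 h)
        rw [Submodule.mkQ_apply, Submodule.Quotient.eq] at hm
        obtain ⟨r, hr⟩ := Submodule.mem_span_singleton.1 hm
        refine ⟨- round r, fun _ => ?_⟩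
        have e1 : j ((y : M) - (-round r) • v) = m - (r - round r) • j v := by
          have : m = j y + r • j v := by rw [hr]; abel
          rw [this, map_sub, map_zsmul, ← Int.cast_smul_eq_zsmul ℝ]
          push_cast
          module
        rw [e1]
        have e2 : ‖(r - round r) • j v‖ ≤ 1 / 2 * ‖j v‖ := by
          rw [norm_smul]
          exact mul_le_mul_of_nonneg_right (abs_sub_round r) (norm_nonneg _)
        have e3 := norm_sub_le m ((r - round r) • j v)
        have e4 := norm_nonneg (j v)
        linarith
      · exact ⟨0, fun h' => absurd h' h⟩
    choose k hk using hlift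
    set φ' : M' → B := fun y => φ1 ((y : M) - k y • v) with hφ'
    obtain ⟨L', hL'⟩ := ih M' (E ⧸ S) B hfr j' φ' (ρ / 16) (by positivity) (by
      intro x y h1 h2 h3
      have k1 := hk x h1
      have k2 := hk y h2
      have k3 := hk _ h3
      have k4 : ‖j (((x : M) - k x • v) + ((y : M) - k y • v))‖ < ρ / 4 := by
        rw [map_add]
        refine lt_of_le_of_lt (norm_add_le _ _) ?_
        linarith
      simp only [hφ']
      rw [← hφ1a _ _ (by linarith) (by linarith) (by linarith)]
      refine inv_int j φ1 ρ hφ1a v hvρ hφ1v _ _ (k x + k y - k (x + y)) (by linarith) (by linarith) ?_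
      rw [Submodule.coe_add]
      module)
    let pr : M →ₗ[ℤ] M' := LinearMap.codRestrict M' (LinearMap.id - e.smulRight v) (by
      intro x
      simp [M', hev])
    have hpr : ∀ x, ((pr x : M') : M) = x - e x • v := fun x => rfl
    refine ⟨L'.comp pr.toAddMonoidHom + (((zmultiplesHom B) (φ v)).comp e.toAddMonoidHom), ?_⟩
    intro x hx
    have h1 : ‖j' (pr x)‖ < c * (ρ / 16) := by
      have : j' (pr x) = S.mkQ (j x) := by
        rw [hj', hpr, map_sub, map_sub, sub_eq_self, Submodule.mkQ_apply,
          Submodule.Quotient.mk_eq_zero, map_zsmul, ← Int.cast_smul_eq_zsmul ℝ]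
        exact Submodule.smul_mem _ _ (Submodule.mem_span_singleton_self _)
      rw [this]
      refine lt_of_le_of_lt (Submodule.Quotient.norm_mk_le S (j x)) ?_
      linarith
    have h2 := hk (pr x) (by nlinarith)
    have h3 : φ1 x = φ1 ((pr x : M) - k (pr x) • v) := by
      refine inv_int j φ1 ρ hφ1a v hvρ hφ1v _ _ (k (pr x) + e x) (by linarith) (by linarith) ?_
      rw [hpr]; module
    have h4 : (L'.comp pr.toAddMonoidHom + (((zmultiplesHom B) (φ v)).comp e.toAddMonoidHom)) x =
      L' (pr x) + e x • φ v := rfl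
    rw [h4, hL' _ h1]
    simp only [hφ']
    rw [← h3]
    simp [hφ1]
end ext

section asm
open scoped Pointwise

lemma fract_int_div (p : ℕ) (hp : 0 < p) (t : ℤ) :
    Int.fract ((t : ℝ) / p) = ((t - p * (t / p) : ℤ) : ℝ) / p := by
  have hp' : (0 : ℝ) < p := by exact_mod_cast hp
  have h : ⌊(t : ℝ) / (p : ℝ)⌋ = t / (p : ℤ) := by
    rw [Int.floor_div_natCast, Int.floor_intCast]
  rw [Int.fract, h]
  push_cast
  field_simp

lemma alf_of (p d m : ℕ) (hp : 0 < p) (γ : Fin m → Fin d → ℤ) (a : Fin d → ℤ) (b : Fin m → ℤ) :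
    ∃ (α : Fin (d + m) → Fin d → ℤ) (β : Fin (d + m) → ℤ), ∀ h : Fin d → ZMod p,
      (p : ℝ) * alfAux p d (d + m) α β h =
        ((∑ i, ((h i).val : ℤ) * a i + ∑ j, (-((∑ i, γ j i * ((h i).val : ℤ)) / p)) * b j : ℤ) : ℝ) := by
  have : NeZero p := ⟨hp.ne'⟩
  have hp' : (0 : ℝ) < p := by exact_mod_cast hp
  refine ⟨Fin.append (fun i => Pi.single i 1) γ,
    Fin.append (fun i => p * a i - ∑ j, b j * γ j i) b, fun h => ?_⟩
  unfold alfAux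
  rw [Fin.sum_univ_add]
  simp only [Fin.append_left, Fin.append_right]
  have h1 : ∀ (x : Fin d → ℤ), (∑ k : Fin d, ((x k : ℝ) / (p : ℝ)) * (((h k).val : ℕ) : ℝ)) =
      ((∑ k, x k * ((h k).val : ℤ) : ℤ) : ℝ) / p := by
    intro x
    push_cast
    rw [Finset.sum_div]
    refine Finset.sum_congr rfl fun k _ => by ring
  simp only [h1, fract_int_div p hp]
  have h2 : ∀ i : Fin d, (∑ k, (Pi.single i 1 : Fin d → ℤ) k * ((h k).val : ℤ)) = ((h i).val : ℤ) := by
    intro i; simp [Pi.single_apply]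
  simp only [h2]
  have h3 : ∀ i : Fin d, ((h i).val : ℤ) / (p : ℤ) = 0 := fun i =>
    Int.ediv_eq_zero_of_lt (by positivity) (by exact_mod_cast ZMod.val_lt (h i))
  simp only [h3]
  set n : Fin m → ℤ := fun j => (∑ i, γ j i * ((h i).val : ℤ)) / p with hn
  have hn' : ∀ j, (∑ i, γ j i * ((h i).val : ℤ)) / p = n j := fun _ => rfl
  simp only [hn']
  push_cast
  rw [mul_add, Finset.mul_sum, Finset.mul_sum]
  have e1 : ∀ i, (p : ℝ) * (((((h i).val : ℕ) : ℝ) - (p : ℝ) * 0) / p *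
      (((p : ℝ) * a i - ∑ j, (b j : ℝ) * γ j i) / p)) =
      ((h i).val : ℝ) * a i - ∑ j, (b j : ℝ) * (γ j i * ((h i).val : ℝ)) / p := by
    intro i
    have : ∑ j, (b j : ℝ) * (γ j i * ((h i).val : ℝ)) / p =
      (∑ j, (b j : ℝ) * γ j i) * ((h i).val : ℝ) / p := by
      rw [Finset.sum_mul, Finset.sum_div]
      refine Finset.sum_congr rfl fun j _ => by ring
    rw [this]
    field_simp
    ring
  have e2 : ∀ j, (p : ℝ) * ((∑ i, (γ j i : ℝ) * ((h i).val : ℝ) - p * n j) / p * ((b j : ℝ) / p)) =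
      ∑ i, (b j : ℝ) * (γ j i * ((h i).val : ℝ)) / p - n j * b j := by
    intro j
    have : ∑ i, (b j : ℝ) * (γ j i * ((h i).val : ℝ)) / p =
      (∑ i, (γ j i : ℝ) * ((h i).val : ℝ)) * b j / p := by
      rw [Finset.sum_mul, Finset.sum_div]
      refine Finset.sum_congr rfl fun i _ => by ring
    rw [this]
    field_simp
  rw [Finset.sum_congr rfl fun i _ => e1 i, Finset.sum_congr rfl fun j _ => e2 j,
    Finset.sum_sub_distrib, Finset.sum_sub_distrib, Finset.sum_comm (γ := Fin m)]
  simp only [neg_mul, Finset.sum_neg_distrib]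
  ring

lemma cell_close (p Q u v : ℕ) (hp : 0 < p) (h : u * Q / p = v * Q / p) (c : ℝ)
    (hc : 1 < c * Q) : |(u : ℝ) - v| < c * p := by
  have hp' : (0 : ℝ) < p := by exact_mod_cast hp
  have hQ0 : (0 : ℝ) < Q := by
    rcases Nat.eq_zero_or_pos Q with h | h
    · subst h; simp at hc; linarith
    · exact_mod_cast h
  have h1 := Nat.div_mul_le_self (u * Q) p
  have h2 := Nat.div_mul_le_self (v * Q) p
  have h3 := Nat.lt_mul_of_div_lt (Nat.lt_succ_self (u * Q / p)) hp
  have h4 := Nat.lt_mul_of_div_lt (Nat.lt_succ_self (v * Q / p)) hp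
  rw [← h] at h2 h4
  generalize u * Q / p = t at *
  have h1 : (t : ℝ) * p ≤ u * Q := by exact_mod_cast h1
  have h2 : (t : ℝ) * p ≤ v * Q := by exact_mod_cast h2
  have h3 : (u : ℝ) * Q < (t + 1) * p := by exact_mod_cast h3
  have h4 : (v : ℝ) * Q < (t + 1) * p := by exact_mod_cast h4
  have h5 : |(u : ℝ) - v| * Q < p := by
    have : |(u : ℝ) - v| * Q = |((u : ℝ) - v) * Q| := by rw [abs_mul, abs_of_pos hQ0]
    rw [this, abs_lt]; constructor <;> nlinarith
  have h6 : |(u : ℝ) - v| * Q < (c * p) * Q := by nlinarith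
  exact lt_of_mul_lt_mul_right h6 hQ0.le

lemma sub2_lift {V : Type*} [AddCommGroup V] [DecidableEq V] (f : V → V) (A : Finset V) (x : V)
    (hx : x ∈ 2 • A - 2 • A) : ∃ z, (x, z) ∈ 2 • gr f A - 2 • gr f A := by
  rw [two_nsmul] at hx
  obtain ⟨u, hu, v, hv, rfl⟩ := Finset.mem_sub.1 hx
  obtain ⟨a, ha, b, hb, rfl⟩ := Finset.mem_add.1 hu
  obtain ⟨c, hc, e, he, rfl⟩ := Finset.mem_add.1 hv
  refine ⟨f a + f b - (f c + f e), ?_⟩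
  rw [two_nsmul]
  exact Finset.sub_mem_sub (Finset.add_mem_add (mem_gr ha) (mem_gr hb))
    (Finset.add_mem_add (mem_gr hc) (mem_gr he))

lemma mem6 {V : Type*} [AddCommGroup V] [DecidableEq V] (Γ : Finset (V × V))
    {x y z : V × V} (hx : x ∈ 2 • Γ - 2 • Γ) (hy : y ∈ 2 • Γ - 2 • Γ) (hz : z ∈ 2 • Γ - 2 • Γ) :
    x + y - z ∈ 6 • Γ - 6 • Γ := by
  obtain ⟨x1, hx1, x2, hx2, rfl⟩ := Finset.mem_sub.1 hx
  obtain ⟨y1, hy1, y2, hy2, rfl⟩ := Finset.mem_sub.1 hy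
  obtain ⟨z1, hz1, z2, hz2, rfl⟩ := Finset.mem_sub.1 hz
  have e : 6 • Γ = 2 • Γ + 2 • Γ + 2 • Γ := by rw [← add_nsmul, ← add_nsmul]
  rw [e]
  refine Finset.mem_sub.2 ⟨x1 + y1 + z2, Finset.add_mem_add (Finset.add_mem_add hx1 hy1) hz2,
    x2 + y2 + z1, Finset.add_mem_add (Finset.add_mem_add hx2 hy2) hz1, by abel⟩

lemma mem2 {V : Type*} [AddCommGroup V] [DecidableEq V] (f : V → V) (A : Finset V) {a b c e : V}
    (ha : a ∈ A) (hb : b ∈ A) (hc : c ∈ A) (he : e ∈ A) :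
    ((a + b - (c + e), f a + f b - (f c + f e)) : V × V) ∈ 2 • gr f A - 2 • gr f A := by
  rw [two_nsmul]
  exact Finset.sub_mem_sub (Finset.add_mem_add (mem_gr ha) (mem_gr hb))
    (Finset.add_mem_add (mem_gr hc) (mem_gr he))
end asm

section asm2
open scoped Pointwise

/-- the integral data attached to a vector -/
def dat (p d m : ℕ) (γ : Fin m → Fin d → ZMod p) (h : Fin d → ZMod p) :
    (Fin d → ℤ) × (Fin m → ℤ) :=
  (fun i => ((h i).val : ℤ), fun j => -((∑ i, ((γ j i).val : ℤ) * ((h i).val : ℤ)) / p))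

def jmapZ (p d m : ℕ) (γ : Fin m → Fin d → ZMod p) :
    (Fin d → ℤ) × (Fin m → ℤ) →+ (Fin d → ℝ) × (Fin m → ℝ) where
  toFun w := (fun i => (w.1 i : ℝ), fun j => ((∑ i, ((γ j i).val : ℤ) * w.1 i + p * w.2 j : ℤ) : ℝ))
  map_zero' := by ext <;> simp
  map_add' := by
    intro a b
    ext
    · simp
    · simp [mul_add, Finset.sum_add_distrib]; ring

lemma jmap_dat (p d m : ℕ) [NeZero p] (γ : Fin m → Fin d → ZMod p) (h : Fin d → ZMod p) :
    jmapZ p d m γ (dat p d m γ h) =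
      (fun i => ((h i).val : ℝ), fun j => ((∑ i, γ j i * h i : ZMod p).val : ℝ)) := by
  ext x
  · simp [jmapZ, dat]
  · simp only [jmapZ, dat, AddMonoidHom.coe_mk, ZeroHom.coe_mk]
    have h1 : ((∑ i, γ x i * h i : ZMod p).val : ℤ) =
        (∑ i, ((γ x i).val : ℤ) * ((h i).val : ℤ)) % p := by
      rw [← ZMod.val_intCast]
      push_cast
      simp
    have h2 := Int.emod_add_mul_ediv (∑ i, ((γ x i).val : ℤ) * ((h i).val : ℤ)) p
    have h3 : (∑ i, ((γ x i).val : ℤ) * ((h i).val : ℤ) +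
        p * -((∑ i, ((γ x i).val : ℤ) * ((h i).val : ℤ)) / p)) =
        ((∑ i, γ x i * h i : ZMod p).val : ℤ) := by
      rw [h1]; linarith
    rw [h3]; simp

lemma partD (d : ℕ) (α : ℝ) (hα : 0 < α) : ∃ c : ℝ, 0 < c ∧ ∃ K : ℕ, ∀ (p : ℕ) [Fact p.Prime]
    (A : Finset (Fin d → ZMod p)) (f : (Fin d → ZMod p) → (Fin d → ZMod p)),
    α * (p : ℝ) ^ d ≤ A.card →
    (∀ z, ((0, z) : (Fin d → ZMod p) × (Fin d → ZMod p)) ∈ 6 • gr f A - 6 • gr f A → z = 0) →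
    ∃ H' ⊆ A, c * (p : ℝ) ^ d ≤ H'.card ∧ ∃ (g : Fin d → ZMod p)
      (T : (Fin d → ZMod p) → (Fin d → ZMod p)),
      (∀ i : Fin d, IsALFHom p d K (↑H' : Set (Fin d → ZMod p)) (fun h => T h i)) ∧
      ∀ h ∈ H', f h = T h + g := by
  classical
  obtain ⟨m, hm⟩ := bogo α hα
  obtain ⟨c, hc0, hc1, hext⟩ := ext_lemma (d + m)
  obtain ⟨Q, hQ⟩ := exists_nat_gt (1 / (c / 4))
  have hQ' : 1 < c / 4 * Q := by
    rw [div_lt_iff₀ (by positivity)] at hQ; linarith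
  have hQ0 : (0 : ℝ) < Q := lt_trans (by positivity) hQ
  have hQ0' : 0 < Q := by exact_mod_cast hQ0
  refine ⟨α / (Q : ℝ) ^ (d + m), by positivity, d + m, ?_⟩
  intro p hpf A f hA h6
  have hpp : 0 < p := (Fact.out : p.Prime).pos
  have hpr : (0 : ℝ) < p := by exact_mod_cast hpp
  obtain ⟨γ, hγ⟩ := hm p d A hA
  set Γ := gr f A with hΓ
  have huniq : ∀ x z z', (x, z) ∈ 2 • Γ - 2 • Γ → (x, z') ∈ 2 • Γ - 2 • Γ →
      ((0, 0) : (Fin d → ZMod p) × (Fin d → ZMod p)) ∈ 2 • Γ - 2 • Γ → z = z' := by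
    intro x z z' h1 h2 h3
    have := mem6 Γ h1 h3 h2
    have h4 := h6 (z + 0 - z') (by simpa using this)
    rw [add_zero] at h4
    exact sub_eq_zero.1 h4
  have hA0 : (0 : ℝ) < A.card := lt_of_lt_of_le (by positivity) hA
  obtain ⟨a0, ha0⟩ : A.Nonempty := Finset.card_pos.1 (by exact_mod_cast hA0)
  have h00 : ((0, 0) : (Fin d → ZMod p) × (Fin d → ZMod p)) ∈ 2 • Γ - 2 • Γ := by
    have := mem2 f A ha0 ha0 ha0 ha0
    simpa using this
  set ψ : (Fin d → ZMod p) → (Fin d → ZMod p) := fun x =>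
    if h : ∃ z, (x, z) ∈ 2 • Γ - 2 • Γ then h.choose else 0 with hψ
  have hψs : ∀ x, (∃ z, (x, z) ∈ 2 • Γ - 2 • Γ) → (x, ψ x) ∈ 2 • Γ - 2 • Γ := by
    intro x h
    simp only [hψ, dif_pos h]
    exact h.choose_spec
  set j := jmapZ p d m γ with hj
  set red : (Fin d → ℤ) × (Fin m → ℤ) → (Fin d → ZMod p) := fun w i => (w.1 i : ZMod p) with hred
  have hdom : ∀ w, ‖j w‖ < p / 4 → ∃ z, (red w, z) ∈ 2 • Γ - 2 • Γ := by
    intro w hw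
    apply sub2_lift f A
    apply hγ
    intro i
    refine ⟨∑ k, ((γ i k).val : ℤ) * w.1 k + p * w.2 i, ?_, ?_⟩
    · push_cast
      simp [hred]
    · have h1 : ‖(j w).2 i‖ < p / 4 :=
        lt_of_le_of_lt ((norm_le_pi_norm _ i).trans (norm_snd_le _)) hw
      have h2 : ‖((∑ k, ((γ i k).val : ℤ) * w.1 k + p * w.2 i : ℤ) : ℝ)‖ < p / 4 := h1
      rw [Real.norm_eq_abs] at h2
      have h3 : 4 * |((∑ k, ((γ i k).val : ℤ) * w.1 k + p * w.2 i : ℤ) : ℝ)| < p := by linarith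
      exact_mod_cast h3.le
  have hredadd : ∀ x y, red (x + y) = red x + red y := by
    intro x y; ext i; simp [hred]
  obtain ⟨L, hL⟩ := hext ((Fin d → ℤ) × (Fin m → ℤ)) ((Fin d → ℝ) × (Fin m → ℝ)) (Fin d → ZMod p)
    (by simp) j (fun w => ψ (red w)) (p / 4) (by positivity) (by
      intro x y h1 h2 h3
      have k1 := hψs _ (hdom _ h1)
      have k2 := hψs _ (hdom _ h2)
      have k3 := hψs _ (hdom _ h3)
      have h4 := mem6 Γ k1 k2 k3
      have h5 := h6 (ψ (red x) + ψ (red y) - ψ (red (x + y))) (by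
        have e : ((red x, ψ (red x)) + (red y, ψ (red y)) - (red (x + y), ψ (red (x + y))) :
          (Fin d → ZMod p) × (Fin d → ZMod p)) =
          (0, ψ (red x) + ψ (red y) - ψ (red (x + y))) := by
          ext1
          · simp [hredadd]
          · rfl
        rw [← e]; exact h4)
      exact (sub_eq_zero.1 h5).symm)
  have hcellt : ∀ t : ZMod p, t.val * Q / p < Q := by
    intro t
    rw [Nat.div_lt_iff_lt_mul hpp, mul_comm]
    exact Nat.mul_lt_mul_of_pos_left (ZMod.val_lt _) hQ0'
  set ct : ZMod p → Fin Q := fun t => ⟨t.val * Q / p, hcellt t⟩ with hct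
  set cell : (Fin d → ZMod p) → (Fin d → Fin Q) × (Fin m → Fin Q) := fun h =>
    (fun i => ct (h i), fun k => ct (∑ i, γ k i * h i)) with hcell
  have hcard : (((Finset.univ : Finset ((Fin d → Fin Q) × (Fin m → Fin Q))).card : ℕ) : ℝ) =
      (Q : ℝ) ^ (d + m) := by
    simp [Fintype.card_prod, pow_add]
  obtain ⟨i0, -, hi0⟩ := pigeon A Finset.univ cell (fun _ _ => Finset.mem_univ _)
    (α / (Q : ℝ) ^ (d + m) * (p : ℝ) ^ d)
    (by
      have : (0 : ℝ) < (((Finset.univ : Finset ((Fin d → Fin Q) × (Fin m → Fin Q))).card : ℕ) : ℝ) := by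
        rw [hcard]; positivity
      exact_mod_cast this)
    (by
      rw [hcard]
      refine le_trans (le_of_eq ?_) hA
      field_simp)
  set H' := A.filter fun a => cell a = i0 with hH'
  have hHA : H' ⊆ A := Finset.filter_subset _ _
  have hH0 : (0 : ℝ) < H'.card := lt_of_lt_of_le (by positivity) hi0
  obtain ⟨h0, hh0⟩ : H'.Nonempty := Finset.card_pos.1 (by exact_mod_cast hH0)
  set D := dat p d m γ with hD
  have hreddat : ∀ h, red (D h) = h := by
    intro h; ext i; simp [hred, hD, dat]
  have hredsub : ∀ x y, red (x - y) = red x - red y := by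
    intro x y; ext i; simp [hred]
  have hmain : ∀ h ∈ H', f h = L (D h) + (f h0 - L (D h0)) := by
    intro h hh
    have hcl : cell h = cell h0 := by
      rw [(Finset.mem_filter.1 hh).2, (Finset.mem_filter.1 hh0).2]
    have hclt : ∀ s t : ZMod p, ct s = ct t → |(s.val : ℝ) - t.val| < c / 4 * p := by
      intro s t hst
      exact cell_close p Q s.val t.val hpp (congrArg Fin.val hst) (c / 4) hQ'
    have hn : ‖j (D h - D h0)‖ < c * (p / 4) := by
      have hpos : 0 < c * ((p : ℝ) / 4) := by positivity
      rw [map_sub, hj, hD, jmap_dat, jmap_dat, Prod.mk_sub_mk, Prod.norm_mk, max_lt_iff]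
      constructor
      · rw [pi_norm_lt_iff hpos]
        intro i
        have := hclt _ _ (congrFun (congrArg Prod.fst hcl) i)
        simp only [Pi.sub_apply, Real.norm_eq_abs]
        linarith
      · rw [pi_norm_lt_iff hpos]
        intro i
        have := hclt _ _ (congrFun (congrArg Prod.snd hcl) i)
        simp only [Pi.sub_apply, Real.norm_eq_abs]
        linarith
    have h1 := hL _ hn
    rw [map_sub, hredsub, hreddat, hreddat] at h1
    have h2 := mem2 f A (hHA hh) (hHA hh0) (hHA hh0) (hHA hh0)
    rw [add_sub_add_right_eq_sub, add_sub_add_right_eq_sub] at h2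
    have h3 := huniq _ _ _ (hψs _ ⟨_, h2⟩) h2 h00
    rw [h3] at h1
    have : f h = (f h - f h0) + f h0 := by abel
    rw [this, ← h1]; abel
  refine ⟨H', hHA, hi0, f h0 - L (D h0), fun h => L (D h), ?_, hmain⟩
  intro i
  set a : Fin d → ZMod p := fun k => L (Pi.single k 1, 0) i with ha
  set b : Fin m → ZMod p := fun k => L (0, Pi.single k 1) i with hb
  have hLf : ∀ w, L w i = ∑ k, (w.1 k : ZMod p) * a k + ∑ k, (w.2 k : ZMod p) * b k := by
    intro w
    have hw : w = ∑ k, w.1 k • ((Pi.single k 1, 0) : (Fin d → ℤ) × (Fin m → ℤ)) +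
        ∑ k, w.2 k • ((0, Pi.single k 1) : (Fin d → ℤ) × (Fin m → ℤ)) := by
      ext t
      · simp [Prod.fst_sum, Finset.sum_apply, Pi.single_apply]
      · simp [Prod.snd_sum, Finset.sum_apply, Pi.single_apply]
    conv_lhs => rw [hw]
    rw [map_add, map_sum, map_sum]
    simp only [map_zsmul, Pi.add_apply, Finset.sum_apply, Pi.smul_apply, ha, hb]
    simp only [zsmul_eq_mul]
  obtain ⟨αα, β, hαβ⟩ := alf_of p d m hpp (fun k i => ((γ k i).val : ℤ)) (fun k => ((a k).val : ℤ))
    (fun k => ((b k).val : ℤ))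
  set mm : (Fin d → ZMod p) → ℤ := fun h => (∑ i, ((h i).val : ℤ) * ((a i).val : ℤ) +
    ∑ k, (-((∑ i, ((γ k i).val : ℤ) * ((h i).val : ℤ)) / p)) * ((b k).val : ℤ)) with hmm
  have hmmL : ∀ h, L (D h) i = (mm h : ZMod p) := by
    intro h
    rw [hLf, hmm]
    simp only [hD, dat]
    push_cast
    simp
  have hαβ' : ∀ h, alfAux p d (d + m) αα β h = (mm h : ℝ) / p := by
    intro h
    rw [eq_div_iff hpr.ne', mul_comm]; exact hαβ h
  refine ⟨αα, β, fun h _ => ⟨mm h, hαβ h, hmmL h⟩, ?_⟩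
  intro h₁ hh₁ h₂ hh₂ h₃ hh₃ h₄ hh₄ hsum
  have k1 := mem2 f A (hHA hh₁) (hHA hh₂) (hHA hh₃) (hHA hh₄)
  rw [hsum, sub_self] at k1
  have k2 := huniq _ _ _ k1 h00 h00
  rw [hmain _ hh₁, hmain _ hh₂, hmain _ hh₃, hmain _ hh₄] at k2
  have k3 : L (D h₁) + L (D h₂) - L (D h₃) - L (D h₄) = 0 := by
    rw [← k2]; abel
  have k4 := congrFun k3 i
  simp only [Pi.add_apply, Pi.sub_apply, hmmL, Pi.zero_apply] at k4
  have k5 : ((mm h₁ + mm h₂ - mm h₃ - mm h₄ : ℤ) : ZMod p) = 0 := by push_cast; exact k4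
  rw [ZMod.intCast_zmod_eq_zero_iff_dvd] at k5
  obtain ⟨z, hz⟩ := k5
  refine ⟨z, ?_⟩
  have hz' : (mm h₁ + mm h₂ - mm h₃ - mm h₄ : ℝ) = p * z := by exact_mod_cast hz
  rw [hαβ', hαβ', hαβ', hαβ']
  field_simp
  linarith
end asm2

/-- **Linearization result for affine subspaces.** -/
theorem stmt1 :
    ∃ d0 : ℕ, ∀ d : ℕ, d0 ≤ d → ∀ δ : ℝ, 0 < δ →
    ∃ (p0 K : ℕ) (c : ℝ), 0 < c ∧
    ∀ p : ℕ, p.Prime → p0 ≤ p →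
    ∀ H : Finset (Fin d → ZMod p), δ * (p : ℝ) ^ d < (H.card : ℝ) →
    ∀ ξ₁ ξ₂ ξ₃ ξ₄ : (Fin d → ZMod p) → (Fin d → ZMod p),
    ∀ U : Finset ((Fin d → ZMod p) × (Fin d → ZMod p) × (Fin d → ZMod p) ×
        (Fin d → ZMod p)),
      (∀ q ∈ U, q.1 ∈ H ∧ q.2.1 ∈ H ∧ q.2.2.1 ∈ H ∧ q.2.2.2 ∈ H ∧
        q.1 + q.2.1 = q.2.2.1 + q.2.2.2) →
      δ * (H.card : ℝ) ^ 3 < (U.card : ℝ) →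
      (∀ q ∈ U, ξ₁ q.1 + ξ₂ q.2.1 - ξ₃ q.2.2.1 - ξ₄ q.2.2.2 ∈
        Submodule.span (ZMod p) {q.1, q.2.1, q.2.2.1}) →
      ∃ H' : Finset (Fin d → ZMod p), H' ⊆ H ∧ c * (p : ℝ) ^ d ≤ (H'.card : ℝ) ∧
        ∃ g : Fin d → ZMod p,
          ∃ T : (Fin d → ZMod p) → (Fin d → ZMod p),
            (∀ i : Fin d, IsALFHom p d K (↑H' : Set (Fin d → ZMod p))
              (fun h => T h i)) ∧
            ∀ h ∈ H', ξ₁ h - T h - g ∈ Submodule.span (ZMod p) {h} := by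
  classical
  refine ⟨6, fun d hd δ hδ => ?_⟩
  obtain ⟨ε', hε', q0, hA⟩ := partA (δ ^ 4) (by positivity)
  obtain ⟨c1, hc1, p1, hC⟩ := partC (ε' / 4) (ε' / 4 * (ε' ^ 2 / 32) ^ 2) (by positivity)
    (by positivity)
  obtain ⟨c, hc, K, hDD⟩ := partD d c1 hc1
  refine ⟨max q0 p1, K, c, hc, ?_⟩
  intro p hp hp0 H hH ξ₁ ξ₂ ξ₃ ξ₄ U hU hUc hspan
  have := Fact.mk hp
  have hcV : Fintype.card (Fin d → ZMod p) = p ^ d := by simp [ZMod.card]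
  have hcF : Fintype.card (ZMod p) = p := ZMod.card p
  have hcnt : (U.card : ℝ) ≤ ∑ s : Fin d → ZMod p, ∑ x : Fin d → ZMod p, ∑ y : Fin d → ZMod p,
      ind ((x, s - x, y, s - y) ∈ U) := by
    have e1 : ∑ s : Fin d → ZMod p, ∑ x : Fin d → ZMod p, ∑ y : Fin d → ZMod p,
        ind ((x, s - x, y, s - y) ∈ U) =
        ∑ t : (Fin d → ZMod p) × (Fin d → ZMod p) × (Fin d → ZMod p),
          ind ((t.2.1, t.1 - t.2.1, t.2.2, t.1 - t.2.2) ∈ U) := by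
      rw [Fintype.sum_prod_type]
      refine Finset.sum_congr rfl fun s _ => ?_
      rw [Fintype.sum_prod_type]
    rw [e1]
    have e2 : (U.card : ℝ) = ∑ q ∈ U, (1 : ℝ) := by simp
    have hinj : Set.InjOn (fun q : (Fin d → ZMod p) × (Fin d → ZMod p) × (Fin d → ZMod p) ×
        (Fin d → ZMod p) => (q.1 + q.2.1, q.1, q.2.2.1)) (U : Set _) := by
      rintro ⟨a, b, c, e⟩ hq ⟨a', b', c', e'⟩ hq' heq
      have h1 := (hU _ hq).2.2.2.2
      have h2 := (hU _ hq').2.2.2.2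
      simp only [Prod.mk.injEq] at heq h1 h2
      obtain ⟨k1, rfl, rfl⟩ := heq
      have k2 : b = b' := add_left_cancel k1
      subst k2
      have k3 : e = e' := add_left_cancel (h1.symm.trans h2)
      subst k3
      rfl
    have e3 : ∑ t ∈ U.image (fun q : (Fin d → ZMod p) × (Fin d → ZMod p) × (Fin d → ZMod p) ×
        (Fin d → ZMod p) => (q.1 + q.2.1, q.1, q.2.2.1)),
          ind ((t.2.1, t.1 - t.2.1, t.2.2, t.1 - t.2.2) ∈ U) = ∑ q ∈ U, (1 : ℝ) := by
      rw [Finset.sum_image hinj]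
      refine Finset.sum_congr rfl fun q hq => ?_
      apply ind_true'
      have h1 := (hU _ hq).2.2.2.2
      have k1 : q.1 + q.2.1 - q.1 = q.2.1 := by abel
      have k2 : q.1 + q.2.1 - q.2.2.1 = q.2.2.2 := by rw [h1]; abel
      simp only [k1, k2]
      exact hq
    rw [e2, ← e3]
    exact Finset.sum_le_sum_of_subset_of_nonneg (Finset.subset_univ _) fun _ _ _ => ind_nonneg _
  obtain ⟨l, g, W, hE⟩ := hA (ZMod p) (Fin d → ZMod p)
    (by rw [hcF]; exact le_trans (le_max_left _ _) hp0)
    (by rw [hcF, hcV]; exact Nat.pow_le_pow_right hp.pos hd)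
    (fun x => x ∈ H) ξ₁ ξ₂ ξ₃ ξ₄ (fun s x y => (x, s - x, y, s - y) ∈ U)
    (fun s x y h => (hU _ h).1)
    (by
      intro s x y h
      have h1 := hspan _ h
      rw [Submodule.mem_span_triple] at h1
      obtain ⟨a, b, e, h1⟩ := h1
      simp only at h1
      refine ⟨b, a - b, e, ?_⟩
      have : (ξ₁ x + ξ₂ (s - x)) - (ξ₃ y + ξ₄ (s - y)) =
        ξ₁ x + ξ₂ (s - x) - ξ₃ y - ξ₄ (s - y) := by abel
      rw [this, ← h1, smul_sub, sub_smul]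
      abel)
    (by
      refine le_trans ?_ hcnt
      rw [hcV]
      push_cast
      have hN : (0 : ℝ) ≤ δ * (p : ℝ) ^ d := by positivity
      have h3 : (δ * (p : ℝ) ^ d) ^ 3 ≤ (H.card : ℝ) ^ 3 := pow_le_pow_left₀ hN hH.le 3
      have h4 := mul_le_mul_of_nonneg_left h3 hδ.le
      refine le_trans (le_of_eq ?_) (le_trans h4 hUc.le)
      ring)
  obtain ⟨A, hAc, hAH, hAd⟩ := partB (fun x => x ∈ H) (fun x => ξ₁ x - l x • x) g W ε' hε' hE
  rw [hcV] at hAc hAd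
  push_cast at hAc hAd
  obtain ⟨A', hA', hA'c, hA'6⟩ := hC p d (le_trans (le_max_right _ _) hp0) A
    (fun x => ξ₁ x - l x • x) hAc (by unfold gr; convert hAd)
  obtain ⟨H', hH', hH'c, g', T, hT, hf⟩ := hDD p A' _ hA'c hA'6
  refine ⟨H', fun h hh => hAH _ (hA' (hH' hh)), hH'c, g', T, hT, ?_⟩
  intro h hh
  have h1 := hf h hh
  have h2 : ξ₁ h - T h - g' = l h • h := by
    rw [sub_sub, ← h1]; abel
  rw [h2]
  exact Submodule.smul_mem _ _ (Submodule.mem_span_singleton_self h)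
end
end

section
/- Let p be a prime, d ≥ 1 an integer, and let V, V_1, …, V_N be subspaces of 𝔽_p^d such that V_1, …, V_N are linearly independent. If N ≥ dim(V) + 2, then ∩_{i=1}^N (V + V_i) = V. -/
/-- Subspaces `V 0, …, V (N-1)` are linearly independent. -/
def SubmodulesIndep (p d N : ℕ) (V : Fin N → Submodule (ZMod p) (Fin d → ZMod p)) : Prop :=
  ∀ v : Fin N → (Fin d → ZMod p), (∀ i, v i ∈ V i) → (∑ i, v i) = 0 → ∀ i, v i = 0

/-- **Intersection property for subspaces of `𝔽_p^d`.**
If `V, V_1, …, V_N` are subspaces of `𝔽_p^d` with `V_1, …, V_N` linearly independent and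
`N ≥ dim V + 2`, then `∩_{i=1}^N (V + V_i) = V`. -/
theorem stmt2 (p d N : ℕ) (hp : p.Prime) (hd : 1 ≤ d)
    (V : Submodule (ZMod p) (Fin d → ZMod p))
    (W : Fin N → Submodule (ZMod p) (Fin d → ZMod p))
    (hindep : SubmodulesIndep p d N W)
    (hN : Module.finrank (ZMod p) V + 2 ≤ N) :
    (⨅ i, (V ⊔ W i)) = V := by
  haveI : Fact p.Prime := ⟨hp⟩
  apply le_antisymm
  · intro x hx
    rw [Submodule.mem_iInf] at hx
    have h : ∀ i, ∃ v ∈ V, ∃ w ∈ W i, v + w = x := fun i => Submodule.mem_sup.1 (hx i)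
    choose v hv w hw hvw using h
    by_contra hxV
    have hw0 : ∀ i, w i ≠ 0 := by
      intro i h0
      apply hxV
      rw [← hvw i, h0, add_zero]
      exact hv i
    have hli : LinearIndependent (ZMod p) w := by
      rw [Fintype.linearIndependent_iff]
      intro g hg i
      have := hindep (fun i => g i • w i) (fun i => (W i).smul_mem _ (hw i)) hg i
      exact (smul_eq_zero.1 this).resolve_right (hw0 i)
    have hsub : Submodule.span (ZMod p) (Set.range w) ≤ V ⊔ Submodule.span (ZMod p) {x} := by
      rw [Submodule.span_le]
      rintro _ ⟨i, rfl⟩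
      have : w i = x - v i := by rw [← hvw i]; abel
      rw [this]
      exact Submodule.sub_mem _
        (Submodule.mem_sup_right (Submodule.mem_span_singleton_self x))
        (Submodule.mem_sup_left (hv i))
    have h1 := Submodule.finrank_mono hsub
    rw [finrank_span_eq_card hli, Fintype.card_fin] at h1
    have h2 := Submodule.finrank_add_le_finrank_add_finrank V (Submodule.span (ZMod p) {x})
    have h3 := finrank_span_le_card (R := ZMod p) ({x} : Set (Fin d → ZMod p))
    simp at h3
    omega
  · exact le_iInf fun i => le_sup_left
end

section
/- Let m, s ∈ ℕ, d, N ≥ 1 be integers, p a prime, and let V, V_1, …, V_N be subspaces of 𝔽_p^d with dim(V) = m. If V_1, …, V_N are linearly independent and N ≥ m + s, then there exist indices i_1 < ⋯ < i_s in {1,…,N} such that the subspaces V, V_{i_1}, …, V_{i_s} are linearly independent. -/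
theorem aux_step (p d N : ℕ) (hp : p.Prime)
    (V : Submodule (ZMod p) (Fin d → ZMod p))
    (W : Fin N → Submodule (ZMod p) (Fin d → ZMod p))
    (hindep : SubmodulesIndep p d N W) (k : ℕ) :
    ∀ S : Finset (Fin N),
      Module.finrank (ZMod p) (V ⊓ ⨆ i ∈ S, W i : Submodule (ZMod p) (Fin d → ZMod p)) ≤ k →
      ∃ T : Finset (Fin N), S.card ≤ T.card + k ∧ V ⊓ ⨆ i ∈ T, W i = ⊥ := by
  haveI : Fact p.Prime := ⟨hp⟩
  induction k with
  | zero =>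
    intro S h
    exact ⟨S, by simp, Submodule.finrank_eq_zero.mp (by omega)⟩
  | succ k ih =>
    intro S h
    by_cases hb : V ⊓ ⨆ i ∈ S, W i = ⊥
    · exact ⟨S, by omega, hb⟩
    obtain ⟨v, hv, hv0⟩ := Submodule.exists_mem_ne_zero_of_ne_bot hb
    obtain ⟨μ, hμ⟩ := (Submodule.mem_iSup_finset_iff_exists_sum W v).mp hv.2
    obtain ⟨i, hiS, hi⟩ : ∃ i ∈ S, (μ i : Fin d → ZMod p) ≠ 0 := by
      by_contra! hc
      exact hv0 (by rw [← hμ]; exact Finset.sum_eq_zero hc)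
    have hnot : v ∉ ⨆ j ∈ S.erase i, W j := by
      intro hmem
      obtain ⟨ν, hν⟩ := (Submodule.mem_iSup_finset_iff_exists_sum W v).mp hmem
      have := hindep (fun j => (if j ∈ S then (μ j : Fin d → ZMod p) else 0) -
        (if j ∈ S.erase i then (ν j : Fin d → ZMod p) else 0)) ?_ ?_ i
      · simp [hiS] at this
        exact hi (by simp [this])
      · intro j
        refine Submodule.sub_mem _ ?_ ?_
        · split_ifs
          · exact (μ j).2
          · exact Submodule.zero_mem _
        · split_ifs
          · exact (ν j).2
          · exact Submodule.zero_mem _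
      · rw [Finset.sum_sub_distrib, Finset.sum_ite_mem, Finset.sum_ite_mem,
          Finset.univ_inter, Finset.univ_inter, hμ, hν, sub_self]
    have hlt : V ⊓ ⨆ j ∈ S.erase i, W j < V ⊓ ⨆ j ∈ S, W j := by
      refine lt_of_le_of_ne (inf_le_inf_left _
        (biSup_mono fun j hj => Finset.mem_of_mem_erase hj)) ?_
      intro he
      rw [← he] at hv
      exact hnot hv.2
    have hfr := Submodule.finrank_lt_finrank_of_lt hlt
    obtain ⟨T, hT, hT'⟩ := ih (S.erase i) (by omega)
    refine ⟨T, ?_, hT'⟩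
    have := Finset.card_erase_add_one hiS
    omega

/-- If `V, V_1, …, V_N` are subspaces of `𝔽_p^d` with `dim V = m`, the `V_i` are linearly
independent and `N ≥ m + s`, then one can select `s` of the `V_i` (with increasing
indices) so that `V` together with the selected subspaces is linearly independent. -/
theorem stmt3 (p d N m s : ℕ) (hp : p.Prime) (hd : 1 ≤ d) (hN : 1 ≤ N)
    (V : Submodule (ZMod p) (Fin d → ZMod p))
    (W : Fin N → Submodule (ZMod p) (Fin d → ZMod p))
    (hV : Module.finrank (ZMod p) V = m)
    (hindep : SubmodulesIndep p d N W)
    (hNms : m + s ≤ N) :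
    ∃ f : Fin s → Fin N, StrictMono f ∧
      SubmodulesIndep p d (s + 1) (Fin.cons V (fun i => W (f i))) := by
  haveI : Fact p.Prime := ⟨hp⟩
  obtain ⟨T, hT, hbot⟩ := aux_step p d N hp V W hindep m Finset.univ
    (hV ▸ Submodule.finrank_mono inf_le_left)
  rw [Finset.card_univ, Fintype.card_fin] at hT
  obtain ⟨T', hT', hc⟩ := Finset.exists_subset_card_eq (show s ≤ T.card by omega)
  refine ⟨T'.orderEmbOfFin hc, (T'.orderEmbOfFin hc).strictMono, ?_⟩
  have hinj := (T'.orderEmbOfFin hc).injective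
  have hmemT := fun i => hT' (T'.orderEmbOfFin_mem hc i)
  generalize T'.orderEmbOfFin hc = f at *
  intro v hv hsum
  rw [Fin.sum_univ_succ] at hsum
  have h0 : v 0 ∈ V := by simpa using hv 0
  have hs : ∀ i : Fin s, v i.succ ∈ W (f i) := fun i => by simpa using hv i.succ
  have hv0 : v 0 = 0 := by
    have : v 0 ∈ V ⊓ ⨆ i ∈ T, W i := by
      refine ⟨h0, ?_⟩
      rw [eq_neg_of_add_eq_zero_left hsum]
      refine Submodule.neg_mem _ (Submodule.sum_mem _ fun i _ => ?_)
      exact (le_biSup W (hmemT i)) (hs i)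
    rw [hbot] at this
    simpa using this
  rw [hv0, zero_add] at hsum
  have key := hindep (fun j => ∑ i : Fin s, if f i = j then v i.succ else 0) ?_ ?_
  · intro i
    refine Fin.cases hv0 (fun i => ?_) i
    have := key (f i)
    simpa [hinj.eq_iff] using this
  · intro j
    refine Submodule.sum_mem _ fun i _ => ?_
    split_ifs with h
    · exact h ▸ hs i
    · exact Submodule.zero_mem _
  · rw [Finset.sum_comm]
    simpa using hsum
end

section
/- Let d, k, m ≥ 1 be integers, k' ∈ ℕ, p a prime, U a subspace of 𝔽_p^d of dimension k', and 𝒰 a collection of subspaces of 𝔽_p^d, each of dimension at most k and each containing U. Then either there exist V_1, …, V_m ∈ 𝒰 which are linearly independent modulo U, or there exists a subspace W of 𝔽_p^d of dimension at most k' + (m−1)(k−k'), containing U, such that W ∩ V ≠ U for every V ∈ 𝒰. -/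
/-- Subspaces `V 0, …, V (m-1)`, each containing `U`, are linearly independent modulo `U`. -/
def SubmodulesIndepMod (p d m : ℕ) (U : Submodule (ZMod p) (Fin d → ZMod p))
    (V : Fin m → Submodule (ZMod p) (Fin d → ZMod p)) : Prop :=
  ∀ v : Fin m → (Fin d → ZMod p), (∀ i, v i ∈ V i) → (∑ i, v i) = 0 → ∀ i, v i ∈ U

/-- Let `U` be a subspace of `𝔽_p^d` of dimension `k'` and let `𝒰` be a collection of
subspaces of dimension at most `k`, each containing `U`.  Then either `𝒰` contains `m`
subspaces which are linearly independent modulo `U`, or there is a subspace `W ⊇ U` of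
dimension at most `k' + (m-1)(k-k')` with `W ∩ V ≠ U` for every `V ∈ 𝒰`. -/
theorem stmt4 (p d k m k' : ℕ) (hp : p.Prime) (hd : 1 ≤ d) (hk : 1 ≤ k) (hm : 1 ≤ m)
    (U : Submodule (ZMod p) (Fin d → ZMod p))
    (hU : Module.finrank (ZMod p) U = k')
    (𝒰 : Set (Submodule (ZMod p) (Fin d → ZMod p)))
    (h𝒰 : ∀ V ∈ 𝒰, Module.finrank (ZMod p) V ≤ k ∧ U ≤ V) :
    (∃ V : Fin m → Submodule (ZMod p) (Fin d → ZMod p),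
      (∀ i, V i ∈ 𝒰) ∧ SubmodulesIndepMod p d m U V) ∨
    (∃ W : Submodule (ZMod p) (Fin d → ZMod p),
      Module.finrank (ZMod p) W ≤ k' + (m - 1) * (k - k') ∧ U ≤ W ∧
      ∀ V ∈ 𝒰, W ⊓ V ≠ U) := by
  haveI := Fact.mk hp
  by_cases hR : (∃ W : Submodule (ZMod p) (Fin d → ZMod p),
      Module.finrank (ZMod p) W ≤ k' + (m - 1) * (k - k') ∧ U ≤ W ∧
      ∀ V ∈ 𝒰, W ⊓ V ≠ U)
  · exact Or.inr hR
  left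
  push Not at hR
  have key : ∀ n, n ≤ m → ∃ V : Fin n → Submodule (ZMod p) (Fin d → ZMod p),
      (∀ i, V i ∈ 𝒰) ∧
      (∀ v : Fin n → (Fin d → ZMod p), (∀ i, v i ∈ V i) → (∑ i, v i) ∈ U → ∀ i, v i ∈ U) ∧
      ∃ W : Submodule (ZMod p) (Fin d → ZMod p), U ≤ W ∧ (∀ i, V i ≤ W) ∧
        Module.finrank (ZMod p) W ≤ k' + n * (k - k') := by
    intro n
    induction n with
    | zero =>
      intro _
      exact ⟨fun i => i.elim0, fun i => i.elim0, fun _ _ _ i => i.elim0, U, le_rfl,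
        fun i => i.elim0, by omega⟩
    | succ n ih =>
      intro hn
      obtain ⟨V, hV, hind, W, hUW, hVW, hW⟩ := ih (by omega)
      have hle : n * (k - k') ≤ (m - 1) * (k - k') := Nat.mul_le_mul_right _ (by omega)
      obtain ⟨X, hX, hXW⟩ := hR W (by omega) hUW
      refine ⟨Fin.cons X V, ?_, ?_, W ⊔ X, hUW.trans le_sup_left, ?_, ?_⟩
      · intro i
        refine Fin.cases ?_ (fun j => ?_) i
        · simpa using hX
        · simpa using hV j
      · intro v hv hs
        rw [Fin.sum_univ_succ] at hs
        have h0 : v 0 ∈ X := by simpa using hv 0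
        have hj : ∀ j : Fin n, v j.succ ∈ V j := fun j => by simpa using hv j.succ
        have hsW : (∑ j : Fin n, v j.succ) ∈ W := Submodule.sum_mem _ fun j _ => hVW j (hj j)
        have h0W : v 0 ∈ W := (Submodule.add_mem_iff_left W hsW).1 (hUW hs)
        have h0U : v 0 ∈ U := by
          rw [← hXW]
          exact ⟨h0W, h0⟩
        have hsU := (Submodule.add_mem_iff_right U h0U).1 hs
        intro i
        refine Fin.cases h0U (fun j => ?_) i
        exact hind (fun j => v j.succ) hj hsU j
      · intro i
        refine Fin.cases ?_ (fun j => ?_) i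
        · simp
        · simpa using (hVW j).trans le_sup_left
      · have h1 := Submodule.finrank_sup_add_finrank_inf_eq W X
        rw [hXW, hU] at h1
        have h2 := (h𝒰 X hX).1
        have h3 := Submodule.finrank_mono (h𝒰 X hX).2
        rw [Nat.add_mul]
        omega
  obtain ⟨V, hV, hind, -⟩ := key m le_rfl
  exact ⟨V, hV, fun v hv hs => hind v hv (hs ▸ U.zero_mem)⟩
end

section
/- Let d ≥ 1 be an integer and k, s ∈ ℕ. There exists a threshold p_0 depending only on d, k and s such that for every prime p ≥ p_0 the following holds. Let M : 𝔽_p^d → 𝔽_p be a non-degenerate quadratic form with associated matrix A, let h, h_1, …, h_k ∈ 𝔽_p^d be linearly independent vectors, and let f ∈ 𝔽_p[x_1,…,x_d] have total degree at most s and satisfy that the polynomial n ↦ ((nA)·h)·f(n) lies in J^M_{h_1,…,h_k}. If rank(M|_{span{h,h_1,…,h_k}^{⊥_M}}) ≥ 3 or d ≥ 2k + 5, then f ∈ J^M_{h_1,…,h_k}. -/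
noncomputable section

open MvPolynomial

/-- The quadratic polynomial `n ↦ (nA)·n`. -/
def quadPoly (p d : ℕ) (A : Matrix (Fin d) (Fin d) (ZMod p)) :
    MvPolynomial (Fin d) (ZMod p) :=
  ∑ i : Fin d, ∑ j : Fin d, MvPolynomial.C (A i j) * (MvPolynomial.X i * MvPolynomial.X j)

/-- The linear polynomial `n ↦ (hA)·n`. -/
def linPoly (p d : ℕ) (A : Matrix (Fin d) (Fin d) (ZMod p)) (h : Fin d → ZMod p) :
    MvPolynomial (Fin d) (ZMod p) :=
  ∑ j : Fin d, MvPolynomial.C (∑ i : Fin d, h i * A i j) * MvPolynomial.X j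

/-- The ideal `J^M_V` attached to the quadratic form with associated matrix `A` and the
set of vectors `V`: it is generated by `n ↦ (nA)·n` and `n ↦ (hA)·n` for `h ∈ V`. -/
def JM (p d : ℕ) (A : Matrix (Fin d) (Fin d) (ZMod p)) (V : Set (Fin d → ZMod p)) :
    Ideal (MvPolynomial (Fin d) (ZMod p)) :=
  Ideal.span ({quadPoly p d A} ∪ (linPoly p d A '' V))

/-- `M` is the quadratic form `n ↦ (nA)·n + n·u + v` with `A` symmetric. -/
def IsQuadFormWith (p d : ℕ) (M : (Fin d → ZMod p) → ZMod p)
    (A : Matrix (Fin d) (Fin d) (ZMod p)) (u : Fin d → ZMod p) (v : ZMod p) : Prop :=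
  A.IsSymm ∧ ∀ n : Fin d → ZMod p,
    M n = (∑ j : Fin d, (∑ i : Fin d, n i * A i j) * n j) + (∑ i : Fin d, n i * u i) + v

/-- The linear functional `n ↦ w · n` as a linear map. -/
def dotL (p d : ℕ) (w : Fin d → ZMod p) : (Fin d → ZMod p) →ₗ[ZMod p] ZMod p where
  toFun n := ∑ j : Fin d, w j * n j
  map_add' x y := by simp [mul_add, Finset.sum_add_distrib]
  map_smul' c x := by
    simp only [Pi.smul_apply, smul_eq_mul, RingHom.id_apply, Finset.mul_sum]
    exact Finset.sum_congr rfl fun j _ => by ring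

/-- `W^{⊥_M}`, the `M`-orthogonal complement of `W`:
all `n` with `(mA)·n = 0` for every `m ∈ W`. -/
def perpM (p d : ℕ) (A : Matrix (Fin d) (Fin d) (ZMod p))
    (W : Submodule (ZMod p) (Fin d → ZMod p)) : Submodule (ZMod p) (Fin d → ZMod p) :=
  ⨅ m ∈ W, LinearMap.ker (dotL p d (fun j => ∑ i : Fin d, m i * A i j))

/-- The rank of `M` restricted to the subspace `W`: `dim W - dim (W ∩ W^{⊥_M})`. -/
def rankRes (p d : ℕ) (A : Matrix (Fin d) (Fin d) (ZMod p))
    (W : Submodule (ZMod p) (Fin d → ZMod p)) : ℕ :=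
  Module.finrank (ZMod p) W - Module.finrank (ZMod p) ↥(W ⊓ perpM p d A W)

def linF (F : Type) [Field F] (d : ℕ) : (Fin d → F) →ₗ[F] MvPolynomial (Fin d) F where
  toFun c := ∑ j : Fin d, C (c j) * X j
  map_add' x y := by simp [add_mul, Finset.sum_add_distrib]
  map_smul' c x := by
    simp only [Pi.smul_apply, smul_eq_mul, RingHom.id_apply, Finset.smul_sum, C_mul, smul_eq_C_mul]
    exact Finset.sum_congr rfl fun j _ => by ring

theorem linF_apply {F : Type} [Field F] {d : ℕ} (c : Fin d → F) :
    linF F d c = ∑ j : Fin d, C (c j) * X j := rfl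

theorem linF_eq_zero {F : Type} [Field F] {d : ℕ} (c : Fin d → F) (hc : linF F d c = 0) :
    c = 0 := by
  funext j
  have := congrArg (eval (Pi.single j (1 : F))) hc
  simpa [linF_apply, Pi.single_apply] using this

theorem exists_phi {F : Type} [Field F] {d : ℕ} (U : Submodule F (Fin d → F)) :
    ∃ φ : MvPolynomial (Fin d) F →ₐ[F] MvPolynomial (Fin d) F,
      (∀ f, φ f = 0 ↔ f ∈ Ideal.span (linF F d '' (U : Set (Fin d → F)))) ∧
      ∀ c, φ (linF F d c) = 0 ↔ c ∈ U := by
  obtain ⟨g, hg⟩ := LinearMap.exists_rightInverse_of_surjective U.mkQ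
    (LinearMap.range_eq_top.2 U.mkQ_surjective)
  have hg' : ∀ x, U.mkQ (g x) = x := fun x => LinearMap.congr_fun hg x
  set φ : MvPolynomial (Fin d) F →ₐ[F] MvPolynomial (Fin d) F :=
    aeval (fun j => linF F d (g (U.mkQ (Pi.single j 1)))) with hφ
  have h1 : ∀ c, φ (linF F d c) = linF F d (g (U.mkQ c)) := by
    intro c
    conv_rhs => rw [pi_eq_sum_univ' c]
    rw [linF_apply c]
    simp only [map_sum, map_mul, map_smul, hφ, aeval_X]
    refine Finset.sum_congr rfl fun j _ => ?_
    rw [← algebraMap_eq, AlgHom.commutes, algebraMap_eq, smul_eq_C_mul]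
  have h2 : ∀ c, φ (linF F d c) = 0 ↔ c ∈ U := by
    intro c
    rw [h1]
    constructor
    · intro h
      have := linF_eq_zero _ h
      have h3 := hg' (U.mkQ c)
      rw [this, map_zero] at h3
      simpa using h3.symm
    · intro h
      have : U.mkQ c = 0 := by simpa using h
      simp [this]
  have h4 : ∀ f, f - φ f ∈ Ideal.span (linF F d '' (U : Set (Fin d → F))) := by
    intro f
    rw [← Ideal.Quotient.eq]
    have : (Ideal.Quotient.mkₐ F (Ideal.span (linF F d '' (U : Set (Fin d → F))))) =
        (Ideal.Quotient.mkₐ F (Ideal.span (linF F d '' (U : Set (Fin d → F))))).comp φ := by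
      apply MvPolynomial.algHom_ext
      intro j
      simp only [AlgHom.comp_apply, Ideal.Quotient.mkₐ_eq_mk]
      rw [Ideal.Quotient.eq]
      have hX : (X j : MvPolynomial (Fin d) F) = linF F d (Pi.single j 1) := by
        simp [linF_apply, Pi.single_apply]
      rw [hX, h1, ← map_sub]
      apply Ideal.subset_span
      refine ⟨_, ?_, rfl⟩
      have : U.mkQ (Pi.single j 1 - g (U.mkQ (Pi.single j 1))) = 0 := by
        rw [map_sub, hg', sub_self]
      exact (Submodule.Quotient.mk_eq_zero U).1 this
    exact DFunLike.congr_fun this f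
  refine ⟨φ, fun f => ⟨fun h => ?_, fun h => ?_⟩, h2⟩
  · simpa [h] using h4 f
  · have : Ideal.span (linF F d '' (U : Set (Fin d → F))) ≤ RingHom.ker φ.toRingHom := by
      rw [Ideal.span_le]
      rintro _ ⟨c, hc, rfl⟩
      exact (h2 c).2 hc
    exact this h

theorem core {F : Type} [Field F] {d : ℕ} (U : Submodule F (Fin d → F)) (c : Fin d → F)
    (hc : c ∉ U) (Q f : MvPolynomial (Fin d) F)
    (hQ : Q ∉ Ideal.span (linF F d '' ((U ⊔ Submodule.span F {c} : Submodule F (Fin d → F)) :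
      Set (Fin d → F))))
    (hf : linF F d c * f ∈ Ideal.span ({Q} ∪ linF F d '' (U : Set (Fin d → F)))) :
    f ∈ Ideal.span ({Q} ∪ linF F d '' (U : Set (Fin d → F))) := by
  obtain ⟨φ, hφ, hφ'⟩ := exists_phi U
  obtain ⟨ψ, hψ, hψ'⟩ := exists_phi (U ⊔ Submodule.span F {c})
  rw [Ideal.span_union, Ideal.mem_span_singleton_sup] at hf ⊢
  obtain ⟨g, a, ha, hga⟩ := hf
  have hUle : Ideal.span (linF F d '' (U : Set (Fin d → F))) ≤
     Ideal.span (linF F d '' ((U ⊔ Submodule.span F {c} : Submodule F (Fin d → F)) :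
      Set (Fin d → F))) := by
    apply Ideal.span_mono
    apply Set.image_mono
    exact (le_sup_left : U ≤ _)
  have h1 : ψ g = 0 := by
    have e := congrArg ψ hga
    have e1 : ψ a = 0 := (hψ a).2 (hUle ha)
    have e2 : ψ (linF F d c) = 0 := (hψ' c).2 (Submodule.mem_sup_right (Submodule.mem_span_singleton_self c))
    rw [map_add, map_mul, map_mul, e1, e2, zero_mul, add_zero] at e
    rcases mul_eq_zero.1 e with e | e
    · exact e
    · exact absurd ((hψ Q).1 e) hQ
  have h2 : g ∈ Ideal.span {linF F d c} ⊔ Ideal.span (linF F d '' (U : Set (Fin d → F))) := by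
    refine (?_ : Ideal.span (linF F d '' ((U ⊔ Submodule.span F {c} : Submodule F (Fin d → F)) :
      Set (Fin d → F))) ≤ _) ((hψ g).1 h1)
    rw [Ideal.span_le]
    rintro _ ⟨x, hx, rfl⟩
    obtain ⟨y, hy, z, hz, rfl⟩ := Submodule.mem_sup.1 hx
    obtain ⟨t, rfl⟩ := Submodule.mem_span_singleton.1 hz
    rw [map_add, map_smul, smul_eq_C_mul]
    refine Ideal.add_mem _ (Ideal.mem_sup_right (Ideal.subset_span ⟨y, hy, rfl⟩)) ?_
    exact Ideal.mul_mem_left _ _ (Ideal.mem_sup_left (Ideal.mem_span_singleton_self _))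
  rw [Ideal.mem_span_singleton_sup] at h2
  obtain ⟨g', b, hb, hgb⟩ := h2
  refine ⟨g', f - g' * Q, ?_, by ring⟩
  rw [← hφ]
  have h3 : φ (linF F d c * (f - g' * Q)) = 0 := by
    rw [hφ]
    have : linF F d c * (f - g' * Q) = a + b * Q := by
      have : linF F d c * f = (g' * linF F d c + b) * Q + a := by rw [hgb, hga]
      rw [mul_sub, this]; ring
    rw [this]
    exact Ideal.add_mem _ ha (Ideal.mul_mem_right _ _ hb)
  rw [map_mul] at h3
  rcases mul_eq_zero.1 h3 with e | e
  · exact absurd ((hφ' c).1 e) hc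
  · exact e

theorem linPoly_eq (p d : ℕ) [Fact p.Prime] (A : Matrix (Fin d) (Fin d) (ZMod p))
    (h : Fin d → ZMod p) : linPoly p d A h = linF (ZMod p) d (A.vecMulLinear h) := by
  simp [linPoly, linF_apply, Matrix.vecMul, dotProduct]

theorem mem_perpM {p d : ℕ} {A : Matrix (Fin d) (Fin d) (ZMod p)}
    {W : Submodule (ZMod p) (Fin d → ZMod p)} {n : Fin d → ZMod p} :
    n ∈ perpM p d A W ↔ ∀ m ∈ W, ∑ j, (∑ i, m i * A i j) * n j = 0 := by
  simp [perpM, dotL]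

theorem sum_eq_toBilin (p d : ℕ) (A : Matrix (Fin d) (Fin d) (ZMod p)) (m n : Fin d → ZMod p) :
    ∑ j, (∑ i, m i * A i j) * n j = Matrix.toBilin' A m n := by
  rw [Matrix.toBilin'_apply]
  simp only [Finset.sum_mul]
  rw [Finset.sum_comm]

theorem perpM_eq (p d : ℕ) [Fact p.Prime] (A : Matrix (Fin d) (Fin d) (ZMod p))
    (W : Submodule (ZMod p) (Fin d → ZMod p)) :
    perpM p d A W = (Matrix.toBilin' A).orthogonal W := by
  ext n
  rw [mem_perpM, LinearMap.BilinForm.mem_orthogonal_iff]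
  simp only [sum_eq_toBilin]

theorem finrank_perpM (p d : ℕ) [Fact p.Prime] (A : Matrix (Fin d) (Fin d) (ZMod p))
    (hA : A.IsSymm) (hdet : A.det ≠ 0)
    (W : Submodule (ZMod p) (Fin d → ZMod p)) :
    Module.finrank (ZMod p) (perpM p d A W) = d - Module.finrank (ZMod p) W := by
  rw [perpM_eq, LinearMap.BilinForm.finrank_orthogonal]
  · simp
  · exact LinearMap.BilinForm.nondegenerate_toBilin'_of_det_ne_zero' A hdet

/-- If `h, h_1, …, h_k` are linearly independent, `f` has degree at most `s` and
`((nA)·h)·f(n) ∈ J^M_{h_1,…,h_k}`, then (under a rank or dimension condition, for large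
`p`) `f ∈ J^M_{h_1,…,h_k}`. -/
theorem stmt5 (d k s : ℕ) (hd : 1 ≤ d) :
    ∃ p0 : ℕ, ∀ p : ℕ, p.Prime → p0 ≤ p →
    ∀ (M : (Fin d → ZMod p) → ZMod p) (A : Matrix (Fin d) (Fin d) (ZMod p))
      (u : Fin d → ZMod p) (v : ZMod p),
      IsQuadFormWith p d M A u v → A.det ≠ 0 →
    ∀ (h : Fin d → ZMod p) (hs : Fin k → Fin d → ZMod p),
      LinearIndependent (ZMod p) (Fin.cons h hs : Fin (k + 1) → Fin d → ZMod p) →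
    ∀ f : MvPolynomial (Fin d) (ZMod p), f.totalDegree ≤ s →
      (∑ i : Fin d, MvPolynomial.C (∑ j : Fin d, A i j * h j) * MvPolynomial.X i) * f ∈
        JM p d A (Submodule.span (ZMod p) (Set.range hs) : Set (Fin d → ZMod p)) →
      (3 ≤ rankRes p d A
          (perpM p d A
            (Submodule.span (ZMod p) (Set.range (Fin.cons h hs : Fin (k + 1) → Fin d → ZMod p)))) ∨
        2 * k + 5 ≤ d) →
      f ∈ JM p d A (Submodule.span (ZMod p) (Set.range hs) : Set (Fin d → ZMod p)) := by
  refine ⟨3, ?_⟩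
  intro p hp hp3 M A u v hM hdet h hs hli f _ hf hcond
  haveI : Fact p.Prime := ⟨hp⟩
  have hsym := hM.1
  set V := Submodule.span (ZMod p) (Set.range hs) with hV
  set V' := Submodule.span (ZMod p)
    (Set.range (Fin.cons h hs : Fin (k + 1) → Fin d → ZMod p)) with hV'
  have hinj : Function.Injective A.vecMulLinear :=
    Matrix.vecMul_injective_of_isUnit ((Matrix.isUnit_iff_isUnit_det A).2 hdet.isUnit)
  have hhV : h ∉ V := (linearIndependent_finCons.1 hli).2
  have himg : linPoly p d A '' (V : Set (Fin d → ZMod p)) =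
      linF (ZMod p) d '' ((V.map A.vecMulLinear : Submodule _ _) : Set (Fin d → ZMod p)) := by
    rw [Submodule.map_coe, Set.image_image]
    exact Set.image_congr fun x _ => linPoly_eq p d A x
  have hL : (∑ i : Fin d, MvPolynomial.C (∑ j : Fin d, A i j * h j) * MvPolynomial.X i) =
      linF (ZMod p) d (A.vecMulLinear h) := by
    rw [← linPoly_eq]
    unfold linPoly
    refine Finset.sum_congr rfl fun i _ => ?_
    congr 2
    refine Finset.sum_congr rfl fun j _ => ?_
    rw [hsym.apply, mul_comm]
  unfold JM at hf ⊢
  rw [himg] at hf ⊢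
  rw [hL] at hf
  refine core _ (A.vecMulLinear h) ?_ _ f ?_ hf
  · rintro ⟨x, hx, hxh⟩
    exact hhV (hinj hxh ▸ hx)
  intro hQ
  have hV'eq : V' = Submodule.span (ZMod p) {h} ⊔ V := by
    rw [hV', Fin.range_cons, Submodule.span_insert]
  -- the quadratic form vanishes on `perpM V'`
  have hiso : ∀ n ∈ perpM p d A V', Matrix.toBilin' A n n = 0 := by
    intro n hn
    have hle : Ideal.span (linF (ZMod p) d '' ((V.map A.vecMulLinear ⊔
        Submodule.span (ZMod p) {A.vecMulLinear h} : Submodule (ZMod p) (Fin d → ZMod p)) :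
        Set (Fin d → ZMod p))) ≤ RingHom.ker (eval n) := by
      rw [Ideal.span_le]
      rintro _ ⟨x, hx, rfl⟩
      rw [← Set.image_singleton, ← Submodule.map_span, ← Submodule.map_sup] at hx
      obtain ⟨m, hm, rfl⟩ := hx
      rw [sup_comm, ← hV'eq] at hm
      have := mem_perpM.1 hn m hm
      rw [← linPoly_eq]
      simpa [linPoly] using this
    have h0 : eval n (quadPoly p d A) = 0 := hle hQ
    rw [Matrix.toBilin'_apply, ← h0]
    simp only [quadPoly, map_sum, map_mul, eval_C, eval_X]
    refine Finset.sum_congr rfl fun i _ => Finset.sum_congr rfl fun j _ => ?_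
    ring
  have hcomm : ∀ x y, Matrix.toBilin' A x y = Matrix.toBilin' A y x := by
    intro x y
    rw [Matrix.toBilin'_apply, Matrix.toBilin'_apply, Finset.sum_comm]
    refine Finset.sum_congr rfl fun i _ => Finset.sum_congr rfl fun j _ => ?_
    rw [hsym.apply]; ring
  have h2 : (2 : ZMod p) ≠ 0 := by
    intro h
    have : ((2 : ℕ) : ZMod p) = 0 := by exact_mod_cast h
    rw [ZMod.natCast_eq_zero_iff] at this
    exact absurd (Nat.le_of_dvd (by norm_num) this) (by omega)
  have hle : perpM p d A V' ≤ perpM p d A (perpM p d A V') := by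
    intro n hn
    rw [mem_perpM]
    intro m hm
    rw [sum_eq_toBilin]
    have e := hiso _ (add_mem hm hn)
    simp only [map_add, LinearMap.add_apply, hiso m hm, hiso n hn, hcomm n m] at e
    have : (2 : ZMod p) * Matrix.toBilin' A m n = 0 := by linear_combination e
    exact (mul_eq_zero.1 this).resolve_left h2
  rcases hcond with hc | hc
  · unfold rankRes at hc
    rw [inf_eq_left.2 hle] at hc
    omega
  · have e1 := Submodule.finrank_mono hle
    rw [finrank_perpM p d A hsym hdet (perpM p d A V'), finrank_perpM p d A hsym hdet V'] at e1
    have e2 : Module.finrank (ZMod p) V' = k + 1 := by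
      rw [hV', finrank_span_eq_card hli, Fintype.card_fin]
    omega
end
end

section
/- Let m, k, s ∈ ℕ, d, d' ≥ 1 be integers, and δ > 0. There exists a threshold p_0 depending only on δ, d and k such that for every prime p ≥ p_0 the following holds. Let M : 𝔽_p^d → 𝔽_p be a non-degenerate quadratic form, let V, U_1, …, U_k be subspaces of 𝔽_p^d such that U_1, …, U_k all have the same dimension and the pair (U_i, V) is linearly independent for every 1 ≤ i ≤ k, set U_0 := {0}, and let P ⊆ 𝔽_p^d with |P| > δ·p^{d'}. Let f ∈ 𝔽_p[x_1,…,x_d] have total degree at most s, and suppose f ∈ J^M_{span{h_1,…,h_m}+V} for all h_1, …, h_m ∈ P such that the tuple (h_1,…,h_m, U_i, V) is linearly independent for every 0 ≤ i ≤ k. If d' ≥ max{dim(V) + m + s, dim(U_k) + dim(V) + m, 2·dim(V) + 2m + 5} (with dim(U_k) interpreted as 0 when k = 0), then f ∈ J^M_V. -/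
noncomputable section

open MvPolynomial

/-- The tuple `(h 0, …, h (m-1), U, V)` of vectors and two subspaces of `𝔽_p^d` is
linearly independent. -/
def VecSubIndep (p d : ℕ) {m : ℕ} (h : Fin m → (Fin d → ZMod p))
    (U V : Submodule (ZMod p) (Fin d → ZMod p)) : Prop :=
  ∀ (c : Fin m → ZMod p), ∀ u ∈ U, ∀ w ∈ V,
    (∑ ℓ, c ℓ • h ℓ) + u + w = 0 → (∀ ℓ, c ℓ = 0) ∧ u = 0 ∧ w = 0

open Polynomial in
theorem poly_ne {F : Type*} [Field F] (h2 : (2:F) ≠ 0) (u b c : F) (hb : b ≠ 0) (hc : c ≠ 0)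
   (T : Polynomial F) (h : Polynomial.C u * T^2 + (Polynomial.C b * Polynomial.X^2 + Polynomial.C c) = 0) : False := by
  have hd := congrArg Polynomial.derivative h
  simp only [Polynomial.derivative_add, Polynomial.derivative_C_mul, Polynomial.derivative_pow, Polynomial.derivative_X, Polynomial.derivative_C, Polynomial.derivative_zero] at hd
  simp at hd
  rw [show (Polynomial.C 2 : Polynomial F) = 2 from rfl] at hd
  have h2' : Polynomial.C ((2:F)⁻¹) * 2 = 1 := by
    rw [show (2:Polynomial F) = Polynomial.C 2 from rfl, ← Polynomial.C_mul, inv_mul_cancel₀ h2, Polynomial.C_1]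
  have e1 : Polynomial.C b * Polynomial.X = - (Polynomial.C u * T * Polynomial.derivative T) := by
    linear_combination (Polynomial.C ((2:F)⁻¹)) * hd - (Polynomial.C b * Polynomial.X + Polynomial.C u * T * Polynomial.derivative T) * h2'
  have hT : T ∣ Polynomial.C c := by
    refine ⟨-Polynomial.C u * T + Polynomial.C u * Polynomial.derivative T * Polynomial.X, ?_⟩
    linear_combination h - Polynomial.X * e1
  have hu : IsUnit T := isUnit_of_dvd_unit hT (Polynomial.isUnit_C.2 hc.isUnit)
  obtain ⟨r, hr, rfl⟩ := Polynomial.isUnit_iff.1 hu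
  have := congrArg (fun q => Polynomial.coeff q 2) h
  rw [← Polynomial.C_pow, ← Polynomial.C_mul] at this
  simp [-map_mul, -map_pow] at this
  exact hb this

theorem prime_opt {F κ : Type*} [Field F] [Fintype κ] [DecidableEq κ] (h2 : (2:F) ≠ 0) (a : Option κ → F)
    (h0 : a none ≠ 0) (j k : κ) (hjk : j ≠ k) (hj : a (some j) ≠ 0) (hk : a (some k) ≠ 0) :
    Prime (∑ l, C (a l) * X l ^ 2 : MvPolynomial (Option κ) F) := by
  rw [← MulEquiv.prime_iff (optionEquivLeft F κ)]
  set g : MvPolynomial κ F := ∑ l, C (a (some l)) * X l ^ 2 with hg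
  have e : optionEquivLeft F κ (∑ l, C (a l) * X l ^ 2) =
     Polynomial.C (C (a none)) * Polynomial.X ^ 2 + Polynomial.C g := by
    simp [Fintype.sum_option, optionEquivLeft_X_none, optionEquivLeft_X_some, optionEquivLeft_C, hg]
  rw [e]
  rw [← irreducible_iff_prime]
  have hu : (C (a none)⁻¹ * C (a none) : MvPolynomial κ F) = 1 := by
    rw [← C_mul, inv_mul_cancel₀ h0, C_1]
  have e2 : Polynomial.C (C (a none)) * Polynomial.X ^ 2 + Polynomial.C g = 
    Polynomial.C (C (a none)) * (Polynomial.X ^ 2 + Polynomial.C (C (a none)⁻¹ * g)) := by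
    have : Polynomial.C (C (a none)) * Polynomial.C (C (a none)⁻¹) = (1 : Polynomial (MvPolynomial κ F)) := by
      rw [← Polynomial.C_mul, mul_comm, hu, Polynomial.C_1]
    rw [Polynomial.C_mul]
    linear_combination - Polynomial.C g * this
  have hunit : IsUnit (Polynomial.C (C (a none)) : Polynomial (MvPolynomial κ F)) :=
    Polynomial.isUnit_C.2 (h0.isUnit.map C)
  rw [e2, irreducible_isUnit_mul hunit]
  have hdeg : (Polynomial.X ^ 2 + Polynomial.C (C (a none)⁻¹ * g)).natDegree = 2 := 
    Polynomial.natDegree_X_pow_add_C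
  rw [Polynomial.Monic.irreducible_iff_roots_eq_zero_of_degree_le_three
    (Polynomial.monic_X_pow_add_C _ (by norm_num)) (by omega) (by omega)]
  rw [Multiset.eq_zero_iff_forall_notMem]
  intro t ht
  have ht := (Polynomial.mem_roots'.1 ht).2
  simp [Polynomial.IsRoot] at ht
  have ht2 : C (a none) * t^2 + g = 0 := by
    linear_combination C (a none) * ht - g * hu
  have := congrArg (aeval (R := F) (fun l : κ => if l = j then (Polynomial.X : Polynomial F) else if l = k then 1 else 0)) ht2
  refine poly_ne h2 (a none) _ _ hj hk (aeval (R := F) (fun l : κ => if l = j then (Polynomial.X : Polynomial F) else if l = k then 1 else 0) t) ?_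
  rw [map_zero] at this
  refine Eq.trans ?_ this
  simp only [map_add, map_mul, map_pow, hg, map_sum, aeval_X, algHom_C, Polynomial.algebraMap_eq]
  congr 1
  symm
  rw [Finset.sum_eq_add j k hjk]
  · simp [hjk.symm]
  · intro c _ hc; simp [hc]
  · simp
  · simp

theorem prime_diag {F ι : Type*} [Field F] [Fintype ι] [DecidableEq ι] (h2 : (2:F) ≠ 0) (a : ι → F)
    (i j k : ι) (hij : i ≠ j) (hik : i ≠ k) (hjk : j ≠ k) (hi : a i ≠ 0) (hj : a j ≠ 0) (hk : a k ≠ 0) :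
    Prime (∑ l, C (a l) * X l ^ 2 : MvPolynomial ι F) := by
  have := prime_opt (κ := {x // x ≠ i}) h2 (a ∘ Equiv.optionSubtypeNe i) (by simpa) ⟨j, hij.symm⟩ ⟨k, hik.symm⟩
    (by simpa) (by simpa) (by simpa)
  rw [← MulEquiv.prime_iff (renameEquiv F (Equiv.optionSubtypeNe i))] at this
  convert this
  simp only [map_sum, map_mul, map_pow, renameEquiv_apply, rename_C, rename_X, Function.comp]
  exact ((Equiv.optionSubtypeNe i).sum_comp (fun l => C (a l) * X l ^ 2)).symm

theorem linPoly_add (p d : ℕ) (A : Matrix (Fin d) (Fin d) (ZMod p)) (x y : Fin d → ZMod p) :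
    linPoly p d A (x + y) = linPoly p d A x + linPoly p d A y := by
  simp only [linPoly, ← Finset.sum_add_distrib, ← add_mul, ← C_add, Pi.add_apply]

theorem linPoly_smul (p d : ℕ) (A : Matrix (Fin d) (Fin d) (ZMod p)) (c : ZMod p) (y : Fin d → ZMod p) :
    linPoly p d A (c • y) = C c * linPoly p d A y := by
  simp only [linPoly, Finset.mul_sum, Pi.smul_apply, smul_eq_mul, ← mul_assoc, ← C_mul]

theorem sum_comm4 {α β R : Type*} [Fintype α] [Fintype β] [AddCommMonoid R] (F : α → α → β → β → R) :
    ∑ i, ∑ j, ∑ l, ∑ l', F i j l l' = ∑ l, ∑ l', ∑ i, ∑ j, F i j l l' := by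
  have h1 : ∀ i, ∑ j, ∑ l, ∑ l', F i j l l' = ∑ l, ∑ l', ∑ j, F i j l l' := by
    intro i
    rw [Finset.sum_comm]
    exact Finset.sum_congr rfl fun l _ => Finset.sum_comm
  simp only [h1]
  rw [Finset.sum_comm]
  exact Finset.sum_congr rfl fun l _ => Finset.sum_comm

theorem structure_lem (p d : ℕ) [Fact p.Prime] (hp2 : (2 : ZMod p) ≠ 0)
    (A : Matrix (Fin d) (Fin d) (ZMod p)) (hA : A.IsSymm) (hdet : A.det ≠ 0)
    (V : Submodule (ZMod p) (Fin d → ZMod p)) (hV : 2 * Module.finrank (ZMod p) V + 3 ≤ d) :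
    ∃ (D : ℕ) (φ : MvPolynomial (Fin d) (ZMod p) →ₐ[ZMod p] MvPolynomial (Fin D) (ZMod p))
      (a : Fin D → ZMod p),
      Prime (∑ l, C (a l) * X l ^ 2 : MvPolynomial (Fin D) (ZMod p)) ∧
      JM p d A V = Ideal.comap φ (Ideal.span {∑ l, C (a l) * X l ^ 2}) ∧
      (∀ h, (φ (linPoly p d A h)).totalDegree ≤ 1) ∧
      (∀ h, φ (linPoly p d A h) = 0 → h ∈ V) := by
  classical
  set B : LinearMap.BilinForm (ZMod p) (Fin d → ZMod p) := Matrix.toBilin' A with hB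
  have hBa : ∀ x y, B x y = ∑ i, ∑ j, x i * A i j * y j := fun x y => Matrix.toBilin'_apply A x y
  have hnd : B.Nondegenerate := LinearMap.BilinForm.nondegenerate_toBilin'_iff_det_ne_zero.2 hdet
  have hsymm : ∀ x y, B x y = B y x := by
    intro x y
    rw [hBa, hBa, Finset.sum_comm]
    refine Finset.sum_congr rfl fun i _ => Finset.sum_congr rfl fun j _ => ?_
    rw [hA.apply]; ring
  have hrefl : B.IsRefl := by
    intro x y h; rw [hsymm]; exact h
  set W := B.orthogonal V with hW
  have hWW : B.orthogonal W = V := LinearMap.BilinForm.orthogonal_orthogonal hnd hrefl V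
  have hWdim : Module.finrank (ZMod p) W = d - Module.finrank (ZMod p) V := by
    rw [hW, LinearMap.BilinForm.finrank_orthogonal hnd]; simp
  have hI : Invertible (2 : ZMod p) := invertibleOfNonzero hp2
  have hsymm' : LinearMap.IsSymm (B.restrict W) := ⟨fun x y => by simpa using hsymm x y⟩
  obtain ⟨D, hD, b, hb⟩ : ∃ D, D = Module.finrank (ZMod p) W ∧ ∃ b : Module.Basis (Fin D) (ZMod p) W,
      ∀ l l', l ≠ l' → B (b l) (b l') = 0 := by
    obtain ⟨b, hb⟩ := LinearMap.BilinForm.exists_orthogonal_basis hsymm'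
    exact ⟨_, rfl, b, fun l l' hl => hb hl⟩
  set w : Fin D → (Fin d → ZMod p) := fun l => (b l : Fin d → ZMod p) with hw
  have hwo : ∀ l l', l ≠ l' → B (w l) (w l') = 0 := by
    intro l l' hl
    exact hb _ _ hl
  -- dual coordinates
  obtain ⟨π, hπ⟩ := LinearMap.exists_leftInverse_of_injective W.subtype (Submodule.ker_subtype W)
  have hπ' : ∀ x : W, π x = x := fun x => congrArg (fun g => g x) hπ
  set lam : Fin D → (Fin d → ZMod p) → ZMod p := fun l x => b.repr (π x) l with hlam
  set φ : MvPolynomial (Fin d) (ZMod p) →ₐ[ZMod p] MvPolynomial (Fin D) (ZMod p) :=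
    aeval (fun j => ∑ l, C (w l j) * X l) with hφ
  set ψ : MvPolynomial (Fin D) (ZMod p) →ₐ[ZMod p] MvPolynomial (Fin d) (ZMod p) :=
    aeval (fun l => ∑ i, C (lam l (Pi.single i 1)) * X i) with hψ
  set a : Fin D → ZMod p := fun l => B (w l) (w l) with ha
  have hφX : ∀ j, φ (X j) = ∑ l, C (w l j) * X l := fun j => by simp [hφ]
  have hφC : ∀ c, φ (C c) = C c := fun c => φ.commutes c
  have hψC : ∀ c, ψ (C c) = C c := fun c => ψ.commutes c
  have hφlin : ∀ h, φ (linPoly p d A h) = ∑ l, C (B h (w l)) * X l := by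
    intro h
    simp only [linPoly, map_sum φ, map_mul φ, hφX, hφC, hBa, Finset.mul_sum]
    rw [Finset.sum_comm]
    refine Finset.sum_congr rfl fun l _ => ?_
    rw [Finset.sum_comm (s := Finset.univ (α := Fin d))]
    simp only [← mul_assoc, ← C_mul, ← Finset.sum_mul, ← map_sum C]
  have hφquad : φ (quadPoly p d A) = ∑ l, C (a l) * X l ^ 2 := by
    have : φ (quadPoly p d A) = ∑ l, ∑ l', C (B (w l) (w l')) * (X l * X l') := by
      simp only [quadPoly, map_sum φ, map_mul φ, hφX, hφC, hBa, map_sum C, C_mul, Finset.sum_mul, Finset.mul_sum]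
      rw [sum_comm4]
      rw [Finset.sum_comm]
      refine Finset.sum_congr rfl fun l _ => Finset.sum_congr rfl fun l' _ =>
        Finset.sum_congr rfl fun i _ => Finset.sum_congr rfl fun j _ => ?_
      ring
    rw [this]
    refine Finset.sum_congr rfl fun l _ => ?_
    rw [Finset.sum_eq_single l]
    · simp [ha, sq]
    · intro l' _ hl; rw [hwo l l' hl.symm]; simp
    · simp
  have hmemW : ∀ l, w l ∈ W := fun l => (b l).2
  have hlinV : ∀ h ∈ V, φ (linPoly p d A h) = 0 := by
    intro h hh
    rw [hφlin]
    refine Finset.sum_eq_zero fun l _ => ?_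
    rw [LinearMap.BilinForm.mem_orthogonal_iff.1 (hmemW l) h hh]; simp
  have hlin0 : ∀ h, φ (linPoly p d A h) = 0 → h ∈ V := by
    intro h hh
    rw [hφlin] at hh
    have hz : ∀ l, B h (w l) = 0 := by
      intro l
      have := congrArg (coeff (Finsupp.single l 1)) hh
      rw [coeff_sum, Finset.sum_eq_single l] at this
      · simpa using this
      · intro l' _ hl
        rw [coeff_C_mul, coeff_X, if_neg, mul_zero]
        intro h; exact hl (Finsupp.single_left_injective one_ne_zero h)
      · simp
    rw [← hWW, LinearMap.BilinForm.mem_orthogonal_iff]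
    intro n hn
    rw [hsymm]
    have hn' := congrArg W.subtype (b.sum_repr ⟨n, hn⟩)
    simp only [map_sum, map_smul, Submodule.subtype_apply] at hn'
    rw [← hn', map_sum]
    refine Finset.sum_eq_zero fun l _ => ?_
    rw [map_smul]
    have := hz l
    simp only [hw] at this
    rw [this, smul_zero]
  have hψφ : ∀ f, ψ (φ f) - f ∈ JM p d A V := by
    intro f
    have hh : (Ideal.Quotient.mkₐ (ZMod p) (JM p d A V)).comp (ψ.comp φ) =
        Ideal.Quotient.mkₐ (ZMod p) (JM p d A V) := by
      apply MvPolynomial.algHom_ext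
      intro i
      simp only [AlgHom.comp_apply, Ideal.Quotient.mkₐ_eq_mk]
      rw [Ideal.Quotient.eq]
      set cf : (Fin d → ZMod p) →ₗ[ZMod p] ZMod p :=
        LinearMap.proj i ∘ₗ (W.subtype ∘ₗ π - LinearMap.id) with hcf
      obtain ⟨v, hv⟩ : ∃ v, ∀ x, B v x = cf x :=
        ⟨(B.toDual hnd).symm cf, fun x => by
          rw [← LinearMap.BilinForm.toDual_def hnd, LinearEquiv.apply_symm_apply]⟩
      have hvV : v ∈ V := by
        apply hlin0
        rw [hφlin]
        refine Finset.sum_eq_zero fun l _ => ?_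
        have : cf (w l) = 0 := by
          have := hπ' (b l)
          simp [hcf, hw, this]
        rw [hv, this]; simp
      have hve : ψ (φ (X i)) - X i = linPoly p d A v := by
        have hco : ∀ j, ∑ i, v i * A i j = cf (Pi.single j 1) := by
          intro j
          rw [← hv, hBa]
          refine Finset.sum_congr rfl fun i _ => ?_
          rw [Finset.sum_eq_single j]
          · simp
          · intro j' _ hj; simp [hj]
          · simp
        simp only [linPoly, hco]
        have hψX : ∀ l, ψ (X l) = ∑ i, C (lam l (Pi.single i 1)) * X i := fun l => by simp [hψ]
        have hXi : (X i : MvPolynomial (Fin d) (ZMod p)) = ∑ j, C ((Pi.single j 1 : Fin d → ZMod p) i) * X j := by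
          rw [Finset.sum_eq_single i]
          · simp
          · intro j _ hj; simp [hj.symm]
          · simp
        have hcf2 : ∀ x, cf x = ∑ l, w l i * lam l x - x i := by
          intro x
          have h := congrArg (fun y => W.subtype y i) (b.sum_repr (π x))
          simp only [map_sum, map_smul, Submodule.subtype_apply, Finset.sum_apply, Pi.smul_apply, smul_eq_mul] at h
          simp only [hcf, LinearMap.comp_apply, LinearMap.sub_apply, LinearMap.proj_apply, Pi.sub_apply, LinearMap.id_apply, Submodule.subtype_apply, ← h, hw, hlam]
          congr 1
          exact Finset.sum_congr rfl fun l _ => mul_comm _ _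
        rw [hφX, map_sum]
        simp only [map_mul ψ, hψC, hψX, hcf2, C_sub, sub_mul, Finset.sum_sub_distrib]
        rw [← hXi]
        congr 1
        simp only [Finset.mul_sum, map_sum C, Finset.sum_mul]
        rw [Finset.sum_comm]
        refine Finset.sum_congr rfl fun l _ => Finset.sum_congr rfl fun j _ => ?_
        rw [C_mul, mul_assoc]
      rw [hve]
      exact Ideal.subset_span (Or.inr ⟨v, hvV, rfl⟩)
    have := congrArg (fun g => g f) hh
    simp only [AlgHom.comp_apply, Ideal.Quotient.mkₐ_eq_mk] at this
    exact Ideal.Quotient.eq.1 this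
  refine ⟨D, φ, a, ?_, ?_, ?_, hlin0⟩
  · -- count nonzero
    have hcard : 3 ≤ (Finset.univ.filter (fun l => a l ≠ 0)).card := by
      have h1 : (Finset.univ.filter (fun l => a l = 0)).card ≤ Module.finrank (ZMod p) V := by
        have hli : LinearIndependent (ZMod p) (fun l : {l // a l = 0} => w l) := by
          have := (b.linearIndependent.map' W.subtype (Submodule.ker_subtype W))
          exact this.comp (fun l : {l // a l = 0} => (l : Fin D)) Subtype.val_injective
        have hin : ∀ l : {l // a l = 0}, w l ∈ V := by
          intro l
          apply hlin0
          rw [hφlin]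
          refine Finset.sum_eq_zero fun l' _ => ?_
          by_cases hl : (l : Fin D) = l'
          · rw [← hl]; have := l.2; simp only [ha] at this; rw [this]; simp
          · rw [hwo _ _ hl]; simp
        have hli2 : LinearIndependent (ZMod p) (fun l : {l // a l = 0} => (⟨w l, hin l⟩ : V)) :=
          LinearIndependent.of_comp V.subtype hli
        have := hli2.fintype_card_le_finrank
        rwa [Fintype.card_subtype] at this
      have h2 := Finset.card_filter_add_card_filter_not (s := (Finset.univ : Finset (Fin D))) (fun l => a l = 0)
      simp only [Finset.card_univ, Fintype.card_fin] at h2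
      simp only [ne_eq]
      omega
    obtain ⟨t, hts, ht⟩ := Finset.exists_subset_card_eq hcard
    obtain ⟨i, j, k, hij, hik, hjk, rfl⟩ := Finset.card_eq_three.1 ht
    have hn : ∀ x ∈ ({i, j, k} : Finset (Fin D)), a x ≠ 0 := fun x hx => (Finset.mem_filter.1 (hts hx)).2
    exact prime_diag hp2 a i j k hij hik hjk (hn _ (by simp)) (hn _ (by simp)) (hn _ (by simp))
  · apply le_antisymm
    · rw [JM, Ideal.span_le]
      rintro x (hx | ⟨h, hh, rfl⟩)
      · rw [Set.mem_singleton_iff.1 hx]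
        rw [SetLike.mem_coe, Ideal.mem_comap]
        rw [hφquad]; exact Ideal.mem_span_singleton_self _
      · rw [SetLike.mem_coe, Ideal.mem_comap]
        rw [hlinV h hh]; exact Ideal.zero_mem _
    · intro f hf
      rw [Ideal.mem_comap] at hf
      obtain ⟨g, hg⟩ := Ideal.mem_span_singleton.1 hf
      have hq : quadPoly p d A ∈ JM p d A V := Ideal.subset_span (Or.inl rfl)
      have h1 : ψ (φ (quadPoly p d A)) ∈ JM p d A V := by
        have := Ideal.add_mem _ (hψφ (quadPoly p d A)) hq
        simpa using this
      have h2 : ψ (φ f) ∈ JM p d A V := by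
        rw [hg, map_mul, ← hφquad]
        exact Ideal.mul_mem_right _ _ h1
      have := Ideal.sub_mem _ h2 (hψφ f)
      simpa using this
  · intro h
    rw [hφlin]
    refine totalDegree_finsetSum_le fun l _ => ?_
    refine (totalDegree_mul _ _).trans ?_
    simp

theorem JM_prime (p d : ℕ) [Fact p.Prime] (hp2 : (2 : ZMod p) ≠ 0)
    (A : Matrix (Fin d) (Fin d) (ZMod p)) (hA : A.IsSymm) (hdet : A.det ≠ 0)
    (V : Submodule (ZMod p) (Fin d → ZMod p)) (hV : 2 * Module.finrank (ZMod p) V + 3 ≤ d) :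
    (JM p d A V).IsPrime ∧ ∀ h, linPoly p d A h ∈ JM p d A V → h ∈ V := by
  obtain ⟨D, φ, a, hq, hJ, hdeg, h0⟩ := structure_lem p d hp2 A hA hdet V hV
  have hP : (Ideal.span {∑ l, C (a l) * X l ^ 2} : Ideal (MvPolynomial (Fin D) (ZMod p))).IsPrime :=
    (Ideal.span_singleton_prime hq.ne_zero).2 hq
  refine ⟨by rw [hJ]; exact Ideal.IsPrime.comap φ, fun h hh => h0 h ?_⟩
  rw [hJ, Ideal.mem_comap, Ideal.mem_span_singleton] at hh
  obtain ⟨g, hg⟩ := hh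
  by_contra hne
  have hg0 : g ≠ 0 := by rintro rfl; simp at hg; exact hne hg
  have h1 := hdeg h
  rw [hg, totalDegree_mul_of_isDomain hq.ne_zero hg0] at h1
  have hhom : (∑ l, C (a l) * X l ^ 2 : MvPolynomial (Fin D) (ZMod p)).IsHomogeneous 2 := by
    refine IsHomogeneous.sum _ _ _ fun l _ => ?_
    exact (isHomogeneous_C_mul_X_pow _ _ _)
  rw [hhom.totalDegree hq.ne_zero] at h1
  omega

theorem linPoly_hom (p d : ℕ) (A : Matrix (Fin d) (Fin d) (ZMod p)) (h : Fin d → ZMod p) :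
    (linPoly p d A h).IsHomogeneous 1 :=
  IsHomogeneous.sum _ _ _ fun l _ => isHomogeneous_C_mul_X _ _

theorem quadPoly_hom (p d : ℕ) (A : Matrix (Fin d) (Fin d) (ZMod p)) :
    (quadPoly p d A).IsHomogeneous 2 :=
  IsHomogeneous.sum _ _ _ fun i _ => IsHomogeneous.sum _ _ _ fun j _ => by
    have := (isHomogeneous_C (Fin d) (A i j)).mul ((isHomogeneous_X (ZMod p) i).mul (isHomogeneous_X (ZMod p) j))
    simpa using this

theorem low_degree (p d : ℕ) (A : Matrix (Fin d) (Fin d) (ZMod p)) (V : Set (Fin d → ZMod p))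
    (N : ℕ) (f Q g : MvPolynomial (Fin d) (ZMod p)) (hQ : Q.IsHomogeneous N) (hf : f.totalDegree < N)
    (h : f - Q * g ∈ JM p d A V) : f ∈ JM p d A V := by
  letI : GradedAlgebra (homogeneousSubmodule (Fin d) (ZMod p)) := gradedAlgebra
  have hJ : (JM p d A V).IsHomogeneous (homogeneousSubmodule (Fin d) (ZMod p)) := by
    apply Ideal.homogeneous_span
    rintro x (hx | ⟨h, hh, rfl⟩)
    · rw [Set.mem_singleton_iff.1 hx]
      exact ⟨2, quadPoly_hom p d A⟩
    · exact ⟨1, linPoly_hom p d A h⟩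
  rw [← sum_homogeneousComponent f]
  refine Ideal.sum_mem _ fun n hn => ?_
  have hn' : ¬ N ≤ n := by have := Finset.mem_range.1 hn; omega
  have h1 := hJ n h
  have h2 := DirectSum.coe_decompose_mul_of_left_mem_of_not_le
    (homogeneousSubmodule (Fin d) (ZMod p)) (b := g) (show Q ∈ homogeneousSubmodule (Fin d) (ZMod p) N from hQ) hn'
  rw [DirectSum.decompose_sub, DirectSum.sub_apply, AddSubgroupClass.coe_sub, h2, sub_zero] at h1
  rw [← decomposition.decompose'_apply]
  exact h1

theorem JM_sup (p d : ℕ) [Fact p.Prime] (A : Matrix (Fin d) (Fin d) (ZMod p))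
    (V : Submodule (ZMod p) (Fin d → ZMod p)) (h : Fin d → ZMod p) (x : MvPolynomial (Fin d) (ZMod p))
    (hx : x ∈ JM p d A (Submodule.span (ZMod p) {h} ⊔ V : Submodule (ZMod p) (Fin d → ZMod p))) :
    ∃ g, x - linPoly p d A h * g ∈ JM p d A V := by
  have hle : JM p d A (Submodule.span (ZMod p) {h} ⊔ V : Submodule (ZMod p) (Fin d → ZMod p)) ≤
      Ideal.span {linPoly p d A h} ⊔ JM p d A V := by
    rw [JM, Ideal.span_le]
    rintro x (hx | ⟨y, hy, rfl⟩)
    · exact Ideal.mem_sup_right (Ideal.subset_span (Or.inl hx))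
    · obtain ⟨z, hz, v, hv, rfl⟩ := Submodule.mem_sup.1 hy
      obtain ⟨c, rfl⟩ := Submodule.mem_span_singleton.1 hz
      rw [SetLike.mem_coe, linPoly_add, linPoly_smul]
      exact Ideal.add_mem _ (Ideal.mem_sup_left (Ideal.mul_mem_left _ _ (Ideal.mem_span_singleton_self _)))
        (Ideal.mem_sup_right (Ideal.subset_span (Or.inr ⟨v, hv, rfl⟩)))
  obtain ⟨y, hy, z, hz, rfl⟩ := Submodule.mem_sup.1 (hle hx)
  obtain ⟨g, rfl⟩ := Ideal.mem_span_singleton.1 hy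
  exact ⟨g, by simpa using hz⟩

theorem JM_mono (p d : ℕ) (A : Matrix (Fin d) (Fin d) (ZMod p))
    {V W : Set (Fin d → ZMod p)} (h : V ⊆ W) : JM p d A V ≤ JM p d A W :=
  Ideal.span_mono (Set.union_subset_union_right _ (Set.image_mono h))

open Classical in
theorem card_le_pow (p d : ℕ) [Fact p.Prime] (W : Submodule (ZMod p) (Fin d → ZMod p))
    (P : Finset (Fin d → ZMod p)) (n : ℕ) (hn : Module.finrank (ZMod p) W ≤ n) :
    (P.filter (· ∈ W)).card ≤ p ^ n := by
  have h1 : Nat.card W = p ^ Module.finrank (ZMod p) W := by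
    rw [Module.natCard_eq_pow_finrank (K := ZMod p), Nat.card_zmod]
  calc (P.filter (· ∈ W)).card ≤ Nat.card W := by
        rw [← Nat.card_eq_finsetCard]
        exact Nat.card_le_card_of_injective (fun x => (⟨x.1, (Finset.mem_filter.1 x.2).2⟩ : W))
          (fun x y h => Subtype.ext (by simpa using h))
    _ ≤ p ^ n := by rw [h1]; exact Nat.pow_le_pow_right (Fact.out : p.Prime).pos hn

open Classical in
theorem step (p d s : ℕ) [Fact p.Prime] (hp2 : (2 : ZMod p) ≠ 0)
    (A : Matrix (Fin d) (Fin d) (ZMod p)) (hA : A.IsSymm) (hdet : A.det ≠ 0)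
    (V : Submodule (ZMod p) (Fin d → ZMod p)) (hV : 2 * (Module.finrank (ZMod p) V + 1) + 3 ≤ d)
    (P : Finset (Fin d → ZMod p)) (hPV : ∀ x ∈ P, x ∉ V)
    (hcard : s * p ^ (Module.finrank (ZMod p) V + 1) < P.card)
    (f : MvPolynomial (Fin d) (ZMod p)) (hf : f.totalDegree ≤ s)
    (hfP : ∀ h ∈ P, f ∈ JM p d A (Submodule.span (ZMod p) {h} ⊔ V : Submodule (ZMod p) (Fin d → ZMod p))) :
    f ∈ JM p d A V := by
  have hfr : ∀ h, Module.finrank (ZMod p) (Submodule.span (ZMod p) {h} ⊔ V : Submodule (ZMod p) (Fin d → ZMod p)) ≤ Module.finrank (ZMod p) V + 1 := by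
    intro h
    have h1 := Submodule.finrank_add_le_finrank_add_finrank (Submodule.span (ZMod p) {h}) V
    have h2 : Module.finrank (ZMod p) (Submodule.span (ZMod p) {h}) ≤ 1 := by
      simpa using finrank_span_le_card (R := ZMod p) ({h} : Set (Fin d → ZMod p))
    omega
  have key : ∀ N, N ≤ s + 1 → ∃ T : Finset (Fin d → ZMod p), T ⊆ P ∧ T.card = N ∧
      ∃ g, f - (∏ h ∈ T, linPoly p d A h) * g ∈ JM p d A V := by
    intro N
    induction N with
    | zero => exact fun _ => ⟨∅, by simp, by simp, f, by simp⟩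
    | succ N ih =>
      intro hN
      obtain ⟨T, hTP, hT, g, hg⟩ := ih (by omega)
      obtain ⟨x, hxP, hx⟩ : ∃ x ∈ P, ∀ h ∈ T, x ∉ (Submodule.span (ZMod p) {h} ⊔ V : Submodule (ZMod p) (Fin d → ZMod p)) := by
        by_contra hcon
        push Not at hcon
        have hsub : P ⊆ T.biUnion (fun h => P.filter (· ∈ (Submodule.span (ZMod p) {h} ⊔ V : Submodule (ZMod p) (Fin d → ZMod p)))) := by
          intro x hx
          obtain ⟨h, hh, hxh⟩ := hcon x hx
          exact Finset.mem_biUnion.2 ⟨h, hh, Finset.mem_filter.2 ⟨hx, hxh⟩⟩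
        have h1 := (Finset.card_le_card hsub).trans
          (Finset.card_biUnion_le_card_mul T _ _ (fun h _ => card_le_pow p d _ P _ (hfr h)))
        have h2 : T.card * p ^ (Module.finrank (ZMod p) V + 1) ≤ s * p ^ (Module.finrank (ZMod p) V + 1) :=
          Nat.mul_le_mul_right _ (by omega)
        omega
      have hxT : x ∉ T := fun hxT => hx x hxT (Submodule.mem_sup_left (Submodule.mem_span_singleton_self x))
      refine ⟨insert x T, Finset.insert_subset hxP hTP, by rw [Finset.card_insert_of_notMem hxT, hT], ?_⟩
      obtain ⟨hpr, hlin⟩ := JM_prime p d hp2 A hA hdet (Submodule.span (ZMod p) {x} ⊔ V) (by have := hfr x; omega)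
      have h1 : (∏ h ∈ T, linPoly p d A h) * g ∈ JM p d A (Submodule.span (ZMod p) {x} ⊔ V : Submodule (ZMod p) (Fin d → ZMod p)) := by
        have := Ideal.sub_mem _ (hfP x hxP) (JM_mono p d A (show (V : Set (Fin d → ZMod p)) ⊆ (Submodule.span (ZMod p) {x} ⊔ V : Submodule (ZMod p) (Fin d → ZMod p)) from fun v hv => Submodule.mem_sup_right hv) hg)
        simpa using this
      have h2 : g ∈ JM p d A (Submodule.span (ZMod p) {x} ⊔ V : Submodule (ZMod p) (Fin d → ZMod p)) := by
        refine (hpr.mem_or_mem h1).resolve_left fun h3 => ?_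
        obtain ⟨h, hh, h4⟩ := hpr.prod_mem_iff.1 h3
        have h5 := hlin h h4
        obtain ⟨z, hz, v, hv, hzv⟩ := Submodule.mem_sup.1 h5
        obtain ⟨c, rfl⟩ := Submodule.mem_span_singleton.1 hz
        have hc : c ≠ 0 := by
          rintro rfl
          apply hPV h (hTP hh)
          rw [← hzv]; simpa using hv
        apply hx h hh
        have : x = c⁻¹ • h + (-c⁻¹) • v := by
          rw [← hzv, smul_add, smul_smul, inv_mul_cancel₀ hc]; simp
        rw [this]
        exact Submodule.add_mem_sup (Submodule.smul_mem _ _ (Submodule.mem_span_singleton_self h)) (V.smul_mem _ hv)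
      obtain ⟨g', hg'⟩ := JM_sup p d A V x g h2
      refine ⟨g', ?_⟩
      rw [Finset.prod_insert hxT]
      have := Ideal.add_mem _ hg (Ideal.mul_mem_left _ (∏ h ∈ T, linPoly p d A h) hg')
      convert this using 1
      ring
  obtain ⟨T, _, hT, g, hg⟩ := key (s + 1) le_rfl
  refine low_degree p d A V (s + 1) f _ g ?_ (by omega) hg
  have := IsHomogeneous.prod T (linPoly p d A) (fun _ => 1) (fun h _ => linPoly_hom p d A h)
  simpa [hT] using this

/-- **Intersection property for a large collection of `M`-ideals.** -/
theorem stmt8 (d d' m k s : ℕ) (hd : 1 ≤ d) (hd' : 1 ≤ d') (δ : ℝ) (hδ : 0 < δ) :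
    ∃ p0 : ℕ, ∀ p : ℕ, p.Prime → p0 ≤ p →
    ∀ (M : (Fin d → ZMod p) → ZMod p) (A : Matrix (Fin d) (Fin d) (ZMod p))
      (uu : Fin d → ZMod p) (vv : ZMod p),
      IsQuadFormWith p d M A uu vv → A.det ≠ 0 →
    ∀ (V : Submodule (ZMod p) (Fin d → ZMod p))
      (U : Fin k → Submodule (ZMod p) (Fin d → ZMod p)),
      (∀ i j, Module.finrank (ZMod p) (U i) = Module.finrank (ZMod p) (U j)) →
      (∀ i, VecSubIndep p d (![] : Fin 0 → Fin d → ZMod p) (U i) V) →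
    ∀ P : Finset (Fin d → ZMod p), δ * (p : ℝ) ^ d' < (P.card : ℝ) →
    ∀ f : MvPolynomial (Fin d) (ZMod p), f.totalDegree ≤ s →
      (∀ h : Fin m → Fin d → ZMod p, (∀ ℓ, h ℓ ∈ P) →
        (∀ i : Fin (k + 1),
          VecSubIndep p d h ((Fin.cons ⊥ U : Fin (k + 1) → Submodule (ZMod p) (Fin d → ZMod p)) i) V) →
        f ∈ JM p d A
          ((Submodule.span (ZMod p) (Set.range h) ⊔ V : Submodule (ZMod p) (Fin d → ZMod p)) :
            Set (Fin d → ZMod p))) →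
      (Module.finrank (ZMod p) V + m + s ≤ d' ∧
        Module.finrank (ZMod p)
            ((Fin.cons ⊥ U : Fin (k + 1) → Submodule (ZMod p) (Fin d → ZMod p)) (Fin.last k)) +
          Module.finrank (ZMod p) V + m ≤ d' ∧
        2 * Module.finrank (ZMod p) V + 2 * m + 5 ≤ d') →
      f ∈ JM p d A (V : Set (Fin d → ZMod p)) := by
  classical
  obtain ⟨n0, hn0⟩ := exists_nat_gt ((k + s + 2 : ℝ) / δ)
  refine ⟨n0 + 3, ?_⟩
  intro p hpp hp M A uu vv hM hdet V U hUdim hUV P hP f hf hfP hdims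
  obtain ⟨-, hdU, hdV⟩ := hdims
  haveI : Fact p.Prime := ⟨hpp⟩
  have hA := hM.1
  have hp2 : (2 : ZMod p) ≠ 0 := by
    intro h
    have h2 : ((2 : ℕ) : ZMod p) = 0 := by exact_mod_cast h
    rw [ZMod.natCast_eq_zero_iff] at h2
    have := Nat.le_of_dvd (by norm_num) h2
    omega
  -- cardinality
  have hPc : (k + s + 2) * p ^ (d' - 1) < P.card := by
    have h1 : (k + s + 2 : ℝ) < δ * p := by
      rw [div_lt_iff₀ hδ] at hn0
      have : (n0 : ℝ) ≤ p := by exact_mod_cast (by omega : n0 ≤ p)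
      nlinarith
    have h2 : (p : ℝ) ^ d' = p * p ^ (d' - 1) := by
      rw [← pow_succ']; congr 1; omega
    have h3 : (0 : ℝ) < (p : ℝ) ^ (d' - 1) := by
      have : (0 : ℝ) < p := by exact_mod_cast hpp.pos
      positivity
    have h4 : ((k + s + 2 : ℝ)) * (p : ℝ) ^ (d' - 1) < P.card := by
      refine lt_trans ?_ hP
      rw [h2, ← mul_assoc]
      exact mul_lt_mul_of_pos_right h1 h3
    exact_mod_cast h4
  have hdd : d' ≤ d := by
    have h1 : P.card ≤ p ^ d := by
      refine (Finset.card_le_univ P).trans ?_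
      simp [ZMod.card]
    have h2 : p ^ (d' - 1) < p ^ d := by
      refine lt_of_le_of_lt ?_ (lt_of_lt_of_le hPc h1)
      exact Nat.le_mul_of_pos_left _ (by omega)
    have := (Nat.pow_lt_pow_iff_right hpp.one_lt).1 h2
    omega
  set UU : Fin (k + 1) → Submodule (ZMod p) (Fin d → ZMod p) := Fin.cons ⊥ U with hUU
  have hUr : ∀ i, Module.finrank (ZMod p) (UU i) ≤ Module.finrank (ZMod p) (UU (Fin.last k)) := by
    intro i
    refine Fin.cases ?_ (fun i => ?_) i
    · rw [show UU 0 = ⊥ from rfl]; simp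
    · obtain ⟨k', rfl⟩ : ∃ k', k = k' + 1 := ⟨k - 1, by have := i.2; omega⟩
      rw [← Fin.succ_last]
      change Module.finrank (ZMod p) (U i) ≤ Module.finrank (ZMod p) (U _)
      exact (hUdim _ _).le
  have main : ∀ n j, j + n = m → ∀ h : Fin j → Fin d → ZMod p, (∀ ℓ, h ℓ ∈ P) →
      (∀ i, VecSubIndep p d h (UU i) V) →
      f ∈ JM p d A ((Submodule.span (ZMod p) (Set.range h) ⊔ V : Submodule (ZMod p) (Fin d → ZMod p)) :
            Set (Fin d → ZMod p)) := by
    intro n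
    induction n with
    | zero =>
      intro j hj
      obtain rfl : j = m := by omega
      exact hfP
    | succ n ih =>
      intro j hj h hhP hhI
      set S := Submodule.span (ZMod p) (Set.range h) with hS
      have hSr : Module.finrank (ZMod p) S ≤ j := by
        simpa [Set.finrank] using finrank_range_le_card (R := ZMod p) h
      have hSV : Module.finrank (ZMod p) (S ⊔ V : Submodule (ZMod p) (Fin d → ZMod p)) ≤ j + Module.finrank (ZMod p) V := by
        have := Submodule.finrank_add_le_finrank_add_finrank S V
        omega
      set P' := P.filter (fun x => ∀ i, x ∉ (S ⊔ V ⊔ UU i : Submodule (ZMod p) (Fin d → ZMod p))) with hP'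
      refine step p d s hp2 A hA hdet (S ⊔ V) (by omega) P' ?_ ?_ f hf ?_
      · intro x hx hxV
        exact (Finset.mem_filter.1 hx).2 0 (Submodule.mem_sup_left hxV)
      · have hsub : P ⊆ P' ∪ Finset.univ.biUnion (fun i => P.filter (· ∈ (S ⊔ V ⊔ UU i : Submodule (ZMod p) (Fin d → ZMod p)))) := by
          intro x hx
          rw [Finset.mem_union]
          by_cases hx' : ∀ i, x ∉ (S ⊔ V ⊔ UU i : Submodule (ZMod p) (Fin d → ZMod p))
          · exact Or.inl (Finset.mem_filter.2 ⟨hx, hx'⟩)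
          · push Not at hx'
            obtain ⟨i, hi⟩ := hx'
            exact Or.inr (Finset.mem_biUnion.2 ⟨i, Finset.mem_univ _, Finset.mem_filter.2 ⟨hx, hi⟩⟩)
        have h1 := (Finset.card_le_card hsub).trans (Finset.card_union_le _ _)
        have h2 := Finset.card_biUnion_le_card_mul (Finset.univ : Finset (Fin (k + 1)))
          (fun i => P.filter (· ∈ (S ⊔ V ⊔ UU i : Submodule (ZMod p) (Fin d → ZMod p)))) (p ^ (d' - 1))
          (fun i _ => card_le_pow p d _ P _ (by
            have := Submodule.finrank_add_le_finrank_add_finrank (S ⊔ V) (UU i)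
            have := hUr i
            omega))
        rw [Finset.card_univ, Fintype.card_fin] at h2
        have h3 : s * p ^ (Module.finrank (ZMod p) (S ⊔ V : Submodule (ZMod p) (Fin d → ZMod p)) + 1) ≤ s * p ^ (d' - 1) :=
          Nat.mul_le_mul_left _ (Nat.pow_le_pow_right hpp.pos (by omega))
        have h4 : (k + s + 2) * p ^ (d' - 1) = (k + 1) * p ^ (d' - 1) + s * p ^ (d' - 1) + p ^ (d' - 1) := by ring
        omega
      · intro x hx
        obtain ⟨hxP, hxi⟩ := Finset.mem_filter.1 hx
        have := ih (j + 1) (by omega) (Fin.cons x h) (fun ℓ => by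
            refine Fin.cases ?_ (fun i => ?_) ℓ
            · simpa using hxP
            · simpa using hhP i) ?_
        · rw [Fin.range_cons, Submodule.span_insert, sup_assoc] at this
          exact this
        · intro i c u hu w hw hsum
          rw [Fin.sum_univ_succ] at hsum
          simp only [Fin.cons_zero, Fin.cons_succ] at hsum
          have hSm : ∀ c' : Fin j → ZMod p, ∑ ℓ, c' ℓ • h ℓ ∈ S := fun c' =>
            Submodule.sum_mem _ fun ℓ _ => Submodule.smul_mem _ _ (Submodule.subset_span ⟨ℓ, rfl⟩)
          have hc0 : c 0 = 0 := by
            by_contra hc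
            apply hxi i
            have hx1 : x = (-(c 0)⁻¹) • ((∑ ℓ : Fin j, c ℓ.succ • h ℓ) + w + u) := by
              have h1 : (∑ ℓ : Fin j, c ℓ.succ • h ℓ) + w + u = - (c 0 • x) := by
                rw [eq_neg_iff_add_eq_zero, ← hsum]; abel
              rw [h1, smul_neg, neg_smul, neg_neg, smul_smul, inv_mul_cancel₀ hc, one_smul]
            rw [hx1]
            exact Submodule.smul_mem _ _ (Submodule.add_mem_sup (Submodule.add_mem_sup (hSm _) hw) hu)
          rw [hc0, zero_smul, zero_add] at hsum
          obtain ⟨h1, h2, h3⟩ := hhI i (fun ℓ => c ℓ.succ) u hu w hw hsum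
          exact ⟨fun ℓ => Fin.cases hc0 h1 ℓ, h2, h3⟩
  have h0 := main m 0 (by omega) ![] (fun ℓ => ℓ.elim0) (fun i => by
    refine Fin.cases ?_ (fun i => ?_) i
    · intro c u hu w hw hsum
      have hu : u = 0 := hu
      subst hu
      simp at hsum
      exact ⟨fun ℓ => ℓ.elim0, rfl, hsum⟩
    · exact hUV i)
  simpa using h0
end
end
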